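/- Let ν ≥ 2 be an integer and let P(X) = c_ν X^ν + ⋯ + c_1 X + c₀ ∈ ℤ[X] be a polynomial with nonzero discriminant, and set f_P(n) = #{1 ≤ d ≤ n : P(d) ≡ 0 (mod n)}. Then there exist constants c > 0 and C > 0 depending only on P such that for all x ≥ 3, | Σ_{n ≤ x} μ(n)·f_P(n) | ≤ C·x·exp( −c·( log x / log log x )^{1/3} ). -/

import Mathlib

open Finset Filter

/-- The pairs `(a, q)` with `1 ≤ a ≤ q ≤ Q` and `gcd (P(a), q) = 1`, indexing the
polynomial Farey fractions `a / q` of order `Q`. -/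
def fareyPairs (P : Polynomial ℤ) (Q : ℕ) : Finset (ℕ × ℕ) :=
  (Finset.Icc 1 Q ×ˢ Finset.Icc 1 Q).filter
    (fun x => x.1 ≤ x.2 ∧ Int.gcd (P.eval (x.1 : ℤ)) (x.2 : ℤ) = 1)

/-- The set of polynomial Farey fractions of order `Q`. -/
def fareySet (P : Polynomial ℤ) (Q : ℕ) : Finset ℚ :=
  (fareyPairs P Q).image (fun x => (x.1 : ℚ) / (x.2 : ℚ))

/-- `f_P(m)` is the number of `1 ≤ d ≤ m` with `P(d) ≡ 0 (mod m)`. -/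
def fP (P : Polynomial ℤ) (m : ℕ) : ℕ :=
  ((Finset.Icc 1 m).filter (fun d : ℕ => (m : ℤ) ∣ P.eval (d : ℤ))).card

/-- `β_P = ∏_p (1 - f_P(p)/p²)`, the product over all primes. -/
noncomputable def betaP (P : Polynomial ℤ) : ℝ :=
  ∏' p : Nat.Primes, (1 - (fP P (p : ℕ) : ℝ) / ((p : ℕ) : ℝ) ^ 2)

open scoped Classical in
/-- Pair correlation measure `S_F(Λ)` of a finite set `F ⊂ ℝ/ℤ` (represented by
rationals): `(1/N) · #{(a,b) ∈ F² : a ≠ b, a - b ∈ (1/N)(0,Λ) + ℤ}`. -/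
noncomputable def pairCorr (F : Finset ℚ) (Λ : ℝ) : ℝ :=
  (((F ×ˢ F).filter (fun x => x.1 ≠ x.2 ∧
      ∃ k : ℤ, ((x.1 : ℝ) - (x.2 : ℝ) - (k : ℝ)) * (F.card : ℝ) ∈ Set.Ioo 0 Λ)).card : ℝ) /
    (F.card : ℝ)

section
open Complex Metric in
lemma landau_nozero {f : ℂ → ℂ} {r M : ℝ} (hr : 0 < r) 
    (hf : DifferentiableOn ℂ f (ball 0 r)) (hM : ∀ z ∈ ball (0:ℂ) r, ‖f z‖ ≤ M)
    (hz : ∀ z ∈ ball (0:ℂ) r, f z ≠ 0) :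
    ∃ L : ℂ → ℂ, L 0 = 0 ∧ (∀ z ∈ ball (0:ℂ) r, HasDerivAt L (deriv f z / f z) z) ∧
      (∀ z ∈ ball (0:ℂ) r, f z = f 0 * exp (L z)) ∧
      (∀ z ∈ ball (0:ℂ) r, ‖L z‖ ≤ 2 * Real.log (M / ‖f 0‖) * ‖z‖ / (r - ‖z‖)) := by
  have h0 : (0:ℂ) ∈ ball (0:ℂ) r := by simpa using hr
  have hfd : ∀ z ∈ ball (0:ℂ) r, HasDerivAt f (deriv f z) z := fun z hz =>
    (hf.differentiableAt (isOpen_ball.mem_nhds hz)).hasDerivAt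
  have hd : DifferentiableOn ℂ (fun z => deriv f z / f z) (ball 0 r) :=
    (hf.deriv isOpen_ball).div hf hz
  obtain ⟨L, hL0, hL⟩ := hd.isExactOn_ball.with_val_at 0 0
  have key : ∀ z ∈ ball (0:ℂ) r, f z = f 0 * exp (L z) := by
    have hcon : ∀ z ∈ ball (0:ℂ) r, HasDerivAt (fun z => f z * exp (- L z)) 0 z := by
      intro z hzb
      have h1 := (hfd z hzb).mul ((hL z hzb).neg.cexp)
      have h2 := hz z hzb
      have h3 : deriv f z * exp (-L z) + f z * (exp (-L z) * -(deriv f z / f z)) = 0 := by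
        field_simp
        ring
      rw [← h3]
      exact h1
    intro z hzb
    have hc := (convex_ball (0:ℂ) r).is_const_of_fderivWithin_eq_zero (𝕜 := ℂ)
      (f := fun z => f z * exp (- L z)) 
      (fun x hx => (hcon x hx).differentiableAt.differentiableWithinAt)
      (fun x hx => by
        rw [fderivWithin_of_isOpen isOpen_ball hx]
        have := (hcon x hx).hasFDerivAt.fderiv
        rw [this]; ext; simp) hzb h0
    simp only [hL0, neg_zero, exp_zero, mul_one] at hc
    rw [← hc, mul_assoc, ← exp_add]; simp
  refine ⟨L, hL0, hL, key, ?_⟩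
  have hf0 : 0 < ‖f 0‖ := norm_pos_iff.2 (hz 0 h0)
  have hre : ∀ z ∈ ball (0:ℂ) r, (L z).re ≤ Real.log (M / ‖f 0‖) := by
    intro z hzb
    have h1 := hM z hzb
    rw [key z hzb, norm_mul, norm_exp] at h1
    rw [Real.le_log_iff_exp_le (div_pos (lt_of_lt_of_le (by positivity) h1) hf0), le_div_iff₀ hf0]
    linarith
  have hm0 : 0 ≤ Real.log (M / ‖f 0‖) := by simpa [hL0] using hre 0 h0
  intro z hzb
  have hzr : ‖z‖ < r := by simpa using hzb
  have hLd : DifferentiableOn ℂ L (ball 0 r) := fun z hz =>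
    (hL z hz).differentiableAt.differentiableWithinAt
  have hlim : ∀ ε > 0, ‖L z‖ ≤ 2 * (Real.log (M / ‖f 0‖) + ε) * ‖z‖ / (r - ‖z‖) := fun ε hε =>
    borelCaratheodory_zero (by positivity) hLd (fun w hw => by
      simp only [Set.mem_ofPred_eq]; linarith [hre w hw]) hr hzb hL0
  have hc : Continuous fun ε : ℝ => 2 * (Real.log (M / ‖f 0‖) + ε) * ‖z‖ / (r - ‖z‖) := by fun_prop
  have ht : Filter.Tendsto (fun ε : ℝ => 2 * (Real.log (M / ‖f 0‖) + ε) * ‖z‖ / (r - ‖z‖))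
      (nhdsWithin 0 (Set.Ioi 0)) (nhds (2 * (Real.log (M / ‖f 0‖) + 0) * ‖z‖ / (r - ‖z‖))) :=
    (hc.tendsto 0).mono_left nhdsWithin_le_nhds
  have := ge_of_tendsto ht
    (by filter_upwards [self_mem_nhdsWithin] with ε hε using hlim ε hε)
  simpa using this

open Complex Metric in
lemma landau_nozero_deriv {f : ℂ → ℂ} {r M : ℝ} (hr : 0 < r) 
    (hf : DifferentiableOn ℂ f (ball 0 r)) (hM : ∀ z ∈ ball (0:ℂ) r, ‖f z‖ ≤ M)
    (hz : ∀ z ∈ ball (0:ℂ) r, f z ≠ 0) :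
    ‖deriv f 0 / f 0‖ ≤ 2 * Real.log (M / ‖f 0‖) / r := by
  obtain ⟨L, hL0, hL, -, hb⟩ := landau_nozero hr hf hM hz
  have h0 : (0:ℂ) ∈ ball (0:ℂ) r := by simpa using hr
  have ht := (hL 0 h0).tendsto_slope.norm
  have hc : ContinuousAt (fun z : ℂ => 2 * Real.log (M / ‖f 0‖) / (r - ‖z‖)) 0 := by
    apply ContinuousAt.div <;> [fun_prop; fun_prop; simpa using hr.ne']
  have hc2 := hc.tendsto.mono_left (nhdsWithin_le_nhds (s := {0}ᶜ))
  simp only [norm_zero, sub_zero] at hc2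
  refine le_of_tendsto_of_tendsto ht hc2 ?_
  filter_upwards [self_mem_nhdsWithin, nhdsWithin_le_nhds (isOpen_ball.mem_nhds h0)] with z hz1 hz2
  have hzn : 0 < ‖z‖ := norm_pos_iff.2 hz1
  have := hb z hz2
  simp only [slope, hL0, vsub_eq_sub, sub_zero, norm_smul, norm_inv]
  rw [inv_mul_le_iff₀ hzn]
  calc _ ≤ _ := this
    _ = _ := by ring


open Complex Metric in
lemma landau_step {f : ℂ → ℂ} {r R M : ℝ} (hr : 0 < r) (hrR : r < R)
    (hf : DifferentiableOn ℂ f (ball 0 R)) (hM : ∀ z ∈ closedBall (0:ℂ) r, ‖f z‖ ≤ M)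
    (hf0 : f 0 ≠ 0) {ρ : ℂ} (hρ : ρ ∈ ball (0:ℂ) (r/2)) (hfρ : f ρ = 0) :
    ∃ g : ℂ → ℂ, DifferentiableOn ℂ g (ball 0 R) ∧ (∀ z ∈ closedBall (0:ℂ) r, ‖g z‖ ≤ M) ∧
      g 0 ≠ 0 ∧ 2 * ‖f 0‖ ≤ ‖g 0‖ ∧ (∀ z ∈ ball (0:ℂ) (r/2), g z = 0 → f z = 0) ∧
      deriv f 0 / f 0 = deriv g 0 / g 0 + (-1/ρ + (starRingEnd ℂ) ρ / r^2) := by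
  have hρ0 : ρ ≠ 0 := by rintro rfl; exact hf0 hfρ
  have hρn : ‖ρ‖ < r/2 := by simpa using hρ
  have hρR : ρ ∈ ball (0:ℂ) R := by simp; linarith
  have h0R : (0:ℂ) ∈ ball (0:ℂ) R := by simp; linarith
  have hrc : (r:ℂ) ≠ 0 := by exact_mod_cast hr.ne'
  have hds : DifferentiableOn ℂ (dslope f ρ) (ball 0 R) :=
    (differentiableOn_dslope (isOpen_ball.mem_nhds hρR)).2 hf
  have hfs : ∀ z, f z = (z - ρ) * dslope f ρ z := by
    intro z
    have := sub_smul_dslope f ρ z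
    rw [hfρ, sub_zero, smul_eq_mul] at this
    exact this.symm
  set g : ℂ → ℂ := fun z => dslope f ρ z * ((r^2 - (starRingEnd ℂ) ρ * z) / r) with hg
  have hgd : DifferentiableOn ℂ g (ball 0 R) := hds.mul (by fun_prop)
  have hsp : ∀ z : ℂ, ‖z‖ = r → ‖(r:ℂ)^2 - (starRingEnd ℂ) ρ * z‖ = r * ‖z - ρ‖ := by
    intro z hz
    have : (r:ℂ)^2 = z * (starRingEnd ℂ) z := by
      rw [mul_conj, normSq_eq_norm_sq, hz]; push_cast; ring
    rw [this, show z * (starRingEnd ℂ) z - (starRingEnd ℂ) ρ * z = z * (starRingEnd ℂ) (z - ρ) by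
      rw [map_sub]; ring, norm_mul, hz, norm_conj]
  have hg0 : g 0 = -(f 0) * r / ρ := by
    have := hfs 0
    simp only [hg]
    rw [this]; field_simp; ring
  have hg0n : ‖g 0‖ = ‖f 0‖ * r / ‖ρ‖ := by
    rw [hg0, norm_div, norm_mul, norm_neg, norm_real, Real.norm_of_nonneg hr.le]
  have hρp : 0 < ‖ρ‖ := norm_pos_iff.2 hρ0
  refine ⟨g, hgd, ?_, ?_, ?_, ?_, ?_⟩
  · intro z hz
    have hdc : DiffContOnCl ℂ g (ball 0 r) := by
      apply DifferentiableOn.diffContOnCl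
      rw [closure_ball _ hr.ne']
      exact hgd.mono (closedBall_subset_ball hrR)
    refine norm_le_of_forall_mem_frontier_norm_le isBounded_ball hdc ?_ (by rwa [closure_ball _ hr.ne'])
    intro w hw
    rw [frontier_ball _ hr.ne', mem_sphere_zero_iff_norm] at hw
    have hwn : w - ρ ≠ 0 := by
      intro h; rw [sub_eq_zero] at h; rw [← h, hw] at hρn; linarith
    have h1 := hM w (by simp [hw])
    rw [hfs w, norm_mul] at h1
    simp only [hg, norm_mul, norm_div, hsp w hw, norm_real, Real.norm_of_nonneg hr.le]
    calc _ = ‖w - ρ‖ * ‖dslope f ρ w‖ := by field_simp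
      _ ≤ M := h1
  · rw [hg0]; simp [hf0, hρ0, hr.ne']
  · rw [hg0n, le_div_iff₀ hρp]
    nlinarith [norm_pos_iff.2 hf0]
  · intro z hz hgz
    have hzn : ‖z‖ < r/2 := by simpa using hz
    simp only [hg, mul_eq_zero, div_eq_zero_iff, hrc, or_false] at hgz
    rcases hgz with h | h
    · rw [hfs z, h, mul_zero]
    · exfalso
      rw [sub_eq_zero] at h
      have : r^2 = ‖ρ‖ * ‖z‖ := by
        have := congrArg norm h
        simpa [abs_of_pos hr] using this
      nlinarith [norm_nonneg z, norm_nonneg ρ]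
  · have hd : HasDerivAt (dslope f ρ) (deriv (dslope f ρ) 0) 0 :=
      (hds.differentiableAt (isOpen_ball.mem_nhds h0R)).hasDerivAt
    have hfd : HasDerivAt f (1 * dslope f ρ 0 + (0 - ρ) * deriv (dslope f ρ) 0) 0 := by
      have h1 := ((hasDerivAt_id (0:ℂ)).sub_const ρ).mul hd
      refine h1.congr_of_eventuallyEq ?_
      filter_upwards with z using hfs z
    have hl : HasDerivAt (fun z : ℂ => ((r:ℂ)^2 - (starRingEnd ℂ) ρ * z) / r)
        (-(starRingEnd ℂ) ρ / r) 0 := by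
      have := (((hasDerivAt_id (0:ℂ)).const_mul ((starRingEnd ℂ) ρ)).const_sub ((r:ℂ)^2)).div_const (r:ℂ)
      simpa using this
    have hgd := (hd.mul hl).deriv
    have hD : dslope f ρ 0 ≠ 0 := by
      intro h; apply hf0; rw [hfs 0, h, mul_zero]
    rw [hfd.deriv, show deriv g 0 = _ from hgd, hfs 0]
    simp only [hg, mul_zero, sub_zero, zero_sub, one_mul]
    field_simp
    ring

open Complex Metric in
lemma landau_main {r R M : ℝ} (hr : 0 < r) (hrR : r < R) (k : ℕ) : ∀ f : ℂ → ℂ,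
    DifferentiableOn ℂ f (ball 0 R) → (∀ z ∈ closedBall (0:ℂ) r, ‖f z‖ ≤ M) →
    f 0 ≠ 0 → (∀ z ∈ ball (0:ℂ) (r/2), f z = 0 → z.re ≤ 0) → M < ‖f 0‖ * 2^k →
    -(deriv f 0 / f 0).re ≤ 4 / r * Real.log (M / ‖f 0‖) := by
  induction k with
  | zero =>
    intro f _ hM _ _ h
    have := hM 0 (by simp [hr.le])
    simp at h; linarith
  | succ k ih =>
    intro f hf hM hf0 hz hk
    have hf0p := norm_pos_iff.2 hf0
    by_cases hex : ∃ ρ ∈ ball (0:ℂ) (r/2), f ρ = 0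
    · obtain ⟨ρ, hρ, hfρ⟩ := hex
      obtain ⟨g, hgd, hgM, hg0, hg2, hgz, hder⟩ := landau_step hr hrR hf hM hf0 hρ hfρ
      have hi := ih g hgd hgM hg0 (fun z hz1 hz2 => hz z hz1 (hgz z hz1 hz2)) (by
        calc M < _ := hk
          _ = 2 * ‖f 0‖ * 2^k := by ring
          _ ≤ _ := by gcongr)
      have hρ0 : ρ ≠ 0 := by rintro rfl; exact hf0 hfρ
      have hρn : ‖ρ‖ < r/2 := by simpa using hρ
      have hρp : 0 < ‖ρ‖ := norm_pos_iff.2 hρ0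
      have hMp : 0 < M := lt_of_lt_of_le (norm_pos_iff.2 hg0) (hgM 0 (by simp [hr.le]))
      have hlog : Real.log (M / ‖g 0‖) ≤ Real.log (M / ‖f 0‖) := by
        have : 0 < ‖g 0‖ := norm_pos_iff.2 hg0
        gcongr; linarith
      have hre : 0 ≤ (-1/ρ + (starRingEnd ℂ) ρ / r^2).re := by
        have h1 : ((-1:ℂ)/ρ).re = -ρ.re / ‖ρ‖^2 := by
          rw [div_re, normSq_eq_norm_sq]; simp
        have h2 : ((starRingEnd ℂ) ρ / (r:ℂ)^2).re = ρ.re / r^2 := by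
          rw [show ((r:ℂ)^2) = ((r^2 : ℝ):ℂ) by push_cast; ring, div_ofReal_re, conj_re]
        rw [add_re, h1, h2]
        have h3 := hz ρ hρ hfρ
        have h4 : 1 / r^2 ≤ 1 / ‖ρ‖^2 := by gcongr; linarith
        calc (0:ℝ) ≤ (-ρ.re) * (1/‖ρ‖^2 - 1/r^2) := mul_nonneg (by linarith) (by linarith)
          _ = _ := by ring
      rw [hder, add_re]
      have : 4 / r * Real.log (M / ‖g 0‖) ≤ 4 / r * Real.log (M / ‖f 0‖) := by gcongr
      linarith
    · push Not at hex
      have hsub : ball (0:ℂ) (r/2) ⊆ closedBall 0 r := 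
        (ball_subset_ball (by linarith)).trans ball_subset_closedBall
      have := landau_nozero_deriv (half_pos hr) (hf.mono (ball_subset_ball (by linarith)))
        (fun z hz => hM z (hsub hz)) hex
      have h2 := (neg_le_abs _).trans ((abs_re_le_norm _).trans this)
      calc _ ≤ _ := h2
        _ = _ := by field_simp; ring

open Complex Metric in
lemma landau_all {r R M : ℝ} (hr : 0 < r) (hrR : r < R) {f : ℂ → ℂ}
    (hf : DifferentiableOn ℂ f (ball 0 R)) (hM : ∀ z ∈ closedBall (0:ℂ) r, ‖f z‖ ≤ M)
    (hf0 : f 0 ≠ 0) (hz : ∀ z ∈ ball (0:ℂ) (r/2), f z = 0 → z.re ≤ 0) :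
    -(deriv f 0 / f 0).re ≤ 4 / r * Real.log (M / ‖f 0‖) := by
  obtain ⟨k, hk⟩ := pow_unbounded_of_one_lt (M / ‖f 0‖) (one_lt_two)
  exact landau_main hr hrR k f hf hM hf0 hz (by
    rw [div_lt_iff₀ (norm_pos_iff.2 hf0)] at hk; linarith)

open Complex Metric in
lemma landau_one {r R M : ℝ} (hr : 0 < r) (hrR : r < R) {f : ℂ → ℂ}
    (hf : DifferentiableOn ℂ f (ball 0 R)) (hM : ∀ z ∈ closedBall (0:ℂ) r, ‖f z‖ ≤ M)
    (hf0 : f 0 ≠ 0) (hz : ∀ z ∈ ball (0:ℂ) (r/2), f z = 0 → z.re ≤ 0)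
    {d : ℝ} (hd0 : 0 < d) (hd : d < r/2) (hfd : f (-d) = 0) :
    -(deriv f 0 / f 0).re ≤ 4 / r * Real.log (M / ‖f 0‖) - 1 / d + d / r^2 := by
  obtain ⟨g, hgd, hgM, hg0, hg2, hgz, hder⟩ := landau_step hr hrR hf hM hf0 (ρ := -d)
    (by simpa [abs_of_pos hd0] using hd) hfd
  have h1 := landau_all hr hrR hgd hgM hg0 (fun z hz1 hz2 => hz z hz1 (hgz z hz1 hz2))
  have hf0p := norm_pos_iff.2 hf0
  have hgp : 0 < ‖g 0‖ := norm_pos_iff.2 hg0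
  have hMp : 0 < M := lt_of_lt_of_le hgp (hgM 0 (by simp [hr.le]))
  have hlog : Real.log (M / ‖g 0‖) ≤ Real.log (M / ‖f 0‖) := by
    gcongr; linarith
  have : 4 / r * Real.log (M / ‖g 0‖) ≤ 4 / r * Real.log (M / ‖f 0‖) := by gcongr
  have h3 : (-1/(-(d:ℂ)) + (starRingEnd ℂ) (-(d:ℂ)) / r^2) = ((1/d - d/r^2 : ℝ) : ℂ) := by
    have : (d:ℂ) ≠ 0 := by exact_mod_cast hd0.ne'
    simp only [map_neg, conj_ofReal]; push_cast; field_simp; ring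
  rw [hder, h3, add_re, ofReal_re]
  linarith
end

section
structure ZetaLike (b : ℕ → ℝ) (G : ℂ → ℂ) (δ : ℝ) : Prop where
  b_nonneg : ∀ n, 0 ≤ b n
  b_bdd : ∃ B, ∀ n, b n ≤ B
  δ_pos : 0 < δ
  δ_le : δ ≤ 1/2
  diff : DifferentiableOn ℂ G {s | 1 - δ < s.re}
  growth : ∃ (C : ℝ) (A : ℕ), 0 < C ∧ ∀ s : ℂ, 1 - δ < s.re → s.re ≤ 4 → ‖G s‖ ≤ C * (1 + ‖s‖)^A
  one_ne : G 1 ≠ 0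
  eq : ∀ s : ℂ, 1 < s.re → G s = (s - 1) * Complex.exp (LSeries (fun n => (b n : ℂ)) s)

lemma lterm_re (a : ℕ → ℝ) (s : ℂ) (n : ℕ) (hn : n ≠ 0) :
    (LSeries.term (fun n => (a n : ℂ)) s n).re =
      a n * (n:ℝ)^(-s.re) * Real.cos (s.im * Real.log n) := by
  rw [LSeries.term_of_ne_zero hn]
  have hn' : (0:ℝ) < n := by positivity
  rw [div_eq_mul_inv, ← Complex.cpow_neg, Complex.re_ofReal_mul, mul_assoc]
  congr 1
  rw [Complex.cpow_def_of_ne_zero (by exact_mod_cast hn), Complex.exp_re, Complex.natCast_log.symm]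
  simp only [Complex.mul_re, Complex.mul_im, Complex.ofReal_re, Complex.ofReal_im, Complex.neg_re,
    Complex.neg_im, zero_mul, sub_zero, add_zero]
  rw [Real.rpow_def_of_pos hn']
  congr 1
  rw [← Real.cos_neg]; ring_nf

lemma lnorm_le_real {a : ℕ → ℝ} (ha : ∀ n, 0 ≤ a n) {s : ℂ} 
    (hs : LSeriesSummable (fun n => (a n : ℂ)) s) :
    ‖LSeries (fun n => (a n : ℂ)) s‖ ≤ (LSeries (fun n => (a n : ℂ)) (s.re : ℂ)).re := by
  have hs' : LSeriesSummable (fun n => (a n : ℂ)) (s.re : ℂ) := hs.of_re_le_re (by simp)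
  unfold LSeries
  rw [Complex.re_tsum hs']
  refine (norm_tsum_le_tsum_norm hs.norm).trans (le_of_eq ?_)
  congr 1; ext n
  rw [LSeries.norm_term_eq]
  split_ifs with h
  · simp [h]
  · rw [lterm_re _ _ _ h]
    simp [abs_of_nonneg (ha n), Real.rpow_neg, div_eq_mul_inv]

lemma l341 {a : ℕ → ℝ} (ha : ∀ n, 0 ≤ a n) {σ : ℝ} (t : ℝ)
    (hs : LSeriesSummable (fun n => (a n : ℂ)) (σ : ℂ)) :
    0 ≤ 3 * (LSeries (fun n => (a n : ℂ)) (σ : ℂ)).re + 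
      4 * (LSeries (fun n => (a n : ℂ)) (σ + t * Complex.I)).re +
      (LSeries (fun n => (a n : ℂ)) (σ + (2 * t : ℝ) * Complex.I)).re := by
  have h1 : LSeriesSummable (fun n => (a n : ℂ)) (σ + t * Complex.I) := hs.of_re_le_re (by simp)
  have h2 : LSeriesSummable (fun n => (a n : ℂ)) (σ + (2 * t : ℝ) * Complex.I) := hs.of_re_le_re (by simp)
  unfold LSeries
  rw [Complex.re_tsum hs, Complex.re_tsum h1, Complex.re_tsum h2, ← tsum_mul_left, ← tsum_mul_left]
  have e0 := (Complex.reCLM.summable hs)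
  have e1 := (Complex.reCLM.summable h1)
  have e2 := (Complex.reCLM.summable h2)
  simp only [Complex.reCLM_apply] at e0 e1 e2
  rw [← (e0.mul_left 3).tsum_add (e1.mul_left 4), 
    ← ((e0.mul_left 3).add (e1.mul_left 4)).tsum_add e2]
  refine tsum_nonneg fun n => ?_
  by_cases hn : n = 0
  · simp [hn]
  · rw [lterm_re _ _ _ hn, lterm_re _ _ _ hn, lterm_re _ _ _ hn]
    simp only [Complex.add_re, Complex.ofReal_re, Complex.mul_re, Complex.I_re, mul_zero, Complex.ofReal_im, Complex.I_im,
      mul_one, sub_zero, add_zero, Complex.add_im, Complex.mul_im, zero_add, zero_mul, Real.cos_zero]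
    have hp : 0 ≤ a n * (n:ℝ)^(-σ) := mul_nonneg (ha n) (by positivity)
    rw [show 2 * t * Real.log n = 2 * (t * Real.log n) by ring, Real.cos_two_mul]
    nlinarith [mul_nonneg hp (sq_nonneg (1 + Real.cos (t * Real.log n)))]

namespace ZetaLike
variable {b : ℕ → ℝ} {G : ℂ → ℂ} {δ : ℝ}

lemma absc (h : ZetaLike b G δ) : LSeries.abscissaOfAbsConv (fun n => (b n : ℂ)) ≤ 1 := by
  obtain ⟨B, hB⟩ := h.b_bdd
  refine LSeries.abscissaOfAbsConv_le_of_le_const ⟨B, fun n _ => ?_⟩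
  simpa [abs_of_nonneg (h.b_nonneg n)] using hB n

lemma absc_lt (h : ZetaLike b G δ) {s : ℂ} (hs : 1 < s.re) : 
    LSeries.abscissaOfAbsConv (fun n => (b n : ℂ)) < s.re :=
  h.absc.trans_lt (by exact_mod_cast hs)

lemma summ (h : ZetaLike b G δ) {s : ℂ} (hs : 1 < s.re) : LSeriesSummable (fun n => (b n : ℂ)) s :=
  LSeriesSummable_of_abscissaOfAbsConv_lt_re (h.absc_lt hs)

lemma ne_zero (h : ZetaLike b G δ) {s : ℂ} (hs : 1 < s.re) : G s ≠ 0 := by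
  rw [h.eq s hs]
  refine mul_ne_zero ?_ (Complex.exp_ne_zero _)
  intro h0; rw [sub_eq_zero] at h0; simp [h0] at hs

lemma diffAt (h : ZetaLike b G δ) {s : ℂ} (hs : 1 - δ < s.re) : DifferentiableAt ℂ G s :=
  h.diff.differentiableAt ((isOpen_lt continuous_const Complex.continuous_re).mem_nhds hs)

/-- bound for the inverse to the right of 1 -/
lemma inv_bound (h : ZetaLike b G δ) : ∃ K : ℝ, 0 < K ∧ ∀ s : ℂ, 1 < s.re → s.re ≤ 3 →
    ‖(s - 1) / G s‖ ≤ K / (s.re - 1) := by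
  obtain ⟨C, A, hC, hg⟩ := h.growth
  refine ⟨C * 4^A, by positivity, fun s hs hs3 => ?_⟩
  have hs1 : s - 1 ≠ 0 := by intro h0; rw [sub_eq_zero] at h0; simp [h0] at hs
  have h1 := lnorm_le_real h.b_nonneg (h.summ hs)
  have h2 := hg (s.re : ℂ) (by simp; linarith [h.δ_pos]) (by simp; linarith)
  rw [h.eq (s.re:ℂ) (by simpa using hs)] at h2
  have h3 : ‖((s.re : ℂ) - 1)‖ = s.re - 1 := by
    rw [show ((s.re : ℂ) - 1) = ((s.re - 1 : ℝ) : ℂ) by push_cast; ring, Complex.norm_real, 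
      Real.norm_of_nonneg (by linarith)]
  rw [norm_mul, h3, Complex.norm_exp, Complex.norm_real, Real.norm_of_nonneg (by linarith)] at h2
  rw [h.eq s hs, le_div_iff₀ (by linarith)]
  have h4 : (s - 1) / ((s - 1) * Complex.exp (LSeries (fun n => (b n : ℂ)) s)) = 
      Complex.exp (-LSeries (fun n => (b n : ℂ)) s) := by
    rw [Complex.exp_neg]; field_simp
  rw [h4, Complex.norm_exp]
  have h5 : (-LSeries (fun n => (b n : ℂ)) s).re ≤ (LSeries (fun n => (b n : ℂ)) (s.re : ℂ)).re :=
    (Complex.re_le_norm _).trans (by rwa [norm_neg])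
  have h6 : (1 + s.re)^A ≤ 4^A := by
    apply pow_le_pow_left₀ <;> linarith
  calc _ ≤ Real.exp (LSeries (fun n => (b n : ℂ)) (s.re : ℂ)).re * (s.re - 1) := by
        gcongr
    _ ≤ C * (1 + s.re)^A := by linarith
    _ ≤ _ := by gcongr

/-- logarithmic derivative -/
lemma logderiv (h : ZetaLike b G δ) {s : ℂ} (hs : 1 < s.re) :
    LSeries (LSeries.logMul (fun n => (b n : ℂ))) s = 1 / (s - 1) - deriv G s / G s := by
  have hs1 : s - 1 ≠ 0 := by intro h0; rw [sub_eq_zero] at h0; simp [h0] at hs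
  have h1 := (((hasDerivAt_id s).sub_const 1).mul (LSeries_hasDerivAt (h.absc_lt hs)).cexp)
  have h2 : HasDerivAt G _ s := h1.congr_of_eventuallyEq (by
    filter_upwards [(isOpen_lt continuous_const Complex.continuous_re).mem_nhds hs] with z hz
    exact h.eq z hz)
  rw [h2.deriv, h.eq s hs]
  have := Complex.exp_ne_zero (LSeries (fun n => (b n : ℂ)) s)
  simp only [id]
  field_simp
  ring

lemma logderiv341 (h : ZetaLike b G δ) {σ : ℝ} (hσ : 1 < σ) (t : ℝ) :
    0 ≤ 3 * (1 / ((σ:ℂ) - 1) - deriv G σ / G σ).re +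
      4 * (1 / ((σ + t * Complex.I : ℂ) - 1) - deriv G (σ + t * Complex.I) / G (σ + t * Complex.I)).re +
      (1 / ((σ + (2 * t : ℝ) * Complex.I : ℂ) - 1) - 
        deriv G (σ + (2 * t : ℝ) * Complex.I) / G (σ + (2 * t : ℝ) * Complex.I)).re := by
  rw [← h.logderiv (by simpa using hσ), ← h.logderiv (by simpa using hσ), ← h.logderiv (by simpa using hσ)]
  have e : LSeries.logMul (fun n => (b n : ℂ)) = fun n : ℕ => ((Real.log n * b n : ℝ) : ℂ) := by
    ext n; simp [LSeries.logMul]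
  have hsum := LSeriesSummable_logMul_of_lt_re (h.absc_lt (s := σ) (by simpa using hσ))
  rw [e] at hsum ⊢
  exact l341 (fun n => mul_nonneg (Real.log_natCast_nonneg n) (h.b_nonneg n)) t hsum

end ZetaLike
end

section
namespace ZetaLike
variable {b : ℕ → ℝ} {G : ℂ → ℂ} {δ : ℝ}

lemma one_le_log {T : ℝ} (hT : 3 ≤ T) : 1 ≤ Real.log T := by
  rw [Real.le_log_iff_exp_le (by linarith)]
  linarith [Real.exp_one_lt_d9]

lemma logM (h : ZetaLike b G δ) {t₀ : ℝ} (ht₀ : 0 < t₀) : ∃ K : ℝ, 1 ≤ K ∧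
    ∀ T q t : ℝ, 3 ≤ T → 0 < q → q ≤ 1 → t₀ ≤ |t| → |t| ≤ 2 * T + 2 → ∃ M : ℝ, 0 < M ∧
    (∀ z : ℂ, ‖z‖ ≤ δ / 2 → ‖G (((1 + q^2 / Real.log T : ℝ) + t * Complex.I) + z)‖ ≤ M) ∧
    Real.log (M / ‖G ((1 + q^2 / Real.log T : ℝ) + t * Complex.I)‖) ≤ K * Real.log T / q := by
  obtain ⟨C, A, hC, hg⟩ := h.growth
  obtain ⟨K1, hK1, hinv⟩ := h.inv_bound
  refine ⟨|Real.log C| + 3 * A + |Real.log (K1 / t₀)| + 3, by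
    have := abs_nonneg (Real.log C)
    have := abs_nonneg (Real.log (K1 / t₀))
    have : (0:ℝ) ≤ A := by positivity
    linarith, fun T q t hT hq hq1 ht htT => ?_⟩
  have hL := one_le_log hT
  set L := Real.log T with hLdef
  have hT0 : 0 < T := by linarith
  have hq2 : q^2 ≤ 1 := by nlinarith
  have hd : 0 < q^2 / L := by positivity
  have hd1 : q^2 / L ≤ 1 := by rw [div_le_one (by linarith)]; linarith
  set s₀ : ℂ := (1 + q^2 / L : ℝ) + t * Complex.I with hs₀
  have hre : s₀.re = 1 + q^2/L := by rw [hs₀]; generalize 1 + q^2/L = w; simp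
  have him : s₀.im = t := by rw [hs₀]; generalize 1 + q^2/L = w; simp
  have hn0 : ‖s₀‖ ≤ 2 + |t| := by
    have := Complex.norm_le_abs_re_add_abs_im s₀
    rw [hre, him, abs_of_pos (by linarith)] at this
    linarith
  refine ⟨C * (4 * T)^A, by positivity, fun z hz => ?_, ?_⟩
  · have hzr : |z.re| ≤ δ / 2 := (Complex.abs_re_le_norm z).trans hz
    have hd := h.δ_pos
    have hd2 := h.δ_le
    rw [abs_le] at hzr
    refine (hg _ (by rw [Complex.add_re, hre]; linarith) (by rw [Complex.add_re, hre]; linarith)).trans ?_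
    have : ‖s₀ + z‖ ≤ ‖s₀‖ + ‖z‖ := norm_add_le _ _
    gcongr
    linarith
  · have h1 := hinv s₀ (by rw [hre]; linarith) (by rw [hre]; linarith)
    have hG0 : 0 < ‖G s₀‖ := norm_pos_iff.2 (h.ne_zero (by rw [hre]; linarith))
    have hge : t₀ ≤ ‖s₀ - 1‖ := by
      refine ht.trans ?_
      have := Complex.abs_im_le_norm (s₀ - 1)
      simpa [him] using this
    rw [norm_div, hre, add_sub_cancel_left, div_le_div_iff₀ hG0 hd] at h1
    have h2 : t₀ * (q^2 / L) ≤ K1 * ‖G s₀‖ := le_trans (by gcongr) h1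
    have h3 : C * (4*T)^A / ‖G s₀‖ ≤ C * (4*T)^A * (K1 / t₀ * (L / q^2)) := by
      rw [div_eq_mul_inv]
      gcongr
      rw [inv_le_iff_one_le_mul₀ hG0]
      have : 1 ≤ (K1 * ‖G s₀‖) / (t₀ * (q^2/L)) := by
        rw [le_div_iff₀ (by positivity)]; linarith
      calc 1 ≤ _ := this
        _ = _ := by field_simp
    have hLp : 0 < L := by linarith
    refine (Real.log_le_log (by positivity) h3).trans ?_
    rw [Real.log_mul (by positivity) (by positivity), Real.log_mul (by positivity) (by positivity),
      Real.log_mul (by positivity) (by positivity), Real.log_pow, 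
      Real.log_div (x := L) (by positivity) (by positivity), Real.log_pow]
    have e1 : Real.log (4 * T) ≤ 3 * L := by
      rw [Real.log_mul (by norm_num) (by positivity)]
      have : Real.log 4 ≤ Real.log (T^2) := Real.log_le_log (by norm_num) (by nlinarith)
      rw [Real.log_pow] at this
      push_cast at this; linarith
    have e2 : Real.log L ≤ L := (Real.log_le_sub_one_of_pos hLp).trans (by linarith)
    have e3 : -Real.log q ≤ 1 / q := by
      rw [← Real.log_inv, ← one_div]
      exact (Real.log_le_sub_one_of_pos (by positivity)).trans (by linarith)
    have e4 : 1 ≤ 1 / q := by rw [le_div_iff₀ hq]; linarith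
    have e5 := le_abs_self (Real.log C)
    have e6 := le_abs_self (Real.log (K1 / t₀))
    have e7 : A * Real.log (4*T) ≤ A * (3 * L) := by gcongr
    have f1 : |Real.log C| ≤ |Real.log C| * (L * (1/q)) := le_mul_of_one_le_right (abs_nonneg _) (one_le_mul_of_one_le_of_one_le hL e4)
    have f2 : |Real.log (K1 / t₀)| ≤ |Real.log (K1 / t₀)| * (L * (1/q)) := le_mul_of_one_le_right (abs_nonneg _) (one_le_mul_of_one_le_of_one_le hL e4)
    have f3 : A * (3 * L) ≤ A * (3 * L) * (1/q) := le_mul_of_one_le_right (by positivity) e4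
    have f4 : L ≤ L * (1/q) := le_mul_of_one_le_right (by positivity) e4
    have f5 : 1/q ≤ L * (1/q) := le_mul_of_one_le_left (by positivity) hL
    calc _ ≤ |Real.log C| * (L * (1/q)) + A * (3 * L) * (1/q) + (|Real.log (K1 / t₀)| * (L * (1/q)) 
          + (L * (1/q) + 2 * (L * (1/q)))) := by push_cast; linarith
      _ = _ := by field_simp; ring

lemma real_bound (h : ZetaLike b G δ) : ∃ K : ℝ, 0 < K ∧ ∀ σ : ℝ, 1 < σ → σ ≤ 2 → 
    -(deriv G σ / G σ).re ≤ K := by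
  have hne : ∀ σ ∈ Set.Icc (1:ℝ) 2, G (σ:ℂ) ≠ 0 := by
    intro σ hσ
    rcases hσ.1.eq_or_lt with rfl | h1
    · simpa using h.one_ne
    · exact h.ne_zero (by simpa using h1)
  have hopen : IsOpen {s : ℂ | 1 - δ < s.re} := isOpen_lt continuous_const Complex.continuous_re
  have hc : ContinuousOn (fun σ : ℝ => deriv G (σ:ℂ) / G (σ:ℂ)) (Set.Icc 1 2) := by
    have hmaps : Set.MapsTo (fun σ : ℝ => (σ:ℂ)) (Set.Icc 1 2) {s : ℂ | 1 - δ < s.re} := by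
      intro σ hσ
      have := h.δ_pos
      simp only [Set.mem_ofPred_eq, Complex.ofReal_re]; linarith [hσ.1]
    exact ((h.diff.deriv hopen).continuousOn.comp Complex.continuous_ofReal.continuousOn hmaps).div
      (h.diff.continuousOn.comp Complex.continuous_ofReal.continuousOn hmaps) hne
  obtain ⟨K, hK⟩ := isCompact_Icc.exists_bound_of_continuousOn hc
  refine ⟨|K| + 1, by positivity, fun σ h1 h2 => ?_⟩
  have := hK σ ⟨h1.le, h2⟩
  have h3 := (neg_le_abs _).trans (Complex.abs_re_le_norm (deriv G σ / G σ))
  linarith [le_abs_self K]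

lemma re_inv_le {s : ℂ} {t₀ : ℝ} (ht₀ : 0 < t₀) (ht : t₀ ≤ |s.im|) : (1 / (s - 1)).re ≤ 1 / t₀ := by
  refine (Complex.re_le_norm _).trans ?_
  rw [norm_div, norm_one]
  gcongr
  refine ht.trans ?_
  simpa using Complex.abs_im_le_norm (s - 1)

set_option maxHeartbeats 1000000 in
lemma zerofree (h : ZetaLike b G δ) {t₀ : ℝ} (ht₀ : 0 < t₀) : ∃ c : ℝ, 0 < c ∧ c < δ ∧
    ∀ (T : ℝ) (s : ℂ), 3 ≤ T → t₀ ≤ |s.im| → |s.im| ≤ T + 1 → 1 - c / Real.log T ≤ s.re → G s ≠ 0 := by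
  obtain ⟨K, hK1, hK⟩ := h.logM ht₀
  obtain ⟨K2, hK2, hre⟩ := h.real_bound
  have hδ := h.δ_pos
  have hδ2 := h.δ_le
  set r := δ / 2 with hr
  have hr0 : 0 < r := by positivity
  set K3 := 3 * K2 + 5 / t₀ + 20 * K / r + 4 / r with hK3
  have hK3p : 0 < K3 := by positivity
  obtain ⟨q, hq, hq1, hqr, hqK⟩ : ∃ q : ℝ, 0 < q ∧ q ≤ 1 ∧ q ≤ r / 4 ∧ K3 * q < 5/9 := by
    refine ⟨min (min 1 (r/4)) (1 / (2 * K3)), by positivity, (min_le_left _ _).trans (min_le_left _ _),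
      (min_le_left _ _).trans (min_le_right _ _), ?_⟩
    calc _ ≤ K3 * (1 / (2 * K3)) := by gcongr; exact min_le_right _ _
      _ = 1/2 := by field_simp
      _ < _ := by norm_num
  refine ⟨q^2/8, by positivity, by nlinarith, fun T s hT hs0 hsT hs1 hGs => ?_⟩
  have hL := one_le_log hT
  set L := Real.log T with hLdef
  have hLp : 0 < L := by linarith
  have hβ : s.re ≤ 1 := by
    by_contra hcon
    exact h.ne_zero (not_le.1 hcon) hGs
  set t := s.im with htdef
  set η := q^2 / L with hη
  have hηp : 0 < η := by positivity
  have hq2 : q^2 ≤ r/4 := by nlinarith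
  have hη1 : η ≤ r/4 := by 
    rw [hη, div_le_iff₀ hLp]; nlinarith
  set d := 1 + η - s.re with hd
  have hd0 : η ≤ d := by linarith
  have hd1 : d ≤ 9/8 * η := by
    have : q^2 / 8 / L = η / 8 := by rw [hη]; ring
    linarith
  have hdp : 0 < d := by linarith
  have hdr : d < r / 2 := by linarith
  have hgen : ∀ u : ℝ, t₀ ≤ |u| → |u| ≤ 2 * T + 2 → ∃ M, 0 < M ∧
      (∀ z ∈ Metric.closedBall (0:ℂ) r, ‖G (((1 + η : ℝ) + u * Complex.I) + z)‖ ≤ M) ∧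
      Real.log (M / ‖G (((1 + η : ℝ) + u * Complex.I) + 0)‖) ≤ K * L / q ∧ 
      DifferentiableOn ℂ (fun z => G (((1 + η : ℝ) + u * Complex.I) + z)) (Metric.ball 0 δ) ∧
      G (((1 + η : ℝ) + u * Complex.I) + 0) ≠ 0 ∧ (∀ z ∈ Metric.ball (0:ℂ) (r/2), 
        G (((1 + η : ℝ) + u * Complex.I) + z) = 0 → z.re ≤ 0) := by
    intro u hu1 hu2
    obtain ⟨M, hM, hM1, hM2⟩ := hK T q u hT hq hq1 hu1 hu2
    refine ⟨M, hM, fun z hz => hM1 z (by simpa using hz), by rwa [add_zero], ?_, ?_, ?_⟩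
    · intro z hz
      have hz' : ‖z‖ < δ := by simpa using hz
      have := (abs_le.1 ((Complex.abs_re_le_norm z).trans hz'.le)).1
      have hd : DifferentiableAt ℂ G (((1 + η : ℝ) + u * Complex.I) + z) := h.diffAt (by simp; linarith)
      exact (hd.comp z (by fun_prop)).differentiableWithinAt
    · exact h.ne_zero (by simp; linarith)
    · intro z hz hz2
      by_contra hcon
      push Not at hcon
      exact h.ne_zero (by simp; linarith) hz2
  have hrδ : r < δ := by linarith
  have ht2 : |t| ≤ 2 * T + 2 := by linarith
  obtain ⟨M1, hM1, a1, a2, a3, a4, a5⟩ := hgen t hs0 ht2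
  obtain ⟨M2, hM2, b1, b2, b3, b4, b5⟩ := hgen (2 * t) (by rw [abs_mul]; simp; linarith) (by rw [abs_mul]; simp; linarith)
  have hone := landau_one hr0 hrδ a3 a1 a4 a5 hdp hdr (by
    rw [← hGs]
    congr 1
    apply Complex.ext <;> simp [hd]; rfl)
  have hall := landau_all hr0 hrδ b3 b1 b4 b5
  rw [deriv_comp_const_add] at hone hall
  simp only [add_zero] at hone hall a2 b2
  have h341 := h.logderiv341 (σ := 1 + η) (by linarith) t
  simp only [Complex.sub_re] at h341
  have i1 : (1 / (((1 + η : ℝ):ℂ) - 1)).re = 1 / η := by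
    rw [show (((1 + η : ℝ):ℂ) - 1) = (η : ℂ) by push_cast; ring, ← Complex.ofReal_one, 
      ← Complex.ofReal_div, Complex.ofReal_re]
  have i2 := re_inv_le (s := (1 + η : ℝ) + t * Complex.I) ht₀ (by simpa using hs0)
  have i3 := re_inv_le (s := (1 + η : ℝ) + (2 * t : ℝ) * Complex.I) ht₀ (by 
    simp [abs_mul]; linarith)
  have i4 := hre (1 + η) (by linarith) (by linarith)
  rw [i1] at h341
  have j1 : 4 / r * Real.log (M1 / ‖G ((1 + η : ℝ) + t * Complex.I)‖) ≤ 4 / r * (K * L / q) := by gcongr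
  have j2 : 4 / r * Real.log (M2 / ‖G ((1 + η : ℝ) + (2 * t : ℝ) * Complex.I)‖) ≤ 4 / r * (K * L / q) := by gcongr
  have j3 : d / r^2 ≤ 1 / r := by
    rw [div_le_div_iff₀ (by positivity) hr0]; nlinarith
  have hmain : 4 / d ≤ 3 / η + (3 * K2 + 5 / t₀ + 20 * K / r * (L / q) + 4 / r) := by
    have e1 : 4 / r * (K * L / q) * 5 = 20 * K / r * (L / q) := by ring
    have e2 : 5 / t₀ = 5 * (1 / t₀) := by ring
    have e4 : 4 / d = 4 * (1 / d) := by ring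
    have e5 : 3 / η = 3 * (1 / η) := by ring
    rw [e2, ← e1, e4, e5]
    rw [show 4 / r = 4 * (1/r) by ring] at j1 j2 hone hall ⊢
    linarith
  have hLq : 1 ≤ L / q := by rw [le_div_iff₀ hq]; linarith
  have hmain2 : 4 / d ≤ 3 / η + K3 * (L / q) := by
    have : 3 * K2 + 5 / t₀ + 4 / r ≤ (3 * K2 + 5 / t₀ + 4 / r) * (L / q) := le_mul_of_one_le_right (by positivity) hLq
    calc _ ≤ _ := hmain
      _ ≤ 3 / η + ((3 * K2 + 5 / t₀ + 4 / r) * (L / q) + 20 * K / r * (L / q)) := by linarith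
      _ = _ := by rw [hK3]; ring
  have hlow : 32 / 9 * (1 / η) ≤ 4 / d := by
    rw [show 32 / 9 * (1 / η) = 4 / (9/8 * η) by field_simp; norm_num]
    gcongr
  have hK4 : K3 * (L / q) < 5/9 * (1/η) := by
    have : K3 * (L / q) = (K3 * q) * (1 / η) := by rw [hη]; field_simp
    rw [this]; gcongr
  have e5 : 3 / η = 3 * (1 / η) := by ring
  linarith

end ZetaLike
end

section
namespace ZetaLike
variable {b : ℕ → ℝ} {G : ℂ → ℂ} {δ : ℝ}

lemma near_one (h : ZetaLike b G δ) : ∃ t₀ K : ℝ, 0 < t₀ ∧ t₀ < δ ∧ 0 < K ∧ 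
    ∀ s : ℂ, 1 - t₀ ≤ s.re → s.re ≤ 1 + t₀ → |s.im| ≤ t₀ → G s ≠ 0 ∧ ‖(s - 1) / G s‖ ≤ K := by
  have hδ := h.δ_pos
  have hδ2 := h.δ_le
  have hc : ContinuousAt G 1 := (h.diffAt (by simp; linarith)).continuousAt
  have hpos : 0 < ‖G 1‖ := norm_pos_iff.2 h.one_ne
  have hev : ∀ᶠ s in nhds (1:ℂ), ‖G 1‖ / 2 < ‖G s‖ := 
    hc.norm.eventually (lt_mem_nhds (by linarith))
  obtain ⟨ε, hε, hball⟩ := Metric.eventually_nhds_iff.1 hev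
  refine ⟨min (ε/3) (δ/2), 2 / ‖G 1‖, by positivity, (min_le_right _ _).trans_lt (by linarith), by positivity, 
    fun s h1 h2 h3 => ?_⟩
  have m1 : min (ε/3) (δ/2) ≤ ε/3 := min_le_left _ _
  have m2 : min (ε/3) (δ/2) ≤ δ/2 := min_le_right _ _
  have hn : ‖s - 1‖ ≤ 2 * min (ε/3) (δ/2) := by
    refine (Complex.norm_le_abs_re_add_abs_im _).trans ?_
    have : |(s-1).re| ≤ min (ε/3) (δ/2) := by
      simp only [Complex.sub_re, Complex.one_re]; rw [abs_le]; constructor <;> linarith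
    simp only [Complex.sub_im, Complex.one_im, sub_zero]
    linarith
  have hG := hball (y := s) (by rw [dist_eq_norm]; linarith)
  have hGp : 0 < ‖G s‖ := by linarith
  refine ⟨norm_pos_iff.1 hGp, ?_⟩
  rw [norm_div]
  calc _ ≤ 1 / (‖G 1‖/2) := by gcongr; linarith
    _ = _ := by field_simp

set_option maxHeartbeats 1000000 in
theorem inv_bound_left (h : ZetaLike b G δ) {ε : ℝ} (hε : 0 < ε) : ∃ c C : ℝ, 0 < c ∧ c < δ ∧ 0 < C ∧
    ∀ (T : ℝ) (s : ℂ), 3 ≤ T → |s.im| ≤ T → 1 - c / Real.log T ≤ s.re → s.re ≤ 2 →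
      G s ≠ 0 ∧ ‖(s - 1) / G s‖ ≤ C * T^ε := by
  obtain ⟨t₀', K0, ht₀', htδ, hK0, hnear⟩ := h.near_one
  obtain ⟨K1, hK1, hright⟩ := h.inv_bound
  set t₀ := t₀' / 2 with ht₀def
  have ht₀ : 0 < t₀ := by positivity
  obtain ⟨c₁, hc₁, hc₁δ, hzf⟩ := h.zerofree ht₀
  obtain ⟨K, hK1', hK⟩ := h.logM ht₀
  have hδ := h.δ_pos
  have hδ2 := h.δ_le
  -- radius a / L
  set a := min (min (δ/2) c₁) (t₀/2) with ha
  have ha0 : 0 < a := by positivity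
  have haδ : a ≤ δ / 2 := (min_le_left _ _).trans (min_le_left _ _)
  have hac : a ≤ c₁ := (min_le_left _ _).trans (min_le_right _ _)
  have hat : a ≤ t₀/2 := (min_le_right _ _)
  obtain ⟨q, hq, hq1, hqa, hqt, hqε⟩ : ∃ q : ℝ, 0 < q ∧ q ≤ 1 ∧ q ≤ a / 4 ∧ q ≤ t₀ ∧ 8 * K / a * q ≤ ε / 2 := by
    refine ⟨min (min (min 1 (a/4)) t₀) (ε / 2 / (8 * K / a)), by positivity, ?_, ?_, ?_, ?_⟩
    · exact (min_le_left _ _).trans ((min_le_left _ _).trans (min_le_left _ _))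
    · exact (min_le_left _ _).trans ((min_le_left _ _).trans (min_le_right _ _))
    · exact (min_le_left _ _).trans (min_le_right _ _)
    · calc _ ≤ 8 * K / a * (ε / 2 / (8 * K / a)) := by gcongr; exact min_le_right _ _
        _ = _ := by field_simp
  have hq2 : q^2 ≤ q := by nlinarith
  refine ⟨q^2, K0 + K1 / q^2 * (2/ε) * (3 + t₀ ) / t₀, by positivity, by linarith, by positivity, 
    fun T s hT hsT hs1 hs2 => ?_⟩
  have hL := one_le_log hT
  have hLT : Real.log T ≤ T^(ε/2) * (2/ε) := by
    have := Real.log_le_rpow_div (x := T) (by linarith) (half_pos hε)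
    calc _ ≤ _ := this
      _ = _ := by field_simp
  set L := Real.log T with hLdef
  have hLp : 0 < L := by linarith
  have hT0 : 0 < T := by linarith
  have hT1 : 1 ≤ T^(ε/2) := Real.one_le_rpow (by linarith) (by positivity)
  have hTT : T^(ε/2) * T^(ε/2) = T^ε := by rw [← Real.rpow_add hT0]; congr 1; ring
  have hT2 : 1 ≤ T^ε := Real.one_le_rpow (by linarith) (by positivity)
  have hT3 : T^(ε/2) ≤ T^ε := by rw [← hTT]; nlinarith
  set η := q^2 / L with hη
  have hηp : 0 < η := by positivity
  have hηa : η ≤ a / 4 / L := by rw [hη]; gcongr; linarith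
  have hηq : η ≤ q := by rw [hη, div_le_iff₀ hLp]; nlinarith
  set Y := K1 / q^2 * (2/ε) * (3 + t₀ ) / t₀ with hY
  have hYp : 0 < Y := by positivity
  have hYK : K1 / q^2 * (2/ε) ≤ Y := by
    rw [hY, le_div_iff₀ ht₀]
    have : 0 < K1 / q^2 * (2/ε) := by positivity
    nlinarith
  by_cases hcase : 1 + η ≤ s.re
  · refine ⟨h.ne_zero (by linarith), (hright s (by linarith) (by linarith)).trans ?_⟩
    calc K1 / (s.re - 1) ≤ K1 / η := by gcongr; linarith
      _ = K1 / q^2 * L := by rw [hη]; field_simp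
      _ ≤ K1 / q^2 * (T^(ε/2) * (2/ε)) := by gcongr
      _ = (K1 / q^2 * (2/ε)) * T^(ε/2) := by ring
      _ ≤ Y * T^ε := by gcongr
      _ ≤ _ := by gcongr; linarith
  push Not at hcase
  by_cases ht : |s.im| ≤ t₀'
  · have hn := hnear s (by linarith) (by linarith) ht
    refine ⟨hn.1, hn.2.trans ?_⟩
    calc K0 = K0 * 1 := by ring
      _ ≤ (K0 + Y) * T^ε := by gcongr; linarith
  push Not at ht
  set t := s.im with htdef
  have ht1 : t₀ ≤ |t| := by linarith
  obtain ⟨M, hM, hM1, hM2⟩ := hK T q t hT hq hq1 ht1 (by linarith)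
  set s₀ : ℂ := (1 + η : ℝ) + t * Complex.I with hs₀
  have hre : s₀.re = 1 + η := by rw [hs₀]; generalize 1 + η = w; simp
  have him : s₀.im = t := by rw [hs₀]; generalize 1 + η = w; simp
  set R := a / L with hR
  have hRp : 0 < R := by positivity
  have hRa : R ≤ a := by rw [hR, div_le_iff₀ hLp]; nlinarith
  have hzbnd : ∀ z ∈ Metric.ball (0:ℂ) R, 1 - a / L ≤ (s₀ + z).re ∧ |(s₀ + z).im| ≤ T + 1 ∧ 
      t₀ ≤ |(s₀ + z).im| ∧ ‖z‖ ≤ δ / 2 := by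
    intro z hz
    have hz' : ‖z‖ < R := by simpa using hz
    have e1 := abs_le.1 ((Complex.abs_re_le_norm z).trans hz'.le)
    have e2 := ((Complex.abs_im_le_norm z).trans hz'.le)
    rw [Complex.add_re, Complex.add_im, hre, him]
    refine ⟨by linarith [e1.1], ?_, ?_, by linarith⟩
    · have := abs_add_le t z.im
      linarith
    · have := abs_sub_abs_le_abs_sub t (-z.im)
      rw [abs_neg, sub_neg_eq_add] at this
      linarith
  have hac' : a / L ≤ c₁ / L := by gcongr
  have hac2 : a / L ≤ a := by rw [div_le_iff₀ hLp]; nlinarith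
  obtain ⟨Lf, -, -, hf, hfb⟩ := landau_nozero (f := fun z => G (s₀ + z)) (r := R) (M := M) hRp
    (by
      intro z hz
      have := hzbnd z hz
      have hd : DifferentiableAt ℂ G (s₀ + z) := h.diffAt (by linarith [this.1])
      exact (hd.comp z (by fun_prop)).differentiableWithinAt)
    (fun z hz => hM1 z (hzbnd z hz).2.2.2)
    (fun z hz => by
      have := hzbnd z hz
      exact hzf T _ hT this.2.2.1 this.2.1 (by linarith [this.1]))
  set z := s - s₀ with hz
  have hzre : z.re = s.re - 1 - η := by rw [hz, Complex.sub_re, hre]; ring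
  have hzim : z.im = 0 := by rw [hz, Complex.sub_im, him]; ring
  have hzn : ‖z‖ ≤ 2 * η := by
    refine (Complex.norm_le_abs_re_add_abs_im _).trans ?_
    rw [hzim, hzre, abs_zero, add_zero, abs_le]
    have : q^2/L = η := rfl
    constructor <;> linarith
  have h2η : 2 * η ≤ R / 2 := by
    have : a/4/L = R/4 := by rw [hR]; ring
    linarith
  have hzb : z ∈ Metric.ball (0:ℂ) R := by simp; linarith
  have hsz : s₀ + z = s := by rw [hz]; ring
  have hfz := hf z hzb
  have hfbz := hfb z hzb
  simp only [add_zero, hsz] at hfz hfbz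
  have hGs : G s ≠ 0 := by
    have := hzbnd z hzb
    rw [hsz] at this
    exact hzf T s hT this.2.2.1 this.2.1 (by linarith [this.1])
  refine ⟨hGs, ?_⟩
  have hlog : 0 ≤ Real.log (M / ‖G s₀‖) := by
    have hGp : 0 < ‖G s₀‖ := norm_pos_iff.2 (h.ne_zero (by rw [hre]; linarith))
    refine Real.log_nonneg ?_
    rw [le_div_iff₀ hGp, one_mul]
    have := hM1 0 (by simp; linarith)
    rwa [add_zero] at this
  have hLb : ‖Lf z‖ ≤ ε / 2 * L := by
    refine hfbz.trans ?_
    have hRz : R / 2 ≤ R - ‖z‖ := by linarith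
    have hM2' : Real.log (M / ‖G s₀‖) ≤ K * L / q := hM2
    calc 2 * Real.log (M / ‖G s₀‖) * ‖z‖ / (R - ‖z‖) ≤ 2 * (K * L / q) * (2 * η) / (R / 2) := by
          gcongr
      _ = 8 * K / a * q * L := by rw [hη, hR]; field_simp; ring
      _ ≤ _ := by gcongr
  have hexp : Real.exp (‖Lf z‖) ≤ T^(ε/2) := by
    rw [Real.rpow_def_of_pos hT0]
    gcongr
    linarith
  have hr0 := hright s₀ (by rw [hre]; linarith) (by rw [hre]; linarith)
  rw [hre, add_sub_cancel_left] at hr0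
  have hkey : (s - 1) / G s = ((s₀ - 1) / G s₀) * Complex.exp (-Lf z) * ((s - 1) / (s₀ - 1)) := by
    have h1 : s₀ - 1 ≠ 0 := by 
      intro h0
      have := congrArg Complex.re h0
      simp [hre] at this; linarith
    have h2 : G s₀ ≠ 0 := h.ne_zero (by rw [hre]; linarith)
    rw [hfz, Complex.exp_neg]
    have := Complex.exp_ne_zero (Lf z)
    field_simp
  have hns0 : t₀ ≤ ‖s₀ - 1‖ := by
    have := Complex.abs_im_le_norm (s₀ - 1)
    simp only [Complex.sub_im, Complex.one_im, sub_zero, him] at this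
    linarith
  have hratio : ‖(s - 1) / (s₀ - 1)‖ ≤ (3 + t₀) / t₀ := by
    rw [show s - 1 = (s₀ - 1) + z by rw [hz]; ring, norm_div, div_le_div_iff₀ (by linarith) ht₀]
    have := norm_add_le (s₀ - 1) z
    have : ‖z‖ ≤ 2 := by linarith
    nlinarith
  have hexpn : ‖Complex.exp (-Lf z)‖ ≤ T^(ε/2) := by
    rw [Complex.norm_exp]
    refine le_trans ?_ hexp
    gcongr
    exact (Complex.re_le_norm _).trans (by rw [norm_neg])
  rw [hkey, norm_mul, norm_mul]
  calc _ ≤ K1 / η * T^(ε/2) * ((3 + t₀) / t₀) := by gcongr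
    _ = K1 / q^2 * L * T^(ε/2) * ((3 + t₀) / t₀) := by rw [hη]; field_simp
    _ ≤ K1 / q^2 * (T^(ε/2) * (2/ε)) * T^(ε/2) * ((3 + t₀) / t₀) := by gcongr
    _ = Y * (T^(ε/2) * T^(ε/2)) := by rw [hY]; ring
    _ = Y * T^ε := by rw [hTT]
    _ ≤ _ := by gcongr; linarith
end ZetaLike
end

section
open MeasureTheory

noncomputable def wtri (u : ℝ) : ℂ := ((max 0 (1 - u) : ℝ) : ℂ)

lemma wtri_cont : Continuous wtri := by unfold wtri; fun_prop

lemma wtri_mellin {s : ℂ} (hs : 0 < s.re) : MellinConvergent wtri s ∧ mellin wtri s = 1 / (s * (s + 1)) := by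
  have hs0 : s ≠ 0 := by rintro rfl; simp at hs
  have hs1 : s + 1 ≠ 0 := by
    intro h; have := congrArg Complex.re h; simp at this; linarith
  have h1 := hasMellin_one_Ioc hs
  have h2 := hasMellin_cpow_Ioc 1 (s := s) (by simp; linarith)
  have h3 := hasMellin_sub h1.1 h2.1
  have e : wtri =ᵐ[volume.restrict (Set.Ioi 0)] fun t => (Set.Ioc 0 1).indicator (fun _ => (1:ℂ)) t - 
      (Set.Ioc 0 1).indicator (fun t : ℝ => (t:ℂ)^(1:ℂ)) t := by
    filter_upwards [ae_restrict_mem measurableSet_Ioi] with t ht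
    have ht' : 0 < t := ht
    by_cases h : t ≤ 1
    · have hm : t ∈ Set.Ioc (0:ℝ) 1 := ⟨ht, h⟩
      simp only [Set.indicator_of_mem hm, wtri, Complex.cpow_one]
      rw [max_eq_right (by linarith)]; push_cast; ring
    · have hm : t ∉ Set.Ioc (0:ℝ) 1 := fun hh => h hh.2
      simp only [Set.indicator_of_notMem hm, wtri]
      rw [max_eq_left (by linarith)]; simp
  have e2 : (fun t : ℝ => (t:ℂ)^(s-1) • wtri t) =ᵐ[volume.restrict (Set.Ioi 0)] fun t : ℝ => (t:ℂ)^(s-1) • ((Set.Ioc 0 1).indicator (fun _ => (1:ℂ)) t - 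
      (Set.Ioc 0 1).indicator (fun t : ℝ => (t:ℂ)^(1:ℂ)) t) := by
    filter_upwards [e] with t ht; rw [ht]
  constructor
  · have h4 := h3.1
    unfold MellinConvergent IntegrableOn at h4 ⊢
    exact (integrable_congr e2).2 h4
  · have : mellin wtri s = _ := (integral_congr_ae e2).trans h3.2
    rw [this, h1.2, h2.2]
    field_simp; ring

lemma norm_inv_bound {σ y : ℝ} (hσ : 1 ≤ σ) : 
    ‖(1:ℂ) / ((σ + y * Complex.I) * (σ + y * Complex.I + 1))‖ ≤ (1 + y^2)⁻¹ := by
  rw [norm_div, norm_one, norm_mul, ← one_div]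
  have h1 : ∀ τ : ℝ, 1 ≤ τ → Real.sqrt (1 + y^2) ≤ ‖(τ + y * Complex.I : ℂ)‖ := by
    intro τ hτ
    rw [Complex.norm_add_mul_I]
    apply Real.sqrt_le_sqrt
    nlinarith
  have h2 := h1 σ hσ
  have h3 := h1 (σ + 1) (by linarith)
  rw [show ((σ + 1 : ℝ) + y * Complex.I : ℂ) = σ + y * Complex.I + 1 by push_cast; ring] at h3
  apply one_div_le_one_div_of_le (by positivity)
  calc 1 + y^2 = Real.sqrt (1 + y^2) * Real.sqrt (1 + y^2) := (Real.mul_self_sqrt (by positivity)).symm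
    _ ≤ _ := by gcongr

lemma wtri_cont_line {σ : ℝ} (hσ : 1 ≤ σ) : 
    Continuous fun y : ℝ => (1:ℂ) / ((σ + y * Complex.I) * (σ + y * Complex.I + 1)) := by
  apply Continuous.div continuous_const (by fun_prop)
  intro y
  apply mul_ne_zero
  · intro h; have := congrArg Complex.re h; simp at this; linarith
  · intro h; have := congrArg Complex.re h; simp at this; linarith

lemma wtri_integrable {σ : ℝ} (hσ : 1 ≤ σ) : 
    Integrable fun y : ℝ => (1:ℂ) / ((σ + y * Complex.I) * (σ + y * Complex.I + 1)) := by
  refine Integrable.mono' integrable_inv_one_add_sq (wtri_cont_line hσ).aestronglyMeasurable ?_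
  filter_upwards with y using norm_inv_bound hσ

lemma wtri_inv {σ u : ℝ} (hσ : 1 ≤ σ) (hu : 0 < u) :
    (1 / (2 * Real.pi) : ℝ) • ∫ y : ℝ, (u:ℂ)^(-(σ + y * Complex.I : ℂ)) * (1 / ((σ + y * Complex.I) * (σ + y * Complex.I + 1)))
     = wtri u := by
  have hm : ∀ y : ℝ, mellin wtri (σ + y * Complex.I) = 1 / ((σ + y * Complex.I) * (σ + y * Complex.I + 1)) :=
    fun y => (wtri_mellin (by simp; linarith)).2
  have := mellinInv_mellin_eq σ wtri hu (wtri_mellin (by simp; linarith)).1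
    (by
      unfold Complex.VerticalIntegrable
      simp_rw [hm]
      exact wtri_integrable hσ) wtri_cont.continuousAt
  rw [← this, mellinInv]
  simp_rw [hm, smul_eq_mul]

/-- smoothed Perron formula -/
lemma perron {a : ℕ → ℝ} {σ x : ℝ} (hσ : 1 ≤ σ) (hx : 0 < x) 
    (hs : LSeriesSummable (fun n => (a n : ℂ)) (σ : ℂ)) :
    ((∑ n ∈ Finset.Icc 1 ⌊x⌋₊, a n * (1 - n / x) : ℝ) : ℂ) = 
    (1 / (2 * Real.pi) : ℝ) • ∫ y : ℝ, LSeries (fun n => (a n : ℂ)) (σ + y * Complex.I) *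
      ((x:ℂ)^(σ + y * Complex.I : ℂ) * (1 / ((σ + y * Complex.I) * (σ + y * Complex.I + 1)))) := by
  set g : ℕ → ℝ → ℂ := fun n y => LSeries.term (fun n => (a n : ℂ)) (σ + y * Complex.I) n *
      ((x:ℂ)^(σ + y * Complex.I : ℂ) * (1 / ((σ + y * Complex.I) * (σ + y * Complex.I + 1)))) with hg
  have hxc : (x:ℂ) ≠ 0 := by exact_mod_cast hx.ne'
  have hnorm : ∀ n y, ‖g n y‖ = ‖LSeries.term (fun n => (a n : ℂ)) (σ : ℂ) n‖ * (x^σ * 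
      ‖(1:ℂ) / ((σ + y * Complex.I) * (σ + y * Complex.I + 1))‖) := by
    intro n y
    rw [hg]
    simp only [norm_mul]
    rw [LSeries.norm_term_eq, LSeries.norm_term_eq, Complex.norm_cpow_eq_rpow_re_of_pos hx]
    simp
  have hcont : ∀ n, Continuous (g n) := by
    intro n
    refine Continuous.mul ?_ (Continuous.mul ?_ (wtri_cont_line hσ))
    · rcases eq_or_ne n 0 with rfl | hn
      · simpa using continuous_const
      · simp_rw [LSeries.term_of_ne_zero hn]
        have hn' : (n:ℂ) ≠ 0 := by exact_mod_cast hn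
        refine Continuous.div continuous_const ?_ ?_
        · exact Continuous.const_cpow (by fun_prop) (Or.inl hn')
        · intro y; simp [Complex.cpow_eq_zero_iff, hn']
    · exact Continuous.const_cpow (by fun_prop) (Or.inl hxc)
  have hint : ∀ n, Integrable (g n) := by
    intro n
    have : Integrable fun y : ℝ => ‖LSeries.term (fun n => (a n : ℂ)) (σ : ℂ) n‖ * (x^σ * 
      ‖(1:ℂ) / ((σ + y * Complex.I) * (σ + y * Complex.I + 1))‖) := 
      ((wtri_integrable hσ).norm.const_mul _).const_mul _
    exact this.mono' (hcont n).aestronglyMeasurable (by filter_upwards with y using (hnorm n y).le)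
  have hsum : Summable fun n => ∫ y, ‖g n y‖ := by
    simp_rw [hnorm, integral_const_mul]
    exact Summable.mul_right _ hs.norm
  have hsw := hasSum_integral_of_summable_integral_norm hint hsum
  have e1 : ∀ y : ℝ, LSeries (fun n => (a n : ℂ)) (σ + y * Complex.I) *
      ((x:ℂ)^(σ + y * Complex.I : ℂ) * (1 / ((σ + y * Complex.I) * (σ + y * Complex.I + 1)))) = ∑' n, g n y := by
    intro y; rw [LSeries, ← tsum_mul_right]
  simp_rw [e1]
  rw [← hsw.tsum_eq, ← tsum_const_smul'']
  have e2 : ∀ n, (1 / (2 * Real.pi) : ℝ) • ∫ y, g n y = if n ∈ Finset.Icc 1 ⌊x⌋₊ then ((a n * (1 - n / x) : ℝ) : ℂ) else 0 := by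
    intro n
    rcases eq_or_ne n 0 with rfl | hn
    · simp [hg]
    · have hn0 : (0:ℝ) < n := by positivity
      have e3 : ∀ y, g n y = a n * (((n / x : ℝ) : ℂ)^(-(σ + y * Complex.I : ℂ)) * (1 / ((σ + y * Complex.I) * (σ + y * Complex.I + 1)))) := by
        intro y
        simp only [hg]
        rw [LSeries.term_of_ne_zero hn, Complex.ofReal_div, Complex.ofReal_natCast]
        have : ((n:ℂ) / x)^(-(σ + y * Complex.I : ℂ)) = (n:ℂ)^(-(σ + y * Complex.I : ℂ)) * (x:ℂ)^((σ + y * Complex.I : ℂ)) := by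
          have h1 := Complex.mul_cpow_ofReal_nonneg hn0.le (inv_nonneg.2 hx.le) (-(σ + y * Complex.I : ℂ))
          rw [Complex.ofReal_inv, Complex.ofReal_natCast] at h1
          rw [div_eq_mul_inv, h1, ← Complex.ofReal_inv, Complex.ofReal_inv, Complex.inv_cpow, ← Complex.cpow_neg, neg_neg]
          rw [Complex.arg_ofReal_of_nonneg hx.le]; exact Real.pi_pos.ne
        rw [this, Complex.cpow_neg]
        ring
      simp_rw [e3]
      rw [integral_const_mul, ← mul_smul_comm, wtri_inv hσ (by positivity), wtri]
      split_ifs with hm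
      · rw [Finset.mem_Icc] at hm
        have : (n:ℝ) ≤ x := (Nat.le_floor_iff hx.le).1 hm.2
        rw [max_eq_right (by rw [sub_nonneg, div_le_one hx]; exact this)]
        push_cast; ring
      · have : ¬ (n:ℝ) ≤ x := fun h => hm (Finset.mem_Icc.2 ⟨Nat.one_le_iff_ne_zero.2 hn, (Nat.le_floor_iff hx.le).2 h⟩)
        rw [max_eq_left (by rw [sub_nonpos, le_div_iff₀ hx]; linarith)]; simp
  simp_rw [e2]
  rw [tsum_eq_sum (s := Finset.Icc 1 ⌊x⌋₊) (fun n hn => by simp [hn])]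
  rw [Complex.ofReal_sum]
  exact Finset.sum_congr rfl fun n hn => by simp [hn]
end

section
open MeasureTheory

structure PerronData (a : ℕ → ℝ) (F : ℂ → ℂ) (c₀ C₀ : ℝ) (k : ℕ) : Prop where
  c₀_pos : 0 < c₀
  c₀_le : c₀ ≤ 1/2
  C₀_pos : 0 < C₀
  diff : ∀ (T : ℝ) (s : ℂ), 3 ≤ T → |s.im| ≤ T → 1 - c₀ / Real.log T ≤ s.re → s.re ≤ 2 →
    DifferentiableAt ℂ F s ∧ ‖F s‖ ≤ C₀ * T^((1:ℝ)/2)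
  eq : ∀ s : ℂ, 1 < s.re → F s = LSeries (fun n => (a n : ℂ)) s
  summ : ∀ σ : ℝ, 1 < σ → σ ≤ 2 → Summable (fun n : ℕ => |a n| * (n:ℝ)^(-σ)) ∧
    ∑' n : ℕ, |a n| * (n:ℝ)^(-σ) ≤ C₀ / (σ-1)^k
  summ2 : ∀ σ : ℝ, 1 < σ → σ ≤ 2 → Summable (fun n : ℕ => (a n)^2 * (n:ℝ)^(-σ)) ∧
    ∑' n : ℕ, (a n)^2 * (n:ℝ)^(-σ) ≤ C₀ / (σ-1)^k

lemma tail_arctan {T : ℝ} (hT : 0 < T) {H : ℝ → ℂ} {B : ℝ} (hB : 0 ≤ B) (hi : Integrable H) 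
    (hH : ∀ y, ‖H y‖ ≤ B * (1 + y^2)⁻¹) :
    ‖∫ y, H y‖ ≤ ‖∫ y in (-T)..T, H y‖ + 2 * B / T := by
  have h1 : ∫ y, H y = (∫ y in (-T)..T, H y) + ∫ y in (Set.Ioc (-T) T)ᶜ, H y := by
    rw [intervalIntegral.integral_of_le (by linarith), integral_add_compl measurableSet_Ioc hi]
  have h2 : ‖∫ y in (Set.Ioc (-T) T)ᶜ, H y‖ ≤ ∫ y in (Set.Ioc (-T) T)ᶜ, B * (1 + y^2)⁻¹ :=
    norm_integral_le_of_norm_le ((integrable_inv_one_add_sq.const_mul B).integrableOn) 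
      (by filter_upwards with y using hH y)
  have h3 : ∫ y in (Set.Ioc (-T) T)ᶜ, B * (1 + y^2)⁻¹ = B * (Real.pi - 2 * Real.arctan T) := by
    have := integral_add_compl (μ := volume) (s := Set.Ioc (-T) T) measurableSet_Ioc (integrable_inv_one_add_sq)
    rw [← intervalIntegral.integral_of_le (by linarith), integral_inv_one_add_sq, integral_univ_inv_one_add_sq, Real.arctan_neg] at this
    rw [integral_const_mul]
    congr 1; linarith
  have h4 := Real.arctan_inv_of_pos hT
  have h5 : Real.arctan T⁻¹ ≤ T⁻¹ := by
    have := Real.le_tan (x := Real.arctan T⁻¹) (Real.arctan_nonneg.2 (by positivity)) (Real.arctan_lt_pi_div_two _)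
    rwa [Real.tan_arctan] at this
  rw [h1]
  refine (norm_add_le _ _).trans ?_
  gcongr
  rw [h3] at h2
  refine h2.trans ?_
  rw [mul_comm 2 B, mul_div_assoc]
  gcongr
  rw [div_eq_mul_inv]; linarith

namespace PerronData
variable {a : ℕ → ℝ} {F : ℂ → ℂ} {c₀ C₀ : ℝ} {k : ℕ}

lemma lsumm (h : PerronData a F c₀ C₀ k) {s : ℂ} (hs : 1 < s.re) (hs2 : s.re ≤ 2) :
    LSeriesSummable (fun n => (a n : ℂ)) s ∧ ‖LSeries (fun n => (a n : ℂ)) s‖ ≤ C₀ / (s.re - 1)^k := by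
  obtain ⟨h1, h2⟩ := h.summ s.re hs hs2
  have e : (fun n => ‖LSeries.term (fun n => (a n : ℂ)) s n‖) = fun n : ℕ => |a n| * (n:ℝ)^(-s.re) := by
    ext n
    rw [LSeries.norm_term_eq]
    split_ifs with hn
    · subst hn; rw [Nat.cast_zero, Real.zero_rpow (by linarith), mul_zero]
    · rw [Real.rpow_neg (by positivity)]; simp [div_eq_mul_inv]
  have h3 : Summable fun n => ‖LSeries.term (fun n => (a n : ℂ)) s n‖ := by rw [e]; exact h1
  refine ⟨h3.of_norm, (norm_tsum_le_tsum_norm h3).trans ?_⟩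
  rw [e]; exact h2

lemma norm_inv_le {s : ℂ} (hs : 1/2 ≤ s.re) : ‖1 / (s * (s+1))‖ ≤ 2 ∧ 
    (s.im ≠ 0 → ‖1 / (s * (s+1))‖ ≤ 1 / s.im^2) := by
  have h1 := (le_abs_self _).trans (Complex.abs_re_le_norm s)
  have h2 := (le_abs_self _).trans (Complex.abs_re_le_norm (s+1))
  have h3 := Complex.abs_im_le_norm s
  have h4 := Complex.abs_im_le_norm (s+1)
  simp only [Complex.add_re, Complex.one_re, Complex.add_im, Complex.one_im, add_zero] at h2 h4
  rw [norm_div, norm_mul, norm_one]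
  constructor
  · rw [div_le_iff₀ (by nlinarith)]; nlinarith
  · intro h0
    have h5 := abs_pos.2 h0
    rw [← sq_abs]
    apply one_div_le_one_div_of_le (by positivity)
    nlinarith

set_option maxHeartbeats 1000000 in
lemma smooth_bound (h : PerronData a F c₀ C₀ k) {x T : ℝ} (hx : 3 ≤ x) (hT : 3 ≤ T) :
    |∑ n ∈ Finset.Icc 1 ⌊x⌋₊, a n * (1 - n / x)| ≤ 
      20 * C₀ * x * ((Real.log x)^k / T + T^2 * Real.exp (-c₀ * Real.log x / Real.log T)) := by
  have hlx := ZetaLike.one_le_log hx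
  have hlT := ZetaLike.one_le_log hT
  have hx0 : 0 < x := by linarith
  have hT0 : 0 < T := by linarith
  have hc := h.c₀_pos
  have hc2 := h.c₀_le
  have hC := h.C₀_pos
  set lx := Real.log x with hlxd
  set lT := Real.log T with hlTd
  have hlx0 : 0 < lx := by linarith
  have hlT0 : 0 < lT := by linarith
  set σ := 1 + 1 / lx with hσ
  have h1l : 0 < 1 / lx := by positivity
  have h1l1 : 1 / lx ≤ 1 := by rw [div_le_one hlx0]; exact hlx
  set τ := 1 - c₀ / lT with hτ
  have hct : 0 < c₀ / lT := by positivity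
  have hct1 : c₀ / lT ≤ 1/2 := by rw [div_le_iff₀ hlT0]; nlinarith
  have hxσ : x^σ = Real.exp 1 * x := by
    rw [hσ, Real.rpow_add hx0, Real.rpow_one, Real.rpow_def_of_pos hx0, mul_comm]
    congr 2; rw [← hlxd]; field_simp
  have hxτ : x^τ = x * Real.exp (-c₀ * lx / lT) := by
    rw [hτ, sub_eq_add_neg, Real.rpow_add hx0, Real.rpow_one, Real.rpow_def_of_pos hx0]
    congr 2; rw [← hlxd]; field_simp
  have he := Real.exp_one_lt_d9
  have hTh : T^((1:ℝ)/2) ≤ T := by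
    conv_rhs => rw [← Real.rpow_one T]
    apply Real.rpow_le_rpow_of_exponent_le <;> linarith
  set Φ : ℂ → ℂ := fun s => F s * ((x:ℂ)^s * (1 / (s * (s+1)))) with hΦ
  set Hh : ℝ → ℂ := fun y => LSeries (fun n => (a n : ℂ)) (σ + y * Complex.I) *
      ((x:ℂ)^(σ + y * Complex.I : ℂ) * (1 / ((σ + y * Complex.I) * (σ + y * Complex.I + 1)))) with hHh
  have hxc : (x:ℂ) ≠ 0 := by exact_mod_cast hx0.ne'
  have hσre : ∀ y : ℝ, (σ + y * Complex.I : ℂ).re = σ := by intro y; simp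
  have hHΦ : ∀ y : ℝ, Hh y = Φ (σ + y * Complex.I) := by
    intro y; simp only [hHh, hΦ]; rw [h.eq _ (by rw [hσre]; linarith)]
  have hsσ := h.lsumm (s := (σ:ℂ)) (by simp; linarith) (by simp; linarith)
  have hper := perron (a := a) (σ := σ) (by linarith) hx0 hsσ.1
  have hbH : ∀ y, ‖Hh y‖ ≤ (C₀ * lx^k * (Real.exp 1 * x)) * (1 + y^2)⁻¹ := by
    intro y
    have h1 := (h.lsumm (s := σ + y * Complex.I) (by rw [hσre]; linarith) (by rw [hσre]; linarith)).2
    rw [hσre] at h1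
    have h2 : C₀ / (σ - 1)^k = C₀ * lx^k := by
      rw [hσ, add_sub_cancel_left, one_div, inv_pow, div_inv_eq_mul]
    rw [h2] at h1
    simp only [hHh, norm_mul]
    rw [Complex.norm_cpow_eq_rpow_re_of_pos hx0, hσre, hxσ, ← mul_assoc]
    gcongr
    exact norm_inv_bound (σ := σ) (y := y) (by linarith)
  have hΦd : ∀ s : ℂ, |s.im| ≤ T → τ ≤ s.re → s.re ≤ 2 → DifferentiableAt ℂ Φ s := by
    intro s h1 h2 h3
    have hs0 : s ≠ 0 := by rintro rfl; simp at h2; linarith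
    have hs1 : s + 1 ≠ 0 := by
      intro h0; have := congrArg Complex.re h0; simp at this; linarith
    refine (h.diff T s hT h1 h2 h3).1.mul (DifferentiableAt.mul ?_ ?_)
    · exact (differentiableAt_id).const_cpow (Or.inl hxc)
    · exact (differentiableAt_const _).div (by fun_prop) (mul_ne_zero hs0 hs1)
  have hHcont : Continuous Hh := by
    rw [continuous_iff_continuousAt]
    intro y
    have : Hh = Φ ∘ (fun y : ℝ => (σ + y * Complex.I : ℂ)) := by ext y; exact hHΦ y
    rw [this]
    refine ContinuousAt.comp ?_ (by fun_prop)
    have hs0 : (σ + y * Complex.I : ℂ) ≠ 0 := by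
      intro h0; have := congrArg Complex.re h0; simp at this; linarith
    have hs1 : (σ + y * Complex.I : ℂ) + 1 ≠ 0 := by
      intro h0; have := congrArg Complex.re h0; simp at this; linarith
    have hd := (h.diff (max 3 |y|) (σ + y * Complex.I) (le_max_left _ _) (by simp) (by
      rw [hσre]
      have : 0 < c₀ / Real.log (max 3 |y|) := div_pos hc (by linarith [ZetaLike.one_le_log (le_max_left 3 |y|)])
      linarith) (by rw [hσre]; linarith)).1
    refine (hd.mul (DifferentiableAt.mul ?_ ?_)).continuousAt
    · exact (differentiableAt_id).const_cpow (Or.inl hxc)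
    · exact (differentiableAt_const _).div (by fun_prop) (mul_ne_zero hs0 hs1)
  have hHint : Integrable Hh := 
    Integrable.mono' (integrable_inv_one_add_sq.const_mul _) hHcont.aestronglyMeasurable (by filter_upwards with y using hbH y)
  have htail := tail_arctan hT0 (by positivity) hHint hbH
  have hrect := Complex.integral_boundary_rect_eq_zero_of_differentiableOn Φ 
    (τ + (-T : ℝ) * Complex.I) (σ + T * Complex.I) (by
      intro s hs
      rw [Complex.mem_reProdIm] at hs
      have h1 := hs.1
      have h2 := hs.2
      simp only [Complex.add_re, Complex.ofReal_re, Complex.mul_re, Complex.I_re, mul_zero, Complex.ofReal_im, Complex.I_im,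
        mul_one, sub_zero, add_zero, Complex.add_im, Complex.mul_im, zero_add, zero_mul] at h1 h2
      rw [Set.uIcc_of_le (by linarith)] at h1 h2
      exact (hΦd s (abs_le.2 h2) h1.1 (by linarith [h1.2])).differentiableWithinAt)
  simp only [Complex.add_re, Complex.ofReal_re, Complex.mul_re, Complex.I_re, mul_zero, Complex.ofReal_im, Complex.I_im,
        mul_one, sub_zero, add_zero, Complex.add_im, Complex.mul_im, zero_add, zero_mul] at hrect
  have hhor : ∀ u : ℝ, |u| = T → ‖∫ v in τ..σ, Φ (v + u * Complex.I)‖ ≤ 2 * (C₀ * (Real.exp 1 * x) / T) := by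
    intro u hu
    have := intervalIntegral.norm_integral_le_of_norm_le_const (a := τ) (b := σ) (f := fun v : ℝ => Φ (v + u * Complex.I))
      (C := C₀ * (Real.exp 1 * x) / T) (by
      intro v hv
      rw [Set.uIoc_of_le (by linarith)] at hv
      have hre : (v + u * Complex.I : ℂ).re = v := by simp
      have him : (v + u * Complex.I : ℂ).im = u := by simp
      have hb := (h.diff T (v + u * Complex.I) hT (by rw [him, hu]) (by rw [hre]; exact hv.1.le) (by rw [hre]; linarith [hv.2])).2
      have hu0 : u ≠ 0 := by intro h0; rw [h0, abs_zero] at hu; linarith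
      have hi := (norm_inv_le (s := v + u * Complex.I) (by rw [hre]; linarith [hv.1])).2 (by rwa [him])
      rw [him, ← sq_abs, hu] at hi
      simp only [hΦ]
      rw [norm_mul, norm_mul, Complex.norm_cpow_eq_rpow_re_of_pos hx0, hre]
      have hxv : x^v ≤ Real.exp 1 * x := by
        rw [← hxσ]; exact Real.rpow_le_rpow_of_exponent_le (by linarith) hv.2
      calc _ ≤ (C₀ * T) * ((Real.exp 1 * x) * (1 / T^2)) := by
            gcongr; exact hb.trans (by gcongr)
        _ = _ := by field_simp)
    refine this.trans ?_
    rw [mul_comm]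
    gcongr
    rw [abs_of_nonneg (by linarith)]; linarith
  have hver : ‖∫ y in (-T)..T, Φ (τ + y * Complex.I)‖ ≤ C₀ * T * (x^τ * 2) * (2 * T) := by
    have := intervalIntegral.norm_integral_le_of_norm_le_const (a := -T) (b := T) (f := fun y : ℝ => Φ (τ + y * Complex.I))
      (C := C₀ * T * (x^τ * 2)) (by
      intro y hy
      rw [Set.uIoc_of_le (by linarith)] at hy
      have hre : (τ + y * Complex.I : ℂ).re = τ := by simp
      have him : (τ + y * Complex.I : ℂ).im = y := by simp
      have hb := (h.diff T (τ + y * Complex.I) hT (by rw [him, abs_le]; exact ⟨hy.1.le, hy.2⟩) (by rw [hre]) (by rw [hre]; linarith)).2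
      have hi := (norm_inv_le (s := τ + y * Complex.I) (by rw [hre]; linarith)).1
      simp only [hΦ]
      rw [norm_mul, norm_mul, Complex.norm_cpow_eq_rpow_re_of_pos hx0, hre]
      gcongr; exact hb.trans (by gcongr))
    rw [show |T - -T| = 2 * T by rw [abs_of_nonneg (by linarith)]; ring] at this
    exact this
  have hHI : ∫ y in (-T)..T, Hh y = ∫ y in (-T)..T, Φ (σ + y * Complex.I) := by
    congr 1; ext y; exact hHΦ y
  have hmid : ‖∫ y in (-T)..T, Hh y‖ ≤ 4 * (C₀ * (Real.exp 1 * x) / T) + C₀ * T * (x^τ * 2) * (2 * T) := by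
    rw [hHI]
    set I1 := ∫ v in τ..σ, Φ (v + (-T:ℝ) * Complex.I)
    set I2 := ∫ v in τ..σ, Φ (v + T * Complex.I)
    set I3 := ∫ y in (-T)..T, Φ (σ + y * Complex.I)
    set I4 := ∫ y in (-T)..T, Φ (τ + y * Complex.I)
    have e : Complex.I • I3 = I2 - I1 + Complex.I • I4 := by
      linear_combination hrect
    have e2 : ‖I3‖ = ‖I2 - I1 + Complex.I • I4‖ := by rw [← e]; simp
    rw [e2]
    have f1 := norm_add_le (I2 - I1) (Complex.I • I4)
    have f2 := norm_sub_le I2 I1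
    have f3 : ‖Complex.I • I4‖ = ‖I4‖ := by simp
    have g1 := hhor (-T) (by rw [abs_neg, abs_of_pos hT0])
    have g2 := hhor T (abs_of_pos hT0)
    linarith
  have hfin : |∑ n ∈ Finset.Icc 1 ⌊x⌋₊, a n * (1 - n / x)| ≤ ‖∫ y, Hh y‖ := by
    rw [← Real.norm_eq_abs, ← Complex.norm_real, hper, norm_smul, Real.norm_of_nonneg (by positivity)]
    apply mul_le_of_le_one_left (norm_nonneg _)
    rw [div_le_one (by positivity)]
    linarith [Real.pi_gt_three]
  refine hfin.trans (htail.trans ?_)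
  have hlk : 1 ≤ lx^k := one_le_pow₀ hlx
  have k1 : 4 * (C₀ * (Real.exp 1 * x) / T) ≤ 11 * C₀ * x * (lx^k / T) := by
    calc _ = (4 * Real.exp 1) * (C₀ * x * (1 / T)) := by ring
      _ ≤ 11 * (C₀ * x * (lx^k / T)) := by gcongr; linarith
      _ = _ := by ring
  have k2 : 2 * (C₀ * lx^k * (Real.exp 1 * x)) / T ≤ 6 * C₀ * x * (lx^k / T) := by
    calc _ = (2 * Real.exp 1) * (C₀ * x * (lx^k / T)) := by ring
      _ ≤ 6 * (C₀ * x * (lx^k / T)) := by gcongr; linarith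
      _ = _ := by ring
  have k3 : C₀ * T * (x^τ * 2) * (2 * T) = 4 * C₀ * x * (T^2 * Real.exp (-c₀ * lx / lT)) := by
    rw [hxτ]; ring
  have p1 : 0 ≤ C₀ * x * (lx^k / T) := by positivity
  have p2 : 0 ≤ C₀ * x * (T^2 * Real.exp (-c₀ * lx / lT)) := by positivity
  calc _ ≤ 11 * C₀ * x * (lx^k / T) + 4 * C₀ * x * (T^2 * Real.exp (-c₀ * lx / lT)) + 6 * C₀ * x * (lx^k / T) := by linarith
    _ ≤ 20 * (C₀ * x * (lx^k / T)) + 20 * (C₀ * x * (T^2 * Real.exp (-c₀ * lx / lT))) := by linarith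
    _ = _ := by ring
end PerronData
end

section
lemma pow_le_const_exp (m : ℕ) {β : ℝ} (hβ : 0 < β) : ∃ K : ℝ, 0 < K ∧ ∀ u : ℝ, 0 ≤ u → u^m ≤ K * Real.exp (β * u) := by
  refine ⟨m.factorial / β^m, by positivity, fun u hu => ?_⟩
  have := Real.pow_div_factorial_le_exp (β * u) (by positivity) m
  rw [div_le_iff₀ (by positivity), mul_pow] at this
  rw [div_mul_eq_mul_div, le_div_iff₀ (by positivity)]
  linarith

namespace PerronData
variable {a : ℕ → ℝ} {F : ℂ → ℂ} {c₀ C₀ : ℝ} {k : ℕ}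

lemma sqrtlog {x : ℝ} (hx : 3 ≤ x) : 1 ≤ Real.sqrt (Real.log x) ∧ Real.sqrt (Real.log x)^2 = Real.log x := by
  have := ZetaLike.one_le_log hx
  exact ⟨by rw [Real.one_le_sqrt]; exact this, Real.sq_sqrt (by linarith)⟩

lemma smooth_exp (h : PerronData a F c₀ C₀ k) : ∃ α K : ℝ, 0 < α ∧ α ≤ 1 ∧ 0 < K ∧ ∀ x : ℝ, 3 ≤ x →
    |∑ n ∈ Finset.Icc 1 ⌊x⌋₊, a n * (1 - n / x)| ≤ K * x * Real.exp (-α * Real.sqrt (Real.log x)) := by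
  have hc := h.c₀_pos
  have hc2 := h.c₀_le
  have hC := h.C₀_pos
  set γ := c₀ / 12 with hγ
  have hγ0 : 0 < γ := by positivity
  obtain ⟨K, hK, hKe⟩ := pow_le_const_exp (2 * k) (half_pos hγ0)
  refine ⟨γ/2, 20 * C₀ * (K + 9), by positivity, by linarith, by positivity, fun x hx => ?_⟩
  obtain ⟨hu1, hu2⟩ := sqrtlog hx
  set u := Real.sqrt (Real.log x) with hu
  have hT : 3 ≤ 3 * Real.exp (γ * u) := by
    have := Real.one_le_exp (x := γ * u) (by positivity)
    linarith
  have hb := h.smooth_bound hx hT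
  refine hb.trans ?_
  have hx0 : 0 < x := by linarith
  have hlT : Real.log (3 * Real.exp (γ * u)) = Real.log 3 + γ * u := by
    rw [Real.log_mul (by norm_num) (by positivity), Real.log_exp]
  have hl3 : Real.log 3 ≤ 2 := (Real.log_le_sub_one_of_pos (by norm_num)).trans (by norm_num)
  have hl3p : 0 < Real.log 3 := Real.log_pos (by norm_num)
  rw [hlT, ← hu2]
  have e1 : (u^2)^k / (3 * Real.exp (γ * u)) ≤ K * Real.exp (-(γ/2) * u) := by
    rw [← pow_mul, div_le_iff₀ (by positivity)]
    calc u^(2*k) ≤ K * Real.exp (γ/2 * u) := hKe u (by linarith)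
      _ = K * Real.exp (-(γ/2) * u) * Real.exp (γ * u) := by rw [mul_assoc, ← Real.exp_add]; ring_nf
      _ ≤ K * Real.exp (-(γ/2) * u) * (3 * Real.exp (γ * u)) := by
        have : 0 < Real.exp (γ * u) := Real.exp_pos _
        gcongr; linarith
  have e2 : (3 * Real.exp (γ * u))^2 * Real.exp (-c₀ * u^2 / (Real.log 3 + γ * u)) ≤ 9 * Real.exp (-(γ/2) * u) := by
    rw [mul_pow, ← Real.exp_nat_mul, mul_assoc, ← Real.exp_add]
    norm_num
    rw [div_eq_mul_inv]
    have h3u : Real.log 3 + γ * u ≤ 3 * u := by nlinarith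
    have hpos : 0 < Real.log 3 + γ * u := by positivity
    have : c₀ * u^2 / (Real.log 3 + γ * u) ≥ 4 * γ * u := by
      rw [ge_iff_le, le_div_iff₀ hpos]
      calc 4 * γ * u * (Real.log 3 + γ * u) ≤ 4 * γ * u * (3 * u) := by gcongr
        _ = _ := by rw [hγ]; ring
    rw [neg_mul, ← div_eq_mul_inv]
    have : 0 < γ * u := by positivity
    linarith
  calc _ ≤ 20 * C₀ * x * (K * Real.exp (-(γ/2) * u) + 9 * Real.exp (-(γ/2) * u)) := by gcongr
    _ = _ := by ring

lemma second_moment (h : PerronData a F c₀ C₀ k) {x : ℝ} (hx : 3 ≤ x) :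
    ∑ n ∈ Finset.Icc 1 ⌊x⌋₊, (a n)^2 ≤ 3 * C₀ * x * (Real.log x)^k := by
  have hlx := ZetaLike.one_le_log hx
  have hx0 : 0 < x := by linarith
  have hC := h.C₀_pos
  set lx := Real.log x with hlxd
  have hlx0 : 0 < lx := by linarith
  set σ := 1 + 1 / lx with hσ
  have h1l : 0 < 1 / lx := by positivity
  have h1l1 : 1 / lx ≤ 1 := by rw [div_le_one hlx0]; exact hlx
  have hxσ : x^σ = Real.exp 1 * x := by
    rw [hσ, Real.rpow_add hx0, Real.rpow_one, Real.rpow_def_of_pos hx0, mul_comm]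
    congr 2; rw [← hlxd]; field_simp
  obtain ⟨h1, h2⟩ := h.summ2 σ (by linarith) (by linarith)
  have h3 : C₀ / (σ - 1)^k = C₀ * lx^k := by
    rw [hσ, add_sub_cancel_left, one_div, inv_pow, div_inv_eq_mul]
  rw [h3] at h2
  calc _ ≤ ∑ n ∈ Finset.Icc 1 ⌊x⌋₊, x^σ * ((a n)^2 * (n:ℝ)^(-σ)) := by
        refine Finset.sum_le_sum fun n hn => ?_
        rw [Finset.mem_Icc] at hn
        have hn0 : (0:ℝ) < n := by exact_mod_cast hn.1
        have hnx : (n:ℝ) ≤ x := (Nat.le_floor_iff hx0.le).1 hn.2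
        rw [Real.rpow_neg hn0.le]
        have : 1 ≤ x^σ * ((n:ℝ)^σ)⁻¹ := by
          rw [← div_eq_mul_inv, one_le_div (by positivity)]
          exact Real.rpow_le_rpow hn0.le hnx (by linarith)
        calc (a n)^2 = (a n)^2 * 1 := by ring
          _ ≤ (a n)^2 * (x^σ * ((n:ℝ)^σ)⁻¹) := by gcongr
          _ = _ := by ring
    _ = x^σ * ∑ n ∈ Finset.Icc 1 ⌊x⌋₊, ((a n)^2 * (n:ℝ)^(-σ)) := by rw [Finset.mul_sum]
    _ ≤ x^σ * (C₀ * lx^k) := by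
        gcongr
        refine le_trans (h1.sum_le_tsum _ fun n _ => by positivity) h2
    _ ≤ (3 * x) * (C₀ * lx^k) := by
        rw [hxσ]; gcongr; linarith [Real.exp_one_lt_d9]
    _ = _ := by ring

set_option maxHeartbeats 1000000 in
lemma sum_exp (h : PerronData a F c₀ C₀ k) : ∃ α K : ℝ, 0 < α ∧ 0 < K ∧ ∀ x : ℝ, 3 ≤ x →
    |∑ n ∈ Finset.Icc 1 ⌊x⌋₊, a n| ≤ K * x * Real.exp (-α * Real.sqrt (Real.log x)) := by
  obtain ⟨α, K, hα, hα1, hK, hS⟩ := h.smooth_exp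
  have hC := h.C₀_pos
  set β := α / 2 with hβ
  have hβ0 : 0 < β := by positivity
  obtain ⟨K2, hK2, hKe⟩ := pow_le_const_exp (2 * k) (half_pos hβ0)
  set D := 12 * C₀ * 2^k * K2 with hD
  have hD0 : 0 < D := by positivity
  refine ⟨β/4, 5 * K + Real.sqrt D, by positivity, by positivity, fun x hx => ?_⟩
  obtain ⟨hu1, hu2⟩ := sqrtlog hx
  have hx0 : 0 < x := by linarith
  set u := Real.sqrt (Real.log x) with hu
  have hu0 : 0 < u := by linarith
  set E := Real.exp (-β * u) with hE
  have hE0 : 0 < E := Real.exp_pos _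
  have hE1 : E ≤ 1 := Real.exp_le_one_iff.2 (by nlinarith)
  have hEx : 1 ≤ x * E := by
    rw [← Real.exp_log hx0, hE, ← Real.exp_add, ← hu2]
    apply Real.one_le_exp; nlinarith
  set z := x + x * E with hz
  have hzx : x ≤ z := by linarith
  have hz2 : z ≤ 2 * x := by nlinarith
  have hz0 : 0 < z := by linarith
  have hfl : ⌊x⌋₊ ≤ ⌊z⌋₊ := Nat.floor_le_floor hzx
  have hSz := hS z (by linarith)
  have hSx := hS x hx
  have hmono : Real.exp (-α * Real.sqrt (Real.log z)) ≤ Real.exp (-α * u) := by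
    have : u ≤ Real.sqrt (Real.log z) := Real.sqrt_le_sqrt (Real.log_le_log hx0 hzx)
    apply Real.exp_le_exp.2; nlinarith
  have hEE : Real.exp (-α * u) = E * E := by
    rw [hE, ← Real.exp_add]; congr 1; rw [hβ]; ring
  rw [hEE] at hmono hSx
  -- identity
  have hdisj : ∑ n ∈ Finset.Icc 1 ⌊z⌋₊, a n * (z - n) = ∑ n ∈ Finset.Icc 1 ⌊x⌋₊, a n * (z - n) + 
      ∑ n ∈ Finset.Ioc ⌊x⌋₊ ⌊z⌋₊, a n * (z - n) := by
    have e : ∀ m : ℕ, Finset.Icc 1 m = Finset.Ioc 0 m := fun m => by ext; simp [Nat.lt_iff_add_one_le]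
    rw [e, e, Finset.sum_Ioc_consecutive _ (Nat.zero_le _) hfl]
  have hid : x * E * ∑ n ∈ Finset.Icc 1 ⌊x⌋₊, a n = z * ∑ n ∈ Finset.Icc 1 ⌊z⌋₊, a n * (1 - n / z) -
      x * ∑ n ∈ Finset.Icc 1 ⌊x⌋₊, a n * (1 - n / x) - ∑ n ∈ Finset.Ioc ⌊x⌋₊ ⌊z⌋₊, a n * (z - n) := by
    have e1 : z * ∑ n ∈ Finset.Icc 1 ⌊z⌋₊, a n * (1 - n / z) = ∑ n ∈ Finset.Icc 1 ⌊z⌋₊, a n * (z - n) := by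
      rw [Finset.mul_sum]; refine Finset.sum_congr rfl fun n _ => by field_simp
    have e2 : x * ∑ n ∈ Finset.Icc 1 ⌊x⌋₊, a n * (1 - n / x) = ∑ n ∈ Finset.Icc 1 ⌊x⌋₊, a n * (x - n) := by
      rw [Finset.mul_sum]; refine Finset.sum_congr rfl fun n _ => by field_simp
    rw [e1, e2, hdisj, add_sub_right_comm, add_sub_cancel_right, ← Finset.sum_sub_distrib, Finset.mul_sum]
    refine Finset.sum_congr rfl fun n _ => by rw [hz]; ring
  set Q := ∑ n ∈ Finset.Ioc ⌊x⌋₊ ⌊z⌋₊, |a n| with hQ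
  have hQ1 : |∑ n ∈ Finset.Ioc ⌊x⌋₊ ⌊z⌋₊, a n * (z - n)| ≤ x * E * Q := by
    refine (Finset.abs_sum_le_sum_abs _ _).trans ?_
    rw [hQ, Finset.mul_sum]
    refine Finset.sum_le_sum fun n hn => ?_
    rw [Finset.mem_Ioc] at hn
    have h1 : x < n := (Nat.floor_lt hx0.le).1 hn.1
    have h2 : (n:ℝ) ≤ z := (Nat.le_floor_iff hz0.le).1 hn.2
    rw [abs_mul, abs_of_nonneg (show 0 ≤ z - n by linarith), mul_comm]
    gcongr; linarith
  have hQ2 : Q ≤ Real.sqrt D * x * Real.exp (-(β/4) * u) := by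
    have h1 : Q^2 ≤ (⌊z⌋₊ - ⌊x⌋₊ : ℕ) * ∑ n ∈ Finset.Ioc ⌊x⌋₊ ⌊z⌋₊, (a n)^2 := by
      have := sq_sum_le_card_mul_sum_sq (s := Finset.Ioc ⌊x⌋₊ ⌊z⌋₊) (f := fun n => |a n|)
      simpa using this
    have h2 : ((⌊z⌋₊ - ⌊x⌋₊ : ℕ) : ℝ) ≤ 2 * (x * E) := by
      rw [Nat.cast_sub hfl]
      have := Nat.floor_le hz0.le
      have := Nat.lt_floor_add_one x
      linarith
    have h3 : ∑ n ∈ Finset.Ioc ⌊x⌋₊ ⌊z⌋₊, (a n)^2 ≤ 3 * C₀ * (2 * x) * (2 * u^2)^k := by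
      calc _ ≤ ∑ n ∈ Finset.Icc 1 ⌊z⌋₊, (a n)^2 := by
            refine Finset.sum_le_sum_of_subset_of_nonneg (fun n hn => ?_) fun _ _ _ => sq_nonneg _
            rw [Finset.mem_Ioc] at hn; rw [Finset.mem_Icc]; omega
        _ ≤ 3 * C₀ * z * (Real.log z)^k := h.second_moment (by linarith)
        _ ≤ _ := by
          have : Real.log z ≤ 2 * u^2 := by
            rw [hu2, show 2 * Real.log x = Real.log (x^2) by rw [Real.log_pow]; norm_num]
            exact Real.log_le_log hz0 (by nlinarith)
          have : 0 ≤ Real.log z := by linarith [ZetaLike.one_le_log (show 3 ≤ z by linarith)]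
          gcongr
    have h4 : Q^2 ≤ D * x^2 * Real.exp (-(β/2) * u) := by
      calc Q^2 ≤ _ := h1
        _ ≤ 2 * (x * E) * (3 * C₀ * (2 * x) * (2 * u^2)^k) := by gcongr
        _ = 12 * C₀ * 2^k * x^2 * (E * u^(2*k)) := by rw [mul_pow, ← pow_mul]; ring
        _ ≤ 12 * C₀ * 2^k * x^2 * (E * (K2 * Real.exp (β/2 * u))) := by gcongr; exact hKe u hu0.le
        _ = D * x^2 * (Real.exp (-β * u) * Real.exp (β/2 * u)) := by rw [hD, hE]; ring
        _ = _ := by rw [← Real.exp_add]; ring_nf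
    refine (Real.le_sqrt_of_sq_le h4).trans (le_of_eq ?_)
    have h5 : x^2 * Real.exp (-(β/2) * u) = (x * Real.exp (-(β/4) * u))^2 := by
      rw [mul_pow, ← Real.exp_nat_mul]; congr 2; push_cast; ring
    rw [mul_assoc, Real.sqrt_mul hD0.le, h5, Real.sqrt_sq (by positivity), mul_assoc]
  set A := ∑ n ∈ Finset.Icc 1 ⌊x⌋₊, a n with hA
  have hxE : 0 < x * E := by positivity
  have hmain : x * E * |A| ≤ x * E * (5 * K * x * E + Q) := by
    have : x * E * |A| = |x * E * A| := by rw [abs_mul, abs_of_pos hxE]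
    rw [this, hid]
    refine (abs_sub _ _).trans ?_
    have f1 := abs_sub (z * ∑ n ∈ Finset.Icc 1 ⌊z⌋₊, a n * (1 - n / z)) (x * ∑ n ∈ Finset.Icc 1 ⌊x⌋₊, a n * (1 - n / x))
    rw [abs_mul z, abs_mul x, abs_of_pos hz0, abs_of_pos hx0] at f1
    have g1 : z * |∑ n ∈ Finset.Icc 1 ⌊z⌋₊, a n * (1 - n / z)| ≤ (2 * x) * (K * (2 * x) * (E * E)) := by
      gcongr; refine hSz.trans ?_; gcongr
    have g2 : x * |∑ n ∈ Finset.Icc 1 ⌊x⌋₊, a n * (1 - n / x)| ≤ x * (K * x * (E * E)) := by gcongr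
    calc _ ≤ (2 * x) * (K * (2 * x) * (E * E)) + x * (K * x * (E * E)) + x * E * Q := by linarith
      _ = _ := by ring
  have hfin := le_of_mul_le_mul_left hmain hxE
  have hE4 : E ≤ Real.exp (-(β/4) * u) := by
    apply Real.exp_le_exp.2; nlinarith
  calc |A| ≤ 5 * K * x * E + Q := hfin
    _ ≤ 5 * K * x * Real.exp (-(β/4) * u) + Real.sqrt D * x * Real.exp (-(β/4) * u) := by gcongr
    _ = _ := by ring

theorem final (h : PerronData a F c₀ C₀ k) : ∃ c C : ℝ, 0 < c ∧ 0 < C ∧ ∀ x : ℝ, 3 ≤ x →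
    |∑ n ∈ Finset.Icc 1 ⌊x⌋₊, a n| ≤ 
      C * x * Real.exp (-c * (Real.log x / Real.log (Real.log x)) ^ ((1 : ℝ) / 3)) := by
  obtain ⟨α, K, hα, hK, hA⟩ := h.sum_exp
  refine ⟨α/3, K, by positivity, hK, fun x hx => (hA x hx).trans ?_⟩
  obtain ⟨hu1, hu2⟩ := sqrtlog hx
  have hx0 : 0 < x := by linarith
  have hlx : 12/11 ≤ Real.log x := by
    have h1 : Real.log 3 ≤ Real.log x := Real.log_le_log (by norm_num) hx
    have h2 : Real.log (Real.exp 1 * 1.1) ≤ Real.log 3 := Real.log_le_log (by positivity) (by linarith [Real.exp_one_lt_d9])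
    rw [Real.log_mul (by positivity) (by norm_num), Real.log_exp] at h2
    have h3 := Real.one_sub_inv_le_log_of_pos (show (0:ℝ) < 1.1 by norm_num)
    norm_num at h3 h2 ⊢
    linarith
  have hllx : 1/12 ≤ Real.log (Real.log x) := by
    have h1 : Real.log (12/11) ≤ Real.log (Real.log x) := Real.log_le_log (by norm_num) hlx
    have h3 := Real.one_sub_inv_le_log_of_pos (show (0:ℝ) < 12/11 by norm_num)
    norm_num at h3 h1 ⊢
    linarith
  set u := Real.sqrt (Real.log x) with hu
  have hr : (Real.log x / Real.log (Real.log x)) ^ ((1 : ℝ) / 3) ≤ 3 * u := by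
    have h1 : Real.log x / Real.log (Real.log x) ≤ (3 * u)^3 := by
      rw [div_le_iff₀ (by linarith)]
      have e1 : u^2 ≤ u^3 := by nlinarith
      have e2 : (3*u)^3 * (1/12) ≤ (3*u)^3 * Real.log (Real.log x) := by gcongr
      rw [← hu2] at e2 ⊢
      nlinarith [pow_pos (by linarith : 0 < u) 3]
    calc _ ≤ ((3 * u)^3) ^ ((1 : ℝ) / 3) := by
          apply Real.rpow_le_rpow _ h1 (by norm_num)
          exact div_nonneg (by linarith) (by linarith)
      _ = 3 * u := by
          rw [← Real.rpow_natCast, ← Real.rpow_mul (by linarith)]; norm_num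
  gcongr K * x * Real.exp ?_
  nlinarith
end PerronData
end

section
namespace MFP
open MeasureTheory Set Filter Topology

noncomputable def vv (t : ℝ) : ℂ :=
  (Set.Ioc 0 1).indicator (fun t : ℝ => (t:ℂ) ^ (2:ℂ)) t - (Set.Ioc 0 1).indicator (fun t : ℝ => (t:ℂ) ^ (3:ℂ)) t

theorem vv_mellin {s : ℂ} (hs : 0 < s.re) : HasMellin vv s (1 / ((s+2) * (s+3))) := by
  have h2 := hasMellin_cpow_Ioc 2 (s := s) (by norm_num; linarith)
  have h3 := hasMellin_cpow_Ioc 3 (s := s) (by norm_num; linarith)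
  have := hasMellin_sub h2.1 h3.1
  rw [h2.2, h3.2] at this
  have e2 : s + 2 ≠ 0 := fun h => by have := congrArg Complex.re h; norm_num at this; linarith
  have e3 : s + 3 ≠ 0 := fun h => by have := congrArg Complex.re h; norm_num at this; linarith
  rw [show 1 / ((s+2) * (s+3)) = 1/(s+2) - 1/(s+3) by field_simp; ring]
  exact this

theorem vv_of_mem {t : ℝ} (h : t ∈ Set.Ioc (0:ℝ) 1) : vv t = ((t^2 * (1-t) : ℝ) : ℂ) := by
  simp only [vv, indicator_of_mem h]
  rw [show (2:ℂ) = ((2:ℕ):ℂ) by norm_num, show (3:ℂ) = ((3:ℕ):ℂ) by norm_num, Complex.cpow_natCast, Complex.cpow_natCast]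
  push_cast; ring

theorem vv_of_not_mem {t : ℝ} (h : t ∉ Set.Ioc (0:ℝ) 1) : vv t = 0 := by
  simp [vv, indicator_of_notMem h]

theorem vv_eq_norm (t : ℝ) : vv t = (‖vv t‖ : ℂ) := by
  by_cases h : t ∈ Set.Ioc (0:ℝ) 1
  · rw [vv_of_mem h, Complex.norm_real, Real.norm_of_nonneg]
    have := h.2; have : 0 ≤ 1 - t := by linarith
    positivity
  · simp [vv_of_not_mem h]

theorem vv_meas : Measurable vv := by
  apply Measurable.sub <;> refine Measurable.indicator ?_ measurableSet_Ioc <;>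
    exact (Complex.measurable_ofReal).pow_const _

noncomputable def VV (r : ℕ → ℝ) (t : ℝ) : ℂ := ∑' n : ℕ, (r n : ℂ) * vv (n * t)

theorem VV_supp {t : ℝ} (ht : 0 < t) {n : ℕ} (hn : n ∉ Finset.Icc 1 ⌊1/t⌋₊) : vv (n * t) = 0 := by
  apply vv_of_not_mem
  rintro ⟨h1, h2⟩
  apply hn
  rw [Finset.mem_Icc]
  refine ⟨?_, Nat.le_floor (by rw [le_div_iff₀ ht]; exact h2)⟩
  rcases Nat.eq_zero_or_pos n with rfl | h
  · simp at h1
  · exact h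

theorem VV_summable (r : ℕ → ℝ) (t : ℝ) : Summable fun n : ℕ => (r n : ℂ) * vv (n * t) := by
  by_cases ht : 0 < t
  · exact summable_of_ne_finset_zero (s := Finset.Icc 1 ⌊1/t⌋₊) fun n hn => by rw [VV_supp ht hn, mul_zero]
  · convert summable_zero with n
    rw [vv_of_not_mem, mul_zero]
    rintro ⟨h1, -⟩
    have : (n:ℝ) * t ≤ 0 := mul_nonpos_of_nonneg_of_nonpos (by positivity) (not_lt.1 ht)
    linarith

theorem VV_eq (r : ℕ → ℝ) {t : ℝ} (ht : 0 < t) :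
    VV r t = ((∑ n ∈ Finset.Icc 1 ⌊1/t⌋₊, r n * ((n * t)^2 * (1 - n * t)) : ℝ) : ℂ) := by
  rw [VV, tsum_eq_sum (s := Finset.Icc 1 ⌊1/t⌋₊) fun n hn => by rw [VV_supp ht hn, mul_zero], Complex.ofReal_sum]
  refine Finset.sum_congr rfl fun n hn => ?_
  rw [Finset.mem_Icc] at hn
  have h2 : (n:ℝ) ≤ 1/t := (Nat.le_floor_iff (by positivity)).1 hn.2
  have : (0:ℝ) < n := by exact_mod_cast hn.1
  rw [vv_of_mem ⟨by positivity, by rwa [le_div_iff₀ ht] at h2⟩]; push_cast; ring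

theorem VV_meas (r : ℕ → ℝ) : Measurable (VV r) := by
  refine measurable_of_tendsto_metrizable (f := fun N t => ∑ n ∈ Finset.range N, (r n : ℂ) * vv (n * t)) (fun N => ?_) ?_
  · exact Finset.measurable_sum _ fun n _ => (vv_meas.comp (measurable_id.const_mul _)).const_mul _
  · exact tendsto_pi_nhds.2 fun t => (VV_summable r t).hasSum.tendsto_sum_nat

theorem VV_term {n : ℕ} {s : ℂ} (hs : 1 < s.re) (r : ℕ → ℝ) :
    HasMellin (fun t => (r n : ℂ) * vv (n * t)) s (LSeries.term (fun n => (r n : ℂ)) s n * (1 / ((s+2) * (s+3)))) := by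
  rcases Nat.eq_zero_or_pos n with rfl | h
  · have : vv 0 = 0 := vv_of_not_mem (by simp)
    simp [HasMellin, MellinConvergent, mellin, this]
  · have hn : (0:ℝ) < n := by exact_mod_cast h
    have h1 := vv_mellin (s := s) (by linarith)
    have h2 := (MellinConvergent.comp_mul_left (f := vv) (s := s) hn).2 h1.1
    have h3 := mellin_comp_mul_left vv s hn
    refine ⟨by simpa using h2.const_smul (r n : ℂ), ?_⟩
    have := mellin_const_smul (fun t => vv (n * t)) s (r n : ℂ)
    simp only [smul_eq_mul] at this
    rw [this, h3, h1.2, LSeries.term_of_ne_zero h.ne', smul_eq_mul, Complex.cpow_neg]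
    push_cast
    ring

theorem VV_mellin {r : ℕ → ℝ} (hr : ∀ n, 0 ≤ r n)
    (hs : ∀ s : ℂ, 1 < s.re → LSeriesSummable (fun n => (r n : ℂ)) s) {s : ℂ} (h1 : 1 < s.re) :
    mellin (VV r) s = LSeries (fun n => (r n : ℂ)) s * (1 / ((s+2) * (s+3))) := by
  have key := hasSum_integral_of_summable_integral_norm (μ := volume.restrict (Set.Ioi (0:ℝ)))
    (F := fun (n:ℕ) (t:ℝ) => (t:ℂ)^(s-1) • ((r n : ℂ) * vv (n * t))) (fun n => (VV_term h1 r).1) ?_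
  · rw [LSeries, ← tsum_mul_right]
    have e : ∀ n, ∫ t in Set.Ioi (0:ℝ), (t:ℂ)^(s-1) • ((r n : ℂ) * vv (n * t)) =
      LSeries.term (fun n => (r n : ℂ)) s n * (1 / ((s+2) * (s+3))) := fun n => (VV_term h1 r).2
    simp_rw [e] at key
    rw [key.tsum_eq, mellin]
    congr 1
    ext t
    rw [VV, smul_eq_mul, ← tsum_mul_left]; rfl
  · have hσ : 1 < ((s.re:ℝ):ℂ).re := by simpa using h1
    have e : ∀ n:ℕ, (((∫ t in Set.Ioi (0:ℝ), ‖(t:ℂ)^(s-1) • ((r n : ℂ) * vv (n * t))‖ : ℝ)) : ℂ) =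
      LSeries.term (fun n => (r n : ℂ)) s.re n * (1 / (((s.re:ℂ)+2) * ((s.re:ℂ)+3))) := by
      intro n
      rw [← (VV_term hσ r).2, mellin, ← integral_complex_ofReal]
      refine setIntegral_congr_fun measurableSet_Ioi fun t ht => ?_
      have ht : 0 < t := ht
      simp only [smul_eq_mul, norm_mul, Complex.norm_cpow_eq_rpow_re_of_pos ht]
      rw [vv_eq_norm, Complex.norm_of_nonneg (hr n)]
      simp only [Complex.ofReal_mul, Complex.norm_real, norm_norm, Complex.ofReal_cpow ht.le]
      simp
    have h3 := (hs _ hσ).mul_right (1 / (((s.re:ℂ)+2) * ((s.re:ℂ)+3)))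
    rw [← Complex.summable_ofReal]
    exact h3.congr fun n => (e n).symm

theorem continuation {r : ℕ → ℝ} (hr : ∀ n, 0 ≤ r n)
    (hs : ∀ s : ℂ, 1 < s.re → LSeriesSummable (fun n => (r n : ℂ)) s) {κ δ C : ℝ} (hδ : 0 < δ)
    (h : ∀ X : ℝ, 1 ≤ X → |∑ n ∈ Finset.Icc 1 ⌊X⌋₊, r n * ((n / X)^2 * (1 - n / X)) - κ * X| ≤ C * X^(1-δ)) :
    ∃ H : ℂ → ℂ, DifferentiableOn ℂ H {s | 1 - δ/2 < s.re} ∧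
      (∃ (C : ℝ) (A : ℕ), 0 < C ∧ ∀ s : ℂ, 1 - δ/2 < s.re → ‖H s‖ ≤ C * (1 + ‖s‖)^A) ∧
      ∀ s : ℂ, 1 < s.re → H s = (s - 1) * LSeries (fun n => (r n : ℂ)) s := by
  have hC : 0 ≤ C := by
    have := (abs_nonneg _).trans (h 1 le_rfl); simpa using this
  set f : ℝ → ℂ := fun t => VV r t - (κ:ℂ) * (Set.Ioc 0 1).indicator (fun t : ℝ => (t:ℂ) ^ (-1:ℂ)) t with hf
  have hfm : Measurable f := (VV_meas r).sub
    ((Measurable.indicator (Complex.measurable_ofReal.pow_const _) measurableSet_Ioc).const_mul _)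
  have hf1 : ∀ t, 1 < t → f t = 0 := by
    intro t ht
    have h1 : ⌊1/t⌋₊ = 0 := Nat.floor_eq_zero.2 (by rw [div_lt_one (by linarith)]; exact ht)
    have h2 : t ∉ Set.Ioc (0:ℝ) 1 := fun h => by linarith [h.2]
    simp only [hf, VV_eq r (show 0 < t by linarith), h1, indicator_of_notMem h2]
    simp
  have hf0 : ∀ t, 0 < t → t ≤ 1 → ‖f t‖ ≤ C * t^(-(1-δ)) := by
    intro t ht ht1
    have := h (1/t) (by rw [le_div_iff₀ ht]; linarith)
    have e : f t = ((∑ n ∈ Finset.Icc 1 ⌊1/t⌋₊, r n * ((n / (1/t))^2 * (1 - n / (1/t))) - κ * (1/t) : ℝ) : ℂ) := by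
      simp only [hf, VV_eq r ht, indicator_of_mem (show t ∈ Set.Ioc (0:ℝ) 1 from ⟨ht, ht1⟩), Complex.cpow_neg_one]
      simp
    rw [e, Complex.norm_real, Real.norm_eq_abs]
    refine this.trans_eq ?_
    rw [one_div, Real.inv_rpow ht.le, Real.rpow_neg ht.le]
  have hfb : ∀ t, 0 < t → ‖f t‖ ≤ C * t^(-(1-δ)) := by
    intro t ht
    rcases le_or_gt t 1 with h | h
    · exact hf0 t ht h
    · rw [hf1 t h, norm_zero]; positivity
  have hloc : LocallyIntegrableOn f (Set.Ioi 0) volume := by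
    have hc : LocallyIntegrableOn (fun t : ℝ => C * t^(-(1-δ))) (Set.Ioi 0) volume := by
      refine ContinuousOn.locallyIntegrableOn ?_ measurableSet_Ioi
      exact continuousOn_const.mul (continuousOn_id.rpow_const fun t ht => Or.inl (ne_of_gt ht))
    intro t ht
    obtain ⟨U, hU, hi⟩ := hc t ht
    obtain ⟨U', hU', hi'⟩ : ∃ U ∈ 𝓝[Ioi 0] t, IntegrableOn (fun t : ℝ => C * t^(-(1-δ))) U volume ∧ U ⊆ Set.Ioi 0 :=
      ⟨U ∩ Set.Ioi 0, inter_mem hU self_mem_nhdsWithin, hi.mono_set inter_subset_left, inter_subset_right⟩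
    refine ⟨U', hU', ?_⟩
    refine Integrable.mono' hi'.1 hfm.aestronglyMeasurable ?_
    have := ae_restrict_mem (μ := volume) (s := Set.Ioi (0:ℝ)) measurableSet_Ioi
    have := ae_mono (Measure.restrict_mono hi'.2 le_rfl) this
    filter_upwards [this] with t ht using hfb t ht
  have hO1 : ∀ a : ℝ, f =O[atTop] fun x => x ^ (-a) := fun a => by
    refine Asymptotics.IsBigO.of_bound 0 ?_
    filter_upwards [eventually_gt_atTop 1] with t ht
    rw [hf1 t ht]; simp
  have hO0 : f =O[𝓝[>] 0] fun x => x ^ (-(1-δ)) := by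
    refine Asymptotics.IsBigO.of_bound C ?_
    filter_upwards [self_mem_nhdsWithin] with t ht
    have ht : 0 < t := ht
    rw [Real.norm_of_nonneg (by positivity)]
    exact hfb t ht
  refine ⟨fun s => (s+2) * (s+3) * ((s-1) * mellin f s + κ), fun s hs' => ?_, ?_, fun s hs1 => ?_⟩
  · have hs' : 1 - δ/2 < s.re := hs'
    have := mellin_differentiableAt_of_isBigO_rpow hloc (hO1 (s.re+1)) (by linarith) hO0 (by linarith)
    exact DifferentiableAt.differentiableWithinAt (by fun_prop)
  · refine ⟨9 * (C * (2/δ) + |κ| + 1), 3, by positivity, fun s hs' => ?_⟩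
    have hm : ‖mellin f s‖ ≤ C * (2/δ) := by
      have hi : IntervalIntegrable (fun t : ℝ => t^(s.re - 1 + -(1-δ))) volume 0 1 :=
        intervalIntegral.intervalIntegrable_rpow' (by linarith)
      have hii : Integrable ((Set.Ioc (0:ℝ) 1).indicator fun t : ℝ => C * t^(s.re - 1 + -(1-δ))) (volume.restrict (Set.Ioi 0)) := by
        refine Integrable.restrict ?_
        rw [integrable_indicator_iff measurableSet_Ioc]
        exact ((intervalIntegrable_iff_integrableOn_Ioc_of_le zero_le_one).1 hi).const_mul C
      rw [mellin]
      refine (norm_integral_le_of_norm_le hii ?_).trans ?_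
      · filter_upwards [ae_restrict_mem measurableSet_Ioi] with t ht
        have ht : 0 < t := ht
        rcases le_or_gt t 1 with h | h
        · rw [indicator_of_mem (show t ∈ Set.Ioc (0:ℝ) 1 from ⟨ht, h⟩), norm_smul, Complex.norm_cpow_eq_rpow_re_of_pos ht,
            Real.rpow_add ht, mul_left_comm]
          simp only [Complex.sub_re, Complex.one_re]
          gcongr
          exact hf0 t ht h
        · rw [hf1 t h, smul_zero, norm_zero]
          exact indicator_nonneg (fun t ht => by have := ht.1; positivity) _
      · rw [setIntegral_indicator measurableSet_Ioc, inter_eq_right.2 (fun t ht => ht.1),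
          ← intervalIntegral.integral_of_le zero_le_one, intervalIntegral.integral_const_mul,
          integral_rpow (Or.inl (by linarith))]
        rw [Real.one_rpow, Real.zero_rpow (by linarith), sub_zero]
        refine mul_le_mul_of_nonneg_left ?_ hC
        rw [div_le_div_iff₀ (by linarith) hδ]; linarith
    have hn := norm_nonneg s
    have e2 : ‖s + 2‖ ≤ 3 * (1 + ‖s‖) := (norm_add_le _ _).trans (by norm_num; linarith)
    have e3 : ‖s + 3‖ ≤ 3 * (1 + ‖s‖) := (norm_add_le _ _).trans (by norm_num; linarith)
    have e1 : ‖s - 1‖ ≤ (1 + ‖s‖) := (norm_sub_le _ _).trans (by norm_num; linarith)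
    have e4 : ‖(s-1) * mellin f s + κ‖ ≤ (1 + ‖s‖) * (C * (2/δ) + |κ| + 1) := by
      refine (norm_add_le _ _).trans ?_
      rw [norm_mul, Complex.norm_real, Real.norm_eq_abs]
      have : ‖s-1‖ * ‖mellin f s‖ ≤ (1 + ‖s‖) * (C * (2/δ)) := by gcongr
      nlinarith [abs_nonneg κ]
    simp only [norm_mul]
    calc _ ≤ (3 * (1 + ‖s‖)) * (3 * (1 + ‖s‖)) * ((1 + ‖s‖) * (C * (2/δ) + |κ| + 1)) := by gcongr
      _ = _ := by ring
  · have hI := hasMellin_cpow_Ioc (-1) (s := s) (by norm_num; linarith)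
    have hf' := mellinConvergent_of_isBigO_rpow hloc (hO1 (s.re+1)) (by linarith) hO0 (by linarith)
    have e : mellin (VV r) s = mellin f s + κ * (1 / (s + -1)) := by
      rw [← hI.2]
      have := mellin_const_smul ((Set.Ioc 0 1).indicator fun t : ℝ => (t:ℂ)^(-1:ℂ)) s (κ : ℂ)
      simp only [smul_eq_mul] at this
      rw [← this]
      have h2 := (hasMellin_add hf' (by simpa using hI.1.const_smul (κ : ℂ))).2
      rw [← h2]
      congr 1; ext t; simp [hf]
    rw [VV_mellin hr hs hs1] at e
    have e2 : s + 2 ≠ 0 := fun h => by have := congrArg Complex.re h; norm_num at this; linarith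
    have e3 : s + 3 ≠ 0 := fun h => by have := congrArg Complex.re h; norm_num at this; linarith
    have e1 : s - 1 ≠ 0 := fun h => by have := congrArg Complex.re h; norm_num at this; linarith
    rw [← sub_eq_add_neg] at e
    field_simp at e
    linear_combination (-1:ℂ) * e
end MFP
end

section
namespace MFP
open MeasureTheory

theorem lattice_sum {ι : Type*} [Fintype ι] (Θ : (ι → ℝ) → ℝ) (ρ C : ℝ) (hρ : 0 ≤ ρ) (hC : 0 ≤ C)
    (hsupp : ∀ y, ρ < ‖y‖ → Θ y = 0) (hlip : ∀ y y', ‖y - y'‖ ≤ 1 → |Θ y - Θ y'| ≤ C * ‖y - y'‖) :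
    ∃ κ C' : ℝ, 0 ≤ C' ∧ ∀ R : ℝ, 1 ≤ R →
      (Function.support fun z : ι → ℤ => Θ (fun i => (z i : ℝ) / R)).Finite ∧
      |∑' z : ι → ℤ, Θ (fun i => (z i : ℝ) / R) - κ * R^(Fintype.card ι)| ≤ C' * (R^(Fintype.card ι) / R) := by
  classical
  set n := Fintype.card ι with hn
  have hcont : Continuous Θ := by
    rw [continuous_iff_continuousAt]
    intro y
    rw [Metric.continuousAt_iff]
    intro ε hε
    refine ⟨min 1 (ε / (C+1)), by positivity, fun {y'} hy => ?_⟩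
    rw [dist_eq_norm] at hy ⊢
    have h1 := hlip y' y (hy.le.trans (min_le_left _ _))
    have h2 := hy.trans_le (min_le_right _ _)
    rw [lt_div_iff₀ (by linarith)] at h2
    rw [Real.norm_eq_abs]
    nlinarith [norm_nonneg (y' - y)]
  have hint : Integrable Θ := by
    refine hcont.integrable_of_hasCompactSupport ?_
    refine HasCompactSupport.intro (isCompact_closedBall (0 : ι → ℝ) ρ) fun y hy => hsupp y ?_
    simpa using hy
  refine ⟨∫ y, Θ y, C * (2 * (ρ+1))^n, by positivity, fun R hR => ?_⟩
  have hR0 : 0 < R := by linarith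
  set K : ℤ := ⌈ρ * R⌉ with hK
  set F : Finset (ι → ℤ) := Fintype.piFinset fun _ => Finset.Icc (-K) K with hF
  have hzF : ∀ z : ι → ℤ, z ∉ F → Θ (fun i => (z i : ℝ) / R) = 0 := by
    intro z hz
    apply hsupp
    by_contra! hle
    apply hz
    rw [hF, Fintype.mem_piFinset]
    intro i
    have := (norm_le_pi_norm (fun i => (z i : ℝ) / R) i).trans hle
    rw [Real.norm_eq_abs, abs_div, abs_of_pos hR0, div_le_iff₀ hR0] at this
    have := this.trans (Int.le_ceil _)
    rw [abs_le] at this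
    rw [Finset.mem_Icc]
    constructor
    · exact_mod_cast this.1
    · exact_mod_cast this.2
  refine ⟨F.finite_toSet.subset fun z hz => ?_, ?_⟩
  · by_contra h; exact hz (hzF z h)
  set Q : (ι → ℤ) → Set (ι → ℝ) := fun z => Set.pi Set.univ fun i => Set.Ico (z i : ℝ) (z i + 1) with hQ
  have hQm : ∀ z, MeasurableSet (Q z) := fun z => MeasurableSet.univ_pi fun i => measurableSet_Ico
  have hQv : ∀ z, volume (Q z) = 1 := fun z => by simp [hQ, Real.volume_pi_Ico]
  have hmem : ∀ z y, y ∈ Q z ↔ (fun i => ⌊y i⌋) = z := by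
    intro z y
    simp only [hQ, Set.mem_univ_pi, Set.mem_Ico, funext_iff, Int.floor_eq_iff]
  set g : (ι → ℝ) → ℝ := fun y => ∑ z ∈ F, (Q z).indicator (fun _ => Θ (fun i => (z i : ℝ) / R)) y with hg
  have hgi : ∀ z ∈ F, Integrable ((Q z).indicator fun _ => Θ (fun i => (z i : ℝ) / R)) := fun z _ => by
    rw [integrable_indicator_iff (hQm z)]
    exact integrableOn_const (by simp [hQv])
  have hgint : ∫ y, g y = ∑ z ∈ F, Θ (fun i => (z i : ℝ) / R) := by
    rw [integral_finsetSum _ hgi]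
    refine Finset.sum_congr rfl fun z _ => ?_
    rw [integral_indicator_const _ (hQm z), Measure.real, hQv]; simp
  have hgy : ∀ y, g y = Θ (fun i => (⌊y i⌋ : ℝ) / R) := by
    intro y
    by_cases h : (fun i => ⌊y i⌋) ∈ F
    · rw [hg]; dsimp only
      rw [Finset.sum_eq_single_of_mem _ h, Set.indicator_of_mem ((hmem _ _).2 rfl)]
      intro z _ hz
      exact Set.indicator_of_notMem (fun h => hz ((hmem _ _).1 h).symm) _
    · rw [hzF _ h, hg]
      refine Finset.sum_eq_zero fun z hz => Set.indicator_of_notMem (fun h' => h ?_) _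
      rw [(hmem _ _).1 h']; exact hz
  have hsc : ∫ y : ι → ℝ, Θ (R⁻¹ • y) = (∫ y, Θ y) * R^n := by
    rw [Measure.integral_comp_inv_smul, Module.finrank_fintype_fun_eq_card, abs_of_pos (by positivity), smul_eq_mul, mul_comm]
  have hI1 : Integrable fun y : ι → ℝ => Θ (R⁻¹ • y) := hint.comp_smul (by positivity)
  rw [tsum_eq_sum fun z hz => hzF z hz, ← hgint, ← hsc, ← integral_sub (integrable_finsetSum _ hgi) hI1]
  have hb : ∀ y, |g y - Θ (R⁻¹ • y)| ≤ C / R := by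
    intro y
    rw [hgy]
    have : ‖(fun i => (⌊y i⌋ : ℝ) / R) - R⁻¹ • y‖ ≤ 1 / R := by
      rw [pi_norm_le_iff_of_nonneg (by positivity)]
      intro i
      simp only [Pi.sub_apply, Pi.smul_apply, smul_eq_mul]
      rw [show (⌊y i⌋ : ℝ) / R - R⁻¹ * y i = (⌊y i⌋ - y i) / R by field_simp, Real.norm_eq_abs, abs_div, abs_of_pos hR0]
      gcongr
      rw [abs_le]; constructor <;> linarith [Int.floor_le (y i), Int.lt_floor_add_one (y i)]
    have h1 : 1 / R ≤ 1 := by rw [div_le_one hR0]; exact hR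
    refine (hlip _ _ (this.trans h1)).trans ?_
    calc _ ≤ C * (1/R) := by gcongr
      _ = _ := by ring
  have hb0 : ∀ y, y ∉ Metric.closedBall (0 : ι → ℝ) ((ρ+1) * R) → g y - Θ (R⁻¹ • y) = 0 := by
    intro y hy
    have hy : (ρ+1) * R < ‖y‖ := by simpa using hy
    have h1 : ρ * R + 1 < ‖y‖ := by nlinarith
    obtain ⟨i, hi⟩ : ∃ i, ρ * R + 1 < ‖y i‖ := by
      by_contra! h
      exact absurd ((pi_norm_le_iff_of_nonneg (by positivity)).2 h) (not_le.2 h1)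
    rw [hgy, hsupp, hsupp, sub_zero]
    · rw [norm_smul, norm_inv, Real.norm_of_nonneg hR0.le, inv_mul_eq_div, lt_div_iff₀ hR0]; linarith
    · refine lt_of_lt_of_le ?_ (norm_le_pi_norm _ i)
      rw [norm_div, Real.norm_of_nonneg hR0.le, lt_div_iff₀ hR0]
      have : ‖y i‖ ≤ ‖(⌊y i⌋:ℝ)‖ + ‖y i - ⌊y i⌋‖ := by
        simpa using norm_add_le (⌊y i⌋:ℝ) (y i - ⌊y i⌋)
      have h3 : ‖y i - ⌊y i⌋‖ ≤ 1 := by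
        rw [Real.norm_eq_abs, abs_le]; constructor <;> linarith [Int.floor_le (y i), Int.lt_floor_add_one (y i)]
      linarith
  rw [← setIntegral_eq_integral_of_forall_compl_eq_zero hb0, ← Real.norm_eq_abs]
  refine (norm_setIntegral_le_of_norm_le_const (C := C / R) (measure_closedBall_lt_top) fun y _ => hb y).trans (le_of_eq ?_)
  rw [Measure.real, Real.volume_pi_closedBall _ (by positivity), ENNReal.toReal_ofReal (by positivity), ← hn,
    ← mul_assoc 2, mul_pow]
  ring
end MFP
end

section
namespace MFP
open Finset

theorem ratio_lip_aux {a a' N N' E E' C : ℝ} (hN' : 0 ≤ N') (hNN : N' ≤ N) (hE : N ≤ E) (hE' : N' ≤ E')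
    (ha : |a'| ≤ C) : |a * N^2 / E - a' * N'^2 / E'| ≤ |a - a'| * N + 2 * C * |N - N'| + C * |E - E'| := by
  have hN : 0 ≤ N := hN'.trans hNN
  have hC : 0 ≤ C := (abs_nonneg _).trans ha
  have hR : 0 ≤ |a - a'| * N + 2 * C * |N - N'| + C * |E - E'| := by positivity
  rcases hN.eq_or_lt with h0 | h0
  · have : N' = 0 := le_antisymm (by linarith) hN'
    rw [← h0, this]; rw [← h0, this] at hR; simpa using hR
  have hE0 : 0 < E := by linarith
  have t1 : |(a - a') * N^2 / E| ≤ |a - a'| * N := by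
    rw [abs_div, abs_mul, abs_of_pos hE0, abs_of_nonneg (sq_nonneg N), div_le_iff₀ hE0, mul_assoc]
    gcongr; nlinarith
  have t2 : |a' * (N^2 - N'^2) / E| ≤ 2 * C * |N - N'| := by
    rw [abs_div, abs_mul, abs_of_pos hE0, div_le_iff₀ hE0, sq_sub_sq, abs_mul, abs_of_nonneg (by linarith : 0 ≤ N + N')]
    calc |a'| * ((N + N') * |N - N'|) ≤ C * ((2 * E) * |N - N'|) := by gcongr; linarith
      _ = _ := by ring
  rcases hN'.eq_or_lt with h1 | h1
  · have e : a * N^2 / E - a' * N'^2 / E' = (a - a') * N^2 / E + a' * (N^2 - N'^2) / E := by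
      rw [← h1]; field_simp; ring
    rw [e]
    have := abs_add_le ((a - a') * N^2 / E) (a' * (N^2 - N'^2) / E)
    have : 0 ≤ C * |E - E'| := by positivity
    linarith
  · have hE0' : 0 < E' := by linarith
    have e : a * N^2 / E - a' * N'^2 / E' = (a - a') * N^2 / E + a' * (N^2 - N'^2) / E + a' * N'^2 * (E' - E) / (E * E') := by
      field_simp; ring
    have t3 : |a' * N'^2 * (E' - E) / (E * E')| ≤ C * |E - E'| := by
      rw [abs_div, abs_mul, abs_mul, abs_of_pos (mul_pos hE0 hE0'), abs_of_nonneg (sq_nonneg N'),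
        div_le_iff₀ (mul_pos hE0 hE0'), abs_sub_comm E' E]
      calc |a'| * N'^2 * |E - E'| ≤ C * (E * E') * |E - E'| := by
            gcongr; nlinarith
        _ = _ := by ring
    rw [e]
    have := abs_add_three ((a - a') * N^2 / E) (a' * (N^2 - N'^2) / E) (a' * N'^2 * (E' - E) / (E * E'))
    linarith

theorem ratio_lip {a a' N N' E E' C M L d : ℝ} (hN' : 0 ≤ N') (hN : 0 ≤ N) (hNM : N ≤ M) (hNM' : N' ≤ M)
    (hE : N ≤ E) (hE' : N' ≤ E') (ha : |a| ≤ C) (ha' : |a'| ≤ C)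
    (h1 : |a - a'| ≤ L * d) (h2 : |N - N'| ≤ L * d) (h3 : |E - E'| ≤ L * d) :
    |a * N^2 / E - a' * N'^2 / E'| ≤ (M + 3 * C) * L * d := by
  have hC : 0 ≤ C := (abs_nonneg _).trans ha
  have hLd : 0 ≤ L * d := (abs_nonneg _).trans h1
  rcases le_total N' N with h | h
  · have := ratio_lip_aux hN' h hE hE' ha' (a := a)
    have : |a - a'| * N ≤ (L * d) * M := by gcongr
    have : 2 * C * |N - N'| ≤ 2 * C * (L * d) := by gcongr
    have : C * |E - E'| ≤ C * (L * d) := by gcongr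
    linarith
  · have := ratio_lip_aux hN h hE' hE ha (a := a')
    rw [abs_sub_comm, abs_sub_comm a', abs_sub_comm N', abs_sub_comm E'] at this
    have : |a - a'| * N' ≤ (L * d) * M := by gcongr
    have : 2 * C * |N - N'| ≤ 2 * C * (L * d) := by gcongr
    have : C * |E - E'| ≤ C * (L * d) := by gcongr
    linarith

variable {S : Type*} [Fintype S] {α : Type*}
noncomputable def nn (r : S → ℝ) : ℝ := ∏ σ, r σ
noncomputable def psi (B : ℝ) (r : S → ℝ) : ℝ := max 0 (B * nn r - ∑ σ, r σ ^ (Fintype.card S))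
noncomputable def ee (B : ℝ) (U : Finset α) (v : α → S → ℝ) (r : S → ℝ) : ℝ := max (∑ u ∈ U, psi B (v u * r)) (nn r)
noncomputable def theta (B : ℝ) (U : Finset α) (v : α → S → ℝ) (r : S → ℝ) : ℝ :=
  psi B r * max 0 (1 - nn r) * nn r^2 / ee B U v r

theorem nn_loclip : LocallyLipschitz (nn (S := S)) := by
  apply ContDiff.locallyLipschitz (𝕂 := ℝ); unfold nn; fun_prop

theorem psi_loclip (B : ℝ) : LocallyLipschitz (psi (S := S) B) := by
  have : LocallyLipschitz fun r : S → ℝ => B * nn r - ∑ σ, r σ ^ (Fintype.card S) := by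
    apply ContDiff.locallyLipschitz (𝕂 := ℝ); unfold nn; fun_prop
  exact this.const_max 0

theorem loclip_mul {f g : (S → ℝ) → ℝ} (hf : LocallyLipschitz f) (hg : LocallyLipschitz g) :
    LocallyLipschitz fun r => f r * g r := by
  have : LocallyLipschitz fun p : ℝ × ℝ => p.1 * p.2 := by
    apply ContDiff.locallyLipschitz (𝕂 := ℝ); fun_prop
  exact this.comp (hf.prodMk hg)

theorem ee_loclip (B : ℝ) (U : Finset α) (v : α → S → ℝ) : LocallyLipschitz (ee B U v) := by
  classical
  refine LocallyLipschitz.max ?_ nn_loclip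
  induction U using Finset.induction_on with
  | empty => simpa using LocallyLipschitz.const (0:ℝ)
  | insert u U hu ih =>
    simp_rw [Finset.sum_insert hu]
    refine LocallyLipschitz.add ?_ ih
    refine (psi_loclip B).comp ?_
    apply ContDiff.locallyLipschitz (𝕂 := ℝ); fun_prop

theorem theta_lip (B : ℝ) (U : Finset α) (v : α → S → ℝ) (M : ℝ) :
    ∃ C : ℝ, 0 ≤ C ∧ ∀ r r' : S → ℝ, r ∈ Set.Icc 0 (fun _ => M) → r' ∈ Set.Icc 0 (fun _ => M) →
      |theta B U v r - theta B U v r'| ≤ C * ‖r - r'‖ := by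
  set Q : Set (S → ℝ) := Set.Icc 0 (fun _ => M)
  have hQ : IsCompact Q := isCompact_Icc
  have key : ∀ f : (S → ℝ) → ℝ, LocallyLipschitz f → ∃ L : ℝ, 0 ≤ L ∧ 
      (∀ r ∈ Q, ∀ r' ∈ Q, |f r - f r'| ≤ L * ‖r - r'‖) ∧ ∀ r ∈ Q, |f r| ≤ L := by
    intro f hf
    obtain ⟨L, hL⟩ := hf.locallyLipschitzOn.exists_lipschitzOnWith_of_compact hQ
    obtain ⟨A, hA⟩ := hQ.exists_bound_of_continuousOn hf.continuous.continuousOn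
    refine ⟨max L A, by positivity, fun r hr r' hr' => ?_, fun r hr => (hA r hr).trans (le_max_right _ _)⟩
    have := hL.dist_le_mul r hr r' hr'
    rw [Real.dist_eq, dist_eq_norm] at this
    exact this.trans (by gcongr; exact le_max_left _ _)
  have hm : LocallyLipschitz fun r : S → ℝ => max 0 (1 - nn r) := by
    refine LocallyLipschitz.const_max ?_ 0
    apply ContDiff.locallyLipschitz (𝕂 := ℝ); unfold nn; fun_prop
  obtain ⟨L1, h1, h1l, h1b⟩ := key _ (loclip_mul (psi_loclip B) hm)
  obtain ⟨L2, h2, h2l, h2b⟩ := key _ nn_loclip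
  obtain ⟨L3, h3, h3l, h3b⟩ := key _ (ee_loclip B U v)
  refine ⟨(L2 + 3 * L1) * (L1 + L2 + L3), by positivity, fun r r' hr hr' => ?_⟩
  have hd := norm_nonneg (r - r')
  refine ratio_lip (prod_nonneg fun i _ => hr'.1 i) (prod_nonneg fun i _ => hr.1 i) ((le_abs_self _).trans (h2b r hr))
    ((le_abs_self _).trans (h2b r' hr')) (le_max_right _ _) (le_max_right _ _) (h1b r hr) (h1b r' hr')
    ((h1l r hr r' hr').trans ?_) ((h2l r hr r' hr').trans ?_) ((h3l r hr r' hr').trans ?_) <;> gcongr <;> linarith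

theorem psi_nonneg (B : ℝ) (r : S → ℝ) : 0 ≤ psi B r := le_max_left _ _

theorem psi_pos {B : ℝ} {r : S → ℝ} (h : psi B r ≠ 0) : ∑ σ, r σ ^ (Fintype.card S) < B * nn r := by
  by_contra! hc
  exact h (max_eq_left (by linarith))

theorem theta_supp {B : ℝ} (hB : 1 ≤ B) (U : Finset α) (v : α → S → ℝ) {r : S → ℝ} (hr : ∀ σ, 0 ≤ r σ)
    (h : theta B U v r ≠ 0) (σ : S) : r σ ≤ B := by
  have h1 : psi B r ≠ 0 := fun h0 => h (by simp [theta, h0])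
  have h2 : nn r < 1 := by
    by_contra! hc
    exact h (by rw [theta, max_eq_left (by linarith)]; simp)
  have h3 := psi_pos h1
  have h4 : r σ ^ (Fintype.card S) ≤ ∑ σ, r σ ^ (Fintype.card S) :=
    single_le_sum (f := fun σ => r σ ^ (Fintype.card S)) (fun i _ => pow_nonneg (hr i) _) (mem_univ σ)
  by_contra! hc
  have : r σ ^ 1 ≤ r σ ^ (Fintype.card S) := pow_le_pow_right₀ (by linarith) (Fintype.card_pos_iff.2 ⟨σ⟩)
  nlinarith

theorem psi_comp {B : ℝ} (hB : 1 ≤ B) {r : S → ℝ} (hr : ∀ σ, 0 ≤ r σ) (h : psi B r ≠ 0) (σ τ : S) : r σ ≤ B * r τ := by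
  classical
  have h3 := psi_pos h
  obtain ⟨μ, -, hμ⟩ := exists_max_image univ r ⟨σ, mem_univ σ⟩
  refine (hμ σ (mem_univ _)).trans ?_
  have h4 : r μ ^ (Fintype.card S) ≤ ∑ σ, r σ ^ (Fintype.card S) :=
    single_le_sum (f := fun σ => r σ ^ (Fintype.card S)) (fun i _ => pow_nonneg (hr i) _) (mem_univ μ)
  have h5 : nn r ≤ r τ * r μ ^ (Fintype.card S - 1) := by
    rw [nn, ← mul_prod_erase _ _ (mem_univ τ)]
    refine mul_le_mul_of_nonneg_left ?_ (hr τ)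
    refine (prod_le_prod (fun i _ => hr i) fun i _ => hμ i (mem_univ i)).trans ?_
    rw [prod_const, card_erase_of_mem (mem_univ _), card_univ]
  have hc : 0 < Fintype.card S := Fintype.card_pos_iff.2 ⟨σ⟩
  rcases (hr μ).eq_or_lt with h0 | h0
  · rw [← h0]; exact mul_nonneg (by linarith) (hr τ)
  · have : r μ * r μ ^ (Fintype.card S - 1) ≤ (B * r τ) * r μ ^ (Fintype.card S - 1) := by
      rw [← pow_succ', Nat.sub_add_cancel hc]
      nlinarith
    exact le_of_mul_le_mul_right this (by positivity)

theorem psi_ratio {B : ℝ} (hB : 1 ≤ B) {r v : S → ℝ} (hr : ∀ σ, 0 ≤ r σ) (h : psi B r ≠ 0) (hv : ∀ σ, 0 ≤ v σ)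
    (hv1 : ∏ σ, v σ = 1) (h' : psi B (v * r) ≠ 0) (σ : S) : v σ ≤ B^2 := by
  obtain ⟨τ, hτ⟩ : ∃ τ, v τ ≤ 1 := by
    by_contra! hc
    have : ∏ σ : S, (1:ℝ) < ∏ σ, v σ := prod_lt_prod (fun _ _ => one_pos) (fun i _ => (hc i).le) ⟨σ, mem_univ _, hc σ⟩
    simp [hv1] at this
  have h1 : v σ * r σ ≤ B * (v τ * r τ) := psi_comp hB (fun σ => mul_nonneg (hv σ) (hr σ)) h' σ τ
  have h2 := psi_comp hB hr h τ σ
  have hpos : 0 < r σ := by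
    by_contra! h0
    have h0 : r σ = 0 := le_antisymm h0 (hr σ)
    have := psi_pos h
    have hn : nn r = 0 := prod_eq_zero (mem_univ σ) h0
    rw [hn, mul_zero] at this
    exact absurd this (not_lt.2 (sum_nonneg fun i _ => pow_nonneg (hr i) _))
  have : v σ * r σ ≤ B^2 * r σ := by
    calc v σ * r σ ≤ B * (v τ * r τ) := h1
      _ ≤ B * (1 * (B * r σ)) := by have := hr τ; gcongr
      _ = _ := by ring
  exact le_of_mul_le_mul_right this hpos
end MFP
end

section
namespace MFP
open Finset NumberField NumberField.mixedEmbedding NumberField.mixedEmbedding.fundamentalCone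
open scoped Classical
set_option linter.unusedSectionVars false

variable (K : Type*) [Field K] [NumberField K]

noncomputable def rr (x : mixedSpace K) : (K →+* ℂ) → ℝ := fun σ => normAtPlace (InfinitePlace.mk σ) x

variable {K}
theorem rr_nonneg (x : mixedSpace K) (σ : K →+* ℂ) : 0 ≤ rr K x σ := normAtPlace_nonneg _ _

theorem nn_rr (x : mixedSpace K) : nn (rr K x) = mixedEmbedding.norm x := by
  classical
  rw [nn, mixedEmbedding.norm_apply, ← prod_fiberwise univ (fun σ : K →+* ℂ => InfinitePlace.mk σ)]
  refine prod_congr rfl fun w _ => ?_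
  rw [prod_congr rfl (g := fun _ => normAtPlace w x), prod_const, InfinitePlace.card_filter_mk_eq]
  intro σ hσ
  rw [mem_filter] at hσ
  rw [rr, hσ.2]

theorem rr_smul {c : ℝ} (hc : 0 ≤ c) (x : mixedSpace K) : rr K (c • x) = c • rr K x := by
  ext σ; simp [rr, normAtPlace_smul, abs_of_nonneg hc]

theorem rr_le (x : mixedSpace K) (σ : K →+* ℂ) : rr K x σ ≤ ‖x‖ := by
  rw [norm_eq_sup'_normAtPlace]
  exact le_sup' (fun w => normAtPlace w x) (mem_univ _)

theorem rr_coerc {x : mixedSpace K} {M : ℝ} (h : ∀ σ, rr K x σ ≤ M) : ‖x‖ ≤ M := by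
  rw [norm_eq_sup'_normAtPlace]
  refine sup'_le _ _ fun w _ => ?_
  have := h w.embedding
  rwa [rr, InfinitePlace.mk_embedding] at this

theorem rr_lip (x y : mixedSpace K) (σ : K →+* ℂ) : |rr K x σ - rr K y σ| ≤ ‖x - y‖ := by
  have h1 := normAtPlace_add_le (InfinitePlace.mk σ) (x - y) y
  have h2 := normAtPlace_add_le (InfinitePlace.mk σ) (y - x) x
  rw [sub_add_cancel] at h1 h2
  have h3 := rr_le (x - y) σ
  have h4 := rr_le (y - x) σ
  rw [norm_sub_rev] at h4
  simp only [rr] at *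
  rw [abs_le]; constructor <;> linarith

theorem rr_mul (x y : mixedSpace K) : rr K (x * y) = rr K x * rr K y := by
  ext σ; simp [rr]

variable (K) in
theorem exists_M : ∃ M : ℝ, 0 ≤ M ∧ ∀ x : mixedSpace K, mixedEmbedding.norm x ≠ 0 → ∃ u : (𝓞 K)ˣ, ∀ σ,
    rr K (u • x) σ ^ (Fintype.card (K →+* ℂ)) ≤ M * mixedEmbedding.norm x := by
  obtain ⟨A, hA⟩ := (isBounded_normLeOne K).exists_norm_le
  set n := Fintype.card (K →+* ℂ) with hn
  have hn0 : n ≠ 0 := Fintype.card_ne_zero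
  refine ⟨|A|^n, by positivity, fun x hx => ?_⟩
  obtain ⟨u, hu⟩ := exists_unit_smul_mem hx
  refine ⟨u, fun σ => ?_⟩
  have hN : 0 < mixedEmbedding.norm x := lt_of_le_of_ne (mixedEmbedding.norm_nonneg x) (Ne.symm hx)
  set N := mixedEmbedding.norm x with hNdef
  set t : ℝ := N ^ (-(1 / (n:ℝ))) with ht
  have ht0 : 0 < t := by positivity
  have htn : t^n * N = 1 := by
    rw [ht, ← Real.rpow_natCast, ← Real.rpow_mul hN.le]
    rw [show -(1 / (n:ℝ)) * n = -1 by field_simp, Real.rpow_neg_one, inv_mul_cancel₀ hN.ne']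
  have hmem : t • (u • x) ∈ normLeOne K := by
    refine ⟨(smul_mem_iff_mem ht0.ne').2 hu, ?_⟩
    rw [Set.mem_ofPred_eq, mixedEmbedding.norm_smul, norm_unit_smul, abs_of_pos ht0, ← hNdef]
    rw [← Embeddings.card K ℂ, ← hn, htn]
  have h1 := (rr_le _ σ).trans (hA _ hmem)
  rw [rr_smul ht0.le] at h1
  have h2 : t * rr K (u • x) σ ≤ |A| := h1.trans (le_abs_self A)
  have h3 : (t * rr K (u • x) σ)^n ≤ |A|^n := pow_le_pow_left₀ (mul_nonneg ht0.le (rr_nonneg _ _)) h2 n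
  rw [mul_pow] at h3
  calc _ = (t^n * rr K (u • x) σ ^ n) * N := by rw [mul_right_comm, htn, one_mul]
    _ ≤ _ := by gcongr

variable (K) in
noncomputable def uv (u : (𝓞 K)ˣ) : (K →+* ℂ) → ℝ := rr K (mixedEmbedding K (u : 𝓞 K))

theorem uv_apply (u : (𝓞 K)ˣ) (σ : K →+* ℂ) : uv K u σ = ‖σ ((u : 𝓞 K) : K)‖ := by
  rw [uv, rr, normAtPlace_apply]; rfl

theorem rr_unit (u : (𝓞 K)ˣ) (x : mixedSpace K) : rr K (u • x) = uv K u * rr K x := by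
  rw [unitSMul_smul, rr_mul]; rfl

theorem units_finite (B : ℝ) : {u : (𝓞 K)ˣ | ∀ σ, uv K u σ ≤ B}.Finite := by
  have h := Embeddings.finite_of_norm_le K ℂ B
  refine Set.Finite.of_injOn (f := fun u : (𝓞 K)ˣ => ((u : 𝓞 K) : K)) (fun u hu => ?_) (fun u _ v _ h => ?_) h
  · exact ⟨RingOfIntegers.isIntegral_coe _, fun σ => by rw [← uv_apply]; exact hu σ⟩
  · exact Units.ext (RingOfIntegers.ext h)

variable (K) in
theorem unit_sum : ∃ (B : ℝ) (U : Finset (𝓞 K)ˣ), 1 ≤ B ∧ ∀ x : mixedSpace K, mixedEmbedding.norm x ≠ 0 →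
    HasSum (fun u : (𝓞 K)ˣ => theta B U (uv K) (rr K (u • x)))
      (max 0 (1 - mixedEmbedding.norm x) * mixedEmbedding.norm x ^ 2) := by
  classical
  obtain ⟨M, hM0, hM⟩ := exists_M K
  set n := Fintype.card (K →+* ℂ) with hn
  set B : ℝ := n * M + 1 with hBdef
  have hB : 1 ≤ B := by have : 0 ≤ n * M := by positivity
                        linarith
  set U := (units_finite (K := K) (B^2)).toFinset with hU
  refine ⟨B, U, hB, fun x hx => ?_⟩
  have hN : 0 < mixedEmbedding.norm x := lt_of_le_of_ne (mixedEmbedding.norm_nonneg x) (Ne.symm hx)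
  set N := mixedEmbedding.norm x with hNdef
  set f : (𝓞 K)ˣ → ℝ := fun u => psi B (rr K (u • x)) with hf
  have hfn : ∀ u, nn (rr K (u • x)) = N := fun u => by rw [nn_rr, norm_unit_smul]
  have hprod : ∀ u : (𝓞 K)ˣ, ∏ σ, uv K u σ = 1 := fun u => by
    have := nn_rr (mixedEmbedding K (u : 𝓞 K)); rw [norm_unit] at this; exact this
  have hout : ∀ u₁, f u₁ ≠ 0 → ∀ u, u ∉ U → f (u * u₁) = 0 := by
    intro u₁ h1 u hu
    by_contra h2
    apply hu
    rw [hU, Set.Finite.mem_toFinset]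
    intro σ
    refine psi_ratio hB (rr_nonneg _) h1 (v := uv K u) (fun σ => rr_nonneg _ σ) (hprod u) ?_ σ
    rw [← rr_unit, ← mul_smul]; exact h2
  obtain ⟨u₀, hu₀⟩ := hM x hx
  have hN0 : N ≤ f u₀ := by
    refine le_trans ?_ (le_max_right _ _)
    have : ∑ σ : K →+* ℂ, rr K (u₀ • x) σ ^ n ≤ ∑ σ : K →+* ℂ, M * N := sum_le_sum fun σ _ => hu₀ σ
    rw [sum_const, card_univ, nsmul_eq_mul, ← hn] at this
    rw [hfn, hBdef]; linarith
  set T := ∑ u ∈ U, f (u * u₀) with hT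
  have hsum : ∀ u₁, f u₁ ≠ 0 → HasSum f (∑ u ∈ U, f (u * u₁)) := by
    intro u₁ h1
    rw [← (Equiv.mulRight u₁).hasSum_iff]
    exact hasSum_sum_of_ne_finset_zero fun u hu => hout u₁ h1 u hu
  have hTs : HasSum f T := hsum u₀ (by linarith)
  have hTN : N ≤ T := hN0.trans (le_hasSum hTs u₀ fun u _ => psi_nonneg _ _)
  have hth : ∀ u : (𝓞 K)ˣ, theta B U (uv K) (rr K (u • x)) = f u * (max 0 (1 - N) * N^2 / T) := by
    intro u
    by_cases h0 : f u = 0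
    · have : psi B (rr K (u • x)) = 0 := h0
      rw [theta, this, h0]; ring
    · have h1 : ∑ u' ∈ U, psi B (uv K u' * rr K (u • x)) = T := by
        rw [← (hsum u h0).unique hTs]
        refine sum_congr rfl fun u' _ => ?_
        rw [← rr_unit, ← mul_smul]
      rw [theta, ee, h1, hfn, max_eq_left hTN]
      ring
  simp_rw [hth]
  have hT0 : T ≠ 0 := by linarith
  have h5 := hTs.mul_right (max 0 (1 - N) * N^2 / T)
  rwa [mul_div_cancel₀ _ hT0] at h5
end MFP
end

section
namespace MFP
open Finset NumberField NumberField.mixedEmbedding NumberField.mixedEmbedding.fundamentalCone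
open scoped Classical nonZeroDivisors
set_option linter.unusedSectionVars false

variable {K : Type*} [Field K] [NumberField K]

noncomputable def ww (t : ℝ) : ℝ := max 0 (1 - t) * t^2

theorem norm_gen (g : 𝓞 K) : mixedEmbedding.norm (mixedEmbedding K (g : K)) = Ideal.absNorm (Ideal.span {g}) := by
  rw [mixedEmbedding.norm_eq_norm, Ideal.absNorm_span_singleton, ← Algebra.coe_norm_int]
  rw [← Int.cast_abs, Rat.cast_intCast, Int.abs_eq_natAbs, Int.cast_natCast]

theorem theta_setup {ι : Type*} [Fintype ι] (b : Module.Basis ι ℝ (mixedSpace K)) {B : ℝ} (hB : 1 ≤ B) (U : Finset (𝓞 K)ˣ) :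
    ∃ κ C' : ℝ, 0 ≤ C' ∧ ∀ R : ℝ, 1 ≤ R →
      (Function.support fun z : ι → ℤ => theta B U (uv K) (rr K (R⁻¹ • ∑ i, (z i : ℝ) • b i))).Finite ∧
      |∑' z : ι → ℤ, theta B U (uv K) (rr K (R⁻¹ • ∑ i, (z i : ℝ) • b i)) - κ * R^(Module.finrank ℚ K)|
        ≤ C' * (R^(Module.finrank ℚ K) / R) := by
  set T : (ι → ℝ) ≃L[ℝ] mixedSpace K := b.equivFun.symm.toContinuousLinearEquiv with hT
  have hTa : ∀ y, T y = ∑ i, y i • b i := fun y => by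
    rw [hT]; exact b.equivFun_symm_apply y
  set A := ‖(T : (ι → ℝ) →L[ℝ] mixedSpace K)‖
  set A' := ‖(T.symm : mixedSpace K →L[ℝ] (ι → ℝ))‖
  have hA : ∀ y, ‖T y‖ ≤ A * ‖y‖ := fun y => (T : (ι → ℝ) →L[ℝ] mixedSpace K).le_opNorm y
  have hA' : ∀ y, ‖y‖ ≤ A' * ‖T y‖ := fun y => by
    have := (T.symm : mixedSpace K →L[ℝ] (ι → ℝ)).le_opNorm (T y)
    simpa using this
  have hA0 : 0 ≤ A := norm_nonneg _
  have hA0' : 0 ≤ A' := norm_nonneg _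
  set Θ : (ι → ℝ) → ℝ := fun y => theta B U (uv K) (rr K (T y)) with hΘ
  obtain ⟨C, hC, hlip⟩ := theta_lip B U (uv K) (B + A)
  have hl : ∀ y y', ‖y - y'‖ ≤ 1 → Θ y ≠ 0 → |Θ y - Θ y'| ≤ (C * A) * ‖y - y'‖ := by
    intro y y' h h0
    have h1 := theta_supp hB U (uv K) (rr_nonneg (T y)) h0
    have h2 : ‖T y - T y'‖ ≤ A * ‖y - y'‖ := by rw [← map_sub]; exact hA _
    have h3 := fun σ => (abs_le.1 ((rr_lip (T y) (T y') σ).trans h2)).1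
    have h4 : A * ‖y - y'‖ ≤ A := by nlinarith
    refine (hlip _ _ ⟨rr_nonneg _, fun σ => ?_⟩ ⟨rr_nonneg _, fun σ => ?_⟩).trans ?_
    · have := h1 σ; simp only; linarith
    · have := h1 σ; have := h3 σ; simp only; linarith
    · rw [mul_assoc]
      refine mul_le_mul_of_nonneg_left ?_ hC
      rw [pi_norm_le_iff_of_nonneg (by positivity)]
      intro σ
      exact (rr_lip (T y) (T y') σ).trans h2
  have hsp : ∀ y, A' * B < ‖y‖ → Θ y = 0 := by
    intro y hy
    by_contra h0
    have h1 := rr_coerc (theta_supp hB U (uv K) (rr_nonneg (T y)) h0)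
    have := hA' y
    have : A' * ‖T y‖ ≤ A' * B := by gcongr
    linarith
  have hlp : ∀ y y', ‖y - y'‖ ≤ 1 → |Θ y - Θ y'| ≤ (C * A) * ‖y - y'‖ := by
    intro y y' h
    by_cases h0 : Θ y = 0
    · by_cases h1 : Θ y' = 0
      · rw [h0, h1]; simp; positivity
      · rw [abs_sub_comm, norm_sub_rev]; exact hl _ _ (by rwa [norm_sub_rev]) h1
    · exact hl _ _ h h0
  obtain ⟨κ, C', hC', h⟩ := lattice_sum Θ (A' * B) (C * A) (by positivity) (by positivity) hsp hlp
  · refine ⟨κ, C', hC', fun R hR => ?_⟩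
    have hcard : Fintype.card ι = Module.finrank ℚ K := by
      rw [← Module.finrank_eq_card_basis b, mixedEmbedding.finrank]
    have e : ∀ z : ι → ℤ, Θ (fun i => (z i : ℝ) / R) = theta B U (uv K) (rr K (R⁻¹ • ∑ i, (z i : ℝ) • b i)) := by
      intro z
      rw [hΘ]; dsimp only
      rw [← hTa, ← map_smul]
      congr 3
      ext i; simp [div_eq_inv_mul]
    have := h R hR
    simp_rw [e, hcard] at this
    exact this

theorem class_asymp (J : (Ideal (𝓞 K))⁰) : ∃ κ C' : ℝ, 0 ≤ C' ∧ ∀ X : ℝ, 1 ≤ X → ∃ t : ℝ,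
    HasSum (fun I : {I : (Ideal (𝓞 K))⁰ // (J : Ideal (𝓞 K)) ∣ I ∧ Submodule.IsPrincipal (I : Ideal (𝓞 K))} =>
      ww ((Ideal.absNorm (I.1 : Ideal (𝓞 K)) : ℝ) / X)) t ∧
    |t - κ * X| ≤ C' * X^(1 - 1 / (Module.finrank ℚ K : ℝ)) := by
  obtain ⟨B, U, hB, hsum⟩ := unit_sum K
  set FI := FractionalIdeal.mk0 K J with hFI
  set b := fractionalIdealLatticeBasis K FI with hb
  obtain ⟨κ, C', hC', hmain⟩ := theta_setup b hB U
  set n := Module.finrank ℚ K with hn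
  have hn0 : 0 < n := Module.finrank_pos
  refine ⟨κ, C', hC', fun X hX => ?_⟩
  have hX0 : 0 < X := by linarith
  set R : ℝ := X^(1 / (n:ℝ)) with hR
  have hR1 : 1 ≤ R := Real.one_le_rpow hX (by positivity)
  have hR0 : 0 < R := by linarith
  have hRn : R^n = X := by
    rw [hR, ← Real.rpow_natCast, ← Real.rpow_mul hX0.le, one_div_mul_cancel (by positivity), Real.rpow_one]
  obtain ⟨hfin, hbd⟩ := hmain R hR1
  set f : (_ → ℤ) → ℝ := fun z => theta B U (uv K) (rr K (R⁻¹ • ∑ i, (z i : ℝ) • b i)) with hf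
  have hfs : HasSum f (∑' z, f z) := (summable_of_hasFiniteSupport hfin).hasSum
  set P := {I : (Ideal (𝓞 K))⁰ // (J : Ideal (𝓞 K)) ∣ I ∧ Submodule.IsPrincipal (I : Ideal (𝓞 K))} with hP
  have hgen : ∀ I : P, ∃ g : 𝓞 K, Ideal.span {g} = (I.1 : Ideal (𝓞 K)) := fun I => by
    obtain ⟨g, hg⟩ := I.2.2.principal
    exact ⟨g, hg.symm⟩
  choose g hg using hgen
  have hg0 : ∀ I : P, g I ≠ 0 := fun I h0 => by
    have h1 := hg I
    rw [h0, Ideal.span_singleton_zero] at h1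
    exact nonZeroDivisors.coe_ne_zero I.1 h1.symm
  have hz : ∀ q : P × (𝓞 K)ˣ, ∃ z : _ → ℤ, ∑ i, (z i : ℝ) • b i = mixedEmbedding K (((q.2 : 𝓞 K) * g q.1 : 𝓞 K) : K) := by
    intro q
    have : mixedEmbedding K (((q.2 : 𝓞 K) * g q.1 : 𝓞 K) : K) ∈ Submodule.span ℤ (Set.range b) := by
      rw [hb, mem_span_fractionalIdealLatticeBasis]
      refine ⟨_, ?_, rfl⟩
      rw [hFI, FractionalIdeal.coe_mk0]
      refine ⟨(q.2 : 𝓞 K) * g q.1, ?_, rfl⟩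
      have h1 : g q.1 ∈ (J : Ideal (𝓞 K)) := by
        apply Ideal.le_of_dvd q.1.2.1
        rw [← hg q.1]; exact Ideal.mem_span_singleton_self _
      exact Ideal.mul_mem_left _ _ h1
    obtain ⟨z, hz⟩ := Submodule.mem_span_range_iff_exists_fun ℤ |>.1 this
    refine ⟨z, ?_⟩
    rw [← hz]
    exact sum_congr rfl fun i _ => by rw [Int.cast_smul_eq_zsmul]
  choose e he using hz
  have hinj : Function.Injective e := by
    rintro ⟨I, u⟩ ⟨I', u'⟩ h
    have h1 := he (I, u)
    rw [h, he (I', u')] at h1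
    have h2 : (u' : 𝓞 K) * g I' = u * g I := RingOfIntegers.ext ((mixedEmbedding_injective K) h1)
    have h3 : I = I' := by
      have e1 : Ideal.span {(u' : 𝓞 K) * g I'} = Ideal.span {g I'} := Ideal.span_singleton_mul_left_unit u'.isUnit _
      have e2 : Ideal.span {(u : 𝓞 K) * g I} = Ideal.span {g I} := Ideal.span_singleton_mul_left_unit u.isUnit _
      rw [h2, e2, hg, hg] at e1
      exact Subtype.ext (Subtype.ext e1)
    subst h3
    have h4 := mul_right_cancel₀ (hg0 I) h2
    rw [Units.ext h4]
  have hlin : ∀ z z' : _ → ℤ, ∑ i, (z i : ℝ) • b i = ∑ i, (z' i : ℝ) • b i → z = z' := by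
    intro z z' h
    rw [← b.equivFun_symm_apply (fun i => (z i : ℝ)), ← b.equivFun_symm_apply (fun i => (z' i : ℝ))] at h
    have := b.equivFun.symm.injective h
    ext i
    exact_mod_cast congrFun this i
  have hrange : ∀ z, z ∉ Set.range e → f z = 0 := by
    intro z hz
    by_cases h0 : z = 0
    · have : rr K (R⁻¹ • ∑ i, (z i : ℝ) • b i) = 0 := by rw [h0]; ext σ; simp [rr]
      rw [hf]
      dsimp only
      rw [this, theta, nn, prod_eq_zero (mem_univ (Classical.arbitrary (K →+* ℂ))) rfl]; simp
    · exfalso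
      apply hz
      have hx : ∑ i, (z i : ℝ) • b i ∈ Submodule.span ℤ (Set.range b) := by
        refine Submodule.sum_mem _ fun i _ => ?_
        rw [Int.cast_smul_eq_zsmul]
        exact Submodule.smul_mem _ _ (Submodule.subset_span ⟨i, rfl⟩)
      rw [hb, mem_span_fractionalIdealLatticeBasis] at hx
      obtain ⟨a', ha', hax⟩ := hx
      rw [hFI, FractionalIdeal.coe_mk0] at ha'
      obtain ⟨a, haJ, rfl⟩ := ha'
      have ha0 : a ≠ 0 := by
        rintro rfl
        apply h0
        apply hlin
        rw [← hb] at hax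
        rw [← hax]; simp
      let I : P := ⟨⟨Ideal.span {a}, mem_nonZeroDivisors_of_ne_zero (by simpa using ha0)⟩,
        Ideal.dvd_iff_le.2 ((Ideal.span_singleton_le_iff_mem _).2 haJ), ⟨a, rfl⟩⟩
      have h1 : Ideal.span {g I} = Ideal.span {a} := hg I
      obtain ⟨u, hu⟩ := Ideal.span_singleton_eq_span_singleton.1 h1
      refine ⟨(I, u), hlin _ _ ?_⟩
      rw [he, ← hb] at *
      rw [← hax, mul_comm, hu]; rfl
  have h1 := (hinj.hasSum_iff hrange).2 hfs
  have h2 : ∀ I : P, HasSum (fun u => (f ∘ e) (I, u)) (ww ((Ideal.absNorm (I.1 : Ideal (𝓞 K)) : ℝ) / X)) := by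
    intro I
    have hnm : mixedEmbedding.norm (R⁻¹ • mixedEmbedding K (g I : K)) = (Ideal.absNorm (I.1 : Ideal (𝓞 K)) : ℝ) / X := by
      rw [mixedEmbedding.norm_smul, norm_gen, hg, ← hn, abs_of_pos (by positivity), inv_pow, hRn, inv_mul_eq_div]
    have hne : (Ideal.absNorm (I.1 : Ideal (𝓞 K)) : ℝ) / X ≠ 0 := by
      have : (Ideal.absNorm (I.1 : Ideal (𝓞 K))) ≠ 0 := Ideal.absNorm_ne_zero_of_nonZeroDivisors I.1
      positivity
    have := hsum (R⁻¹ • mixedEmbedding K (g I : K)) (by rwa [hnm])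
    rw [hnm] at this
    refine Eq.subst (motive := fun q => HasSum q _) (funext fun u => ?_) this
    simp only [hf, Function.comp, he, unitSMul_smul]
    congr 1; congr 1
    rw [mul_smul_comm, ← map_mul]; rfl
  refine ⟨_, h1.prod_fiberwise h2, ?_⟩
  rw [Real.rpow_sub hX0, Real.rpow_one, ← hR, ← hRn]
  exact hbd
end MFP
end

section
namespace MFP
open Finset NumberField Filter Topology
open scoped Classical nonZeroDivisors
set_option linter.unusedSectionVars false

variable (K : Type*) [Field K] [NumberField K]

noncomputable def rI (n : ℕ) : ℝ := Nat.card {I : Ideal (𝓞 K) // Ideal.absNorm I = n}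

variable {K}
theorem class_asymp' (c : ClassGroup (𝓞 K)) : ∃ κ C' : ℝ, 0 ≤ C' ∧ ∀ X : ℝ, 1 ≤ X → ∃ t : ℝ,
    HasSum (fun I : {I : (Ideal (𝓞 K))⁰ // ClassGroup.mk0 I = c} =>
      ww ((Ideal.absNorm (I.1 : Ideal (𝓞 K)) : ℝ) / X)) t ∧
    |t - κ * X| ≤ C' * X^(1 - 1 / (Module.finrank ℚ K : ℝ)) := by
  obtain ⟨J, hJ⟩ := ClassGroup.mk0_surjective c⁻¹
  obtain ⟨κ, C', hC', h⟩ := class_asymp J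
  have hN : (1:ℝ) ≤ Ideal.absNorm (J : Ideal (𝓞 K)) := by
    have := Ideal.absNorm_pos_of_nonZeroDivisors J
    exact_mod_cast this
  set N : ℝ := ((Ideal.absNorm (J : Ideal (𝓞 K)) : ℕ) : ℝ) with hNd
  refine ⟨κ * N, C' * N^(1 - 1 / (Module.finrank ℚ K : ℝ)), by positivity, fun X hX => ?_⟩
  obtain ⟨t, ht, hb⟩ := h (N * X) (by nlinarith)
  refine ⟨t, ?_, ?_⟩
  · have hiff : ∀ I : (Ideal (𝓞 K))⁰, ClassGroup.mk0 I = c ↔ Submodule.IsPrincipal ((J * I : (Ideal (𝓞 K))⁰) : Ideal (𝓞 K)) := fun I => by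
      rw [← ClassGroup.mk0_eq_one_iff (J * I).2]
      change _ ↔ ClassGroup.mk0 (J * I) = 1
      rw [map_mul, hJ, inv_mul_eq_one, eq_comm]
    let e : {I : (Ideal (𝓞 K))⁰ // ClassGroup.mk0 I = c} ≃ {I : (Ideal (𝓞 K))⁰ // (J : Ideal (𝓞 K)) ∣ I ∧ Submodule.IsPrincipal (I : Ideal (𝓞 K))} :=
      (((Equiv.dvd J).subtypeEquiv fun I ↦ hiff I).trans
      (Equiv.subtypeSubtypeEquivSubtypeInter (fun I : (Ideal (𝓞 K))⁰ ↦ J ∣ I)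
        (fun I => Submodule.IsPrincipal (I : Ideal (𝓞 K))))).trans
      (Equiv.subtypeEquivRight fun I => by rw [nonZeroDivisors_dvd_iff_dvd_coe])
    have he : ∀ I, ((e I).1 : Ideal (𝓞 K)) = J * I.1 := fun I => rfl
    have := e.hasSum_iff.2 ht
    refine Eq.subst (motive := fun q => HasSum q _) (funext fun I => ?_) this
    simp only [Function.comp, he, map_mul, Nat.cast_mul, ← hNd]
    rw [mul_div_mul_left _ _ (by positivity)]
  · rw [Real.mul_rpow (by positivity) (by positivity)] at hb
    rw [mul_assoc, mul_assoc]; exact hb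

theorem ideal_asymp : ∃ κ C' : ℝ, 0 ≤ C' ∧ ∀ X : ℝ, 1 ≤ X → ∃ t : ℝ,
    HasSum (fun I : Ideal (𝓞 K) => ww ((Ideal.absNorm I : ℝ) / X)) t ∧
    |t - κ * X| ≤ C' * X^(1 - 1 / (Module.finrank ℚ K : ℝ)) := by
  choose κ C' hC' h using fun c => class_asymp' (K := K) c
  refine ⟨∑ c, κ c, ∑ c, C' c, sum_nonneg fun c _ => hC' c, fun X hX => ?_⟩
  choose t ht hb using fun c => h c X hX
  refine ⟨∑ c, t c, ?_, ?_⟩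
  · have h1 := hasSum_sum (s := univ) fun c _ => (hasSum_subtype_iff_indicator (f := fun I : (Ideal (𝓞 K))⁰ =>
      ww ((Ideal.absNorm (I : Ideal (𝓞 K)) : ℝ) / X)) (s := {I | ClassGroup.mk0 I = c})).1 (ht c)
    have h2 : HasSum (fun I : (Ideal (𝓞 K))⁰ => ww ((Ideal.absNorm (I : Ideal (𝓞 K)) : ℝ) / X)) (∑ c, t c) := by
      refine Eq.subst (motive := fun q => HasSum q _) (funext fun I => ?_) h1
      simp [Set.indicator_apply]
    refine (Function.Injective.hasSum_iff Subtype.val_injective ?_).1 h2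
    intro I hI
    have : I = ⊥ := by
      by_contra h0
      exact hI ⟨⟨I, mem_nonZeroDivisors_of_ne_zero h0⟩, rfl⟩
    simp [this, ww]
  · rw [sum_mul, sum_mul, ← sum_sub_distrib]
    exact (abs_sum_le_sum_abs _ _).trans (sum_le_sum fun c _ => hb c)

theorem hasSum_rI {f : ℕ → ℝ} {t : ℝ} (h : HasSum (fun I : Ideal (𝓞 K) => f (Ideal.absNorm I)) t) :
    HasSum (fun n => rI K n * f n) t := by
  have h1 := h.tsum_fiberwise (fun I => Ideal.absNorm I)
  refine Eq.subst (motive := fun q => HasSum q _) (funext fun n => ?_) h1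
  have : Finite ((fun I : Ideal (𝓞 K) => Ideal.absNorm I) ⁻¹' {n}) := (Ideal.finite_setOfPred_absNorm_eq n)
  letI := Fintype.ofFinite ((fun I : Ideal (𝓞 K) => Ideal.absNorm I) ⁻¹' {n})
  rw [tsum_fintype, sum_congr rfl (g := fun _ => f n), sum_const, rI, nsmul_eq_mul, card_univ, ← Nat.card_eq_fintype_card]
  · rfl
  · rintro ⟨I, rfl⟩ _; rfl

theorem smooth_asymp : ∃ κ C' : ℝ, ∀ X : ℝ, 1 ≤ X →
    |∑ n ∈ Icc 1 ⌊X⌋₊, rI K n * ((n / X)^2 * (1 - n / X)) - κ * X| ≤ C' * X^(1 - 1 / (Module.finrank ℚ K : ℝ)) := by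
  obtain ⟨κ, C', hC', h⟩ := ideal_asymp (K := K)
  refine ⟨κ, C', fun X hX => ?_⟩
  obtain ⟨t, ht, hb⟩ := h X hX
  have h1 := hasSum_rI (f := fun n => ww (n / X)) ht
  have hX0 : 0 < X := by linarith
  have h2 : t = ∑ n ∈ Icc 1 ⌊X⌋₊, rI K n * ((n / X)^2 * (1 - n / X)) := by
    rw [← h1.tsum_eq, tsum_eq_sum (s := Icc 1 ⌊X⌋₊)]
    · refine sum_congr rfl fun n hn => ?_
      rw [mem_Icc, Nat.le_floor_iff hX0.le] at hn
      rw [ww, max_eq_right, mul_comm (1 - _)]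
      rw [sub_nonneg, div_le_one hX0]; exact hn.2
    · intro n hn
      rw [mem_Icc, Nat.le_floor_iff hX0.le, not_and, not_le] at hn
      rcases Nat.eq_zero_or_pos n with rfl | h0
      · simp [ww]
      · rw [ww, max_eq_left]; simp
        rw [sub_nonpos, one_le_div hX0]; exact (hn h0).le
  rw [← h2]; exact hb

theorem rI_nonneg (n : ℕ) : 0 ≤ rI K n := Nat.cast_nonneg _

theorem rI_summ (s : ℂ) (hs : 1 < s.re) : LSeriesSummable (fun n => (rI K n : ℂ)) s := by
  refine LSeriesSummable_of_sum_norm_bigO_and_nonneg (r := 1) ?_ rI_nonneg zero_le_one hs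
  have h1 : Tendsto (fun n : ℕ => (∑ k ∈ Icc 1 n, rI K k) / n) atTop (𝓝 (dedekindZeta_residue K)) := by
    refine ((Ideal.tendsto_norm_le_div_atTop₀ K).comp tendsto_natCast_atTop_atTop).congr fun n ↦ ?_
    simp only [Function.comp_apply, Nat.cast_le, rI, ← Nat.cast_sum]
    congr
    rw [← add_left_inj 1, ← Ideal.card_norm_le_eq_card_norm_le_add_one,
      show Finset.Icc 1 n = Finset.Ioc 0 n from Finset.Icc_succ_left_eq_Ioc _ _,
      show 1 = Nat.card {I : Ideal (𝓞 K) // Ideal.absNorm I = 0} by simp [Ideal.absNorm_eq_zero_iff],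
      Finset.sum_Ioc_add_eq_sum_Icc (n.zero_le),
      ← Finset.card_preimage_eq_sum_card_image_eq (fun k _ ↦ Ideal.finite_setOfPred_absNorm_eq k)]
    simp [Set.coe_eq_subtype]
  have h2 := h1.isBigO_one ℝ
  have h3 := h2.mul (Asymptotics.isBigO_refl (fun n : ℕ => (n:ℝ)) atTop)
  refine (h3.congr' ?_ ?_)
  · filter_upwards [eventually_gt_atTop 0] with n hn
    have : (0:ℝ) < n := by exact_mod_cast hn
    field_simp
  · exact Eventually.of_forall fun n => by simp

variable (K)
theorem zeta_ext : ∃ (H : ℂ → ℂ) (δ : ℝ), 0 < δ ∧ δ ≤ 1/4 ∧ DifferentiableOn ℂ H {s | 1 - δ < s.re} ∧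
    (∃ (C : ℝ) (A : ℕ), 0 < C ∧ ∀ s, 1 - δ < s.re → ‖H s‖ ≤ C * (1 + ‖s‖)^A) ∧ H 1 ≠ 0 ∧
    ∀ s, 1 < s.re → H s = (s - 1) * LSeries (fun n => (rI K n : ℂ)) s := by
  obtain ⟨κ, C', h⟩ := smooth_asymp (K := K)
  have hn : 0 < Module.finrank ℚ K := Module.finrank_pos
  obtain ⟨H, h1, ⟨C, A, hC, h2⟩, h3⟩ := continuation rI_nonneg rI_summ (δ := 1 / (Module.finrank ℚ K : ℝ)) (by positivity) h
  set δ := 1 / (Module.finrank ℚ K : ℝ) / 2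
  have hδ : 0 < δ := by positivity
  have hsub : ∀ s : ℂ, 1 - min δ (1/4) < s.re → 1 - δ < s.re := fun s hs => by
    have := min_le_left δ (1/4); linarith
  refine ⟨H, min δ (1/4), by positivity, min_le_right _ _, h1.mono hsub, ⟨C, A, hC, fun s hs => h2 s (hsub s hs)⟩, ?_, h3⟩
  have hc : ContinuousAt H 1 := by
    refine (h1.differentiableAt ?_).continuousAt
    exact (isOpen_lt continuous_const Complex.continuous_re).mem_nhds (by simp [hδ])
  have t1 : Tendsto (fun s : ℝ => H s) (𝓝[>] 1) (𝓝 (H 1)) := by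
    have : Tendsto (fun s : ℝ => (s : ℂ)) (𝓝[>] 1) (𝓝 1) := by
      have := (Complex.continuous_ofReal.tendsto 1).mono_left (nhdsWithin_le_nhds (s := Set.Ioi 1))
      simpa using this
    exact hc.tendsto.comp this
  have t2 := tendsto_sub_one_mul_dedekindZeta_nhdsGT K
  have t3 : Tendsto (fun s : ℝ => H s) (𝓝[>] 1) (𝓝 (dedekindZeta_residue K)) := by
    refine t2.congr' ?_
    filter_upwards [self_mem_nhdsWithin] with s hs
    rw [h3 s (by simpa using hs), dedekindZeta]
    simp [rI]
  rw [tendsto_nhds_unique t1 t3]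
  exact_mod_cast dedekindZeta_residue_ne_zero K
end MFP
end

section
namespace MFP
open Finset NumberField Filter Topology IsDedekindDomain
open scoped Classical
set_option linter.unusedSectionVars false

variable {K : Type*} [Field K] [NumberField K]

theorem euler_ideal (F : Ideal (𝓞 K) → ℂ) (h0 : F ⊥ = 0) (h1 : F 1 = 1) (hm : ∀ I J, F (I * J) = F I * F J)
    (hs : Summable fun I => ‖F I‖) (hv : ∀ v : HeightOneSpectrum (𝓞 K), ‖F v.asIdeal‖ ≤ 1/2) :
    ∑' I, F I = Complex.exp (∑' v : HeightOneSpectrum (𝓞 K), Complex.log (1 - F v.asIdeal)⁻¹) := by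
  set V := HeightOneSpectrum (𝓞 K)
  set Q : Finset V → Set (Ideal (𝓞 K)) := fun S => {I | ∀ v ∈ S, ¬ v.asIdeal ∣ I} with hQ
  have hsQ : ∀ A : Set (Ideal (𝓞 K)), Summable (A.indicator F) := fun A => hs.of_norm.indicator A
  have hprod : ∀ S : Finset V, (∏ v ∈ S, (1 - F v.asIdeal)) * ∑' I, F I = ∑' I, (Q S).indicator F I := by
    intro S
    induction S using Finset.induction_on with
    | empty => simp [hQ]
    | insert v S hvS ih =>
      rw [prod_insert hvS, mul_assoc, ih, sub_mul, one_mul]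
      have e1 : F v.asIdeal * ∑' I, (Q S).indicator F I = ∑' I, (Q S ∩ {I | v.asIdeal ∣ I}).indicator F I := by
        rw [← tsum_mul_left]
        have hinj : Function.Injective (fun I : Ideal (𝓞 K) => v.asIdeal * I) := fun I J h => mul_left_cancel₀ v.ne_bot h
        rw [← hinj.tsum_eq (f := (Q S ∩ {I | v.asIdeal ∣ I}).indicator F)]
        · refine tsum_congr fun I => ?_
          have : I ∈ Q S ↔ v.asIdeal * I ∈ Q S := by
            simp only [hQ, Set.mem_ofPred_eq]
            refine forall₂_congr fun w hw => not_congr ⟨fun h => h.mul_left _, fun h => ?_⟩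
            have hpr : Prime w.asIdeal := w.prime
            rcases hpr.dvd_or_dvd h with h | h
            · exfalso
              apply hvS
              have h2 : w.asIdeal = v.asIdeal := by
                exact (associated_iff_eq.1 (hpr.associated_of_dvd v.prime h))
              rwa [← (HeightOneSpectrum.ext h2 : w = v)]
            · exact h
          have e : v.asIdeal * I ∈ {J | v.asIdeal ∣ J} := Dvd.intro _ rfl
          by_cases hI : I ∈ Q S
          · rw [Set.indicator_of_mem hI, Set.indicator_of_mem (show v.asIdeal * I ∈ Q S ∩ {I | v.asIdeal ∣ I} from ⟨this.1 hI, e⟩), hm]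
          · rw [Set.indicator_of_notMem hI, Set.indicator_of_notMem (fun h => hI (this.2 h.1)), mul_zero]
        · intro I hI
          have := (Set.mem_of_indicator_ne_zero hI).2
          obtain ⟨J, rfl⟩ := this
          exact ⟨J, rfl⟩
      rw [e1, ← Summable.tsum_sub (hsQ _) (hsQ _)]
      refine tsum_congr fun I => ?_
      by_cases hI : I ∈ Q S <;> by_cases hvI : v.asIdeal ∣ I
      · rw [Set.indicator_of_mem hI, Set.indicator_of_mem (show I ∈ Q S ∩ {I | v.asIdeal ∣ I} from ⟨hI, hvI⟩), Set.indicator_of_notMem, sub_self]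
        intro h; exact h v (mem_insert_self _ _) hvI
      · rw [Set.indicator_of_mem hI, Set.indicator_of_notMem (fun h => hvI h.2), sub_zero, Set.indicator_of_mem]
        intro w hw
        rcases mem_insert.1 hw with rfl | hw
        · exact hvI
        · exact hI w hw
      all_goals
        rw [Set.indicator_of_notMem hI, Set.indicator_of_notMem (fun h => hI h.1), sub_zero, Set.indicator_of_notMem]
        exact fun h => hI fun w hw => h w (mem_insert_of_mem hw)
  have hlim : Tendsto (fun S => ∑' I, (Q S).indicator F I) atTop (𝓝 1) := by
    have e : (1:ℂ) = ∑' I : Ideal (𝓞 K), if I = 1 then (1:ℂ) else 0 := by rw [tsum_ite_eq]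
    rw [e]
    refine tendsto_tsum_of_dominated_convergence hs (fun I => ?_) (Eventually.of_forall fun S I => ?_)
    · by_cases hI : I = 1
      · refine tendsto_const_nhds.congr fun S => ?_
        rw [if_pos hI, Set.indicator_of_mem, hI, h1]
        intro v _ h
        rw [hI] at h
        exact v.prime.not_isUnit (isUnit_of_dvd_one h)
      · rw [if_neg hI]
        refine tendsto_const_nhds.congr' ?_
        by_cases hb : I = ⊥
        · refine Eventually.of_forall fun S => ?_
          dsimp only
          rw [hb, Set.indicator_apply, h0, ite_self]
        · obtain ⟨M, hM, hIM⟩ := Ideal.exists_le_maximal I (by rwa [← Ideal.one_eq_top])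
          let v : V := ⟨M, hM.isPrime, fun h => hb (le_bot_iff.1 (h ▸ hIM))⟩
          filter_upwards [eventually_ge_atTop {v}] with S hS
          rw [Set.indicator_of_notMem]
          intro h
          exact h v (hS (mem_singleton_self v)) (Ideal.dvd_iff_le.2 hIM)
    · rw [Set.indicator_apply]; split_ifs <;> simp
  have hne : ∀ v : V, 1 - F v.asIdeal ≠ 0 := fun v h => by
    have h2 := hv v
    rw [← sub_eq_zero.1 h] at h2; norm_num at h2
  have hsv : Summable fun v : V => ‖F v.asIdeal‖ :=
    hs.comp_injective (i := fun v : V => v.asIdeal) (fun v w h => HeightOneSpectrum.ext h)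
  have hlog : Summable fun v : V => Complex.log (1 - F v.asIdeal) := by
    refine Summable.of_norm_bounded (hsv.mul_left (3/2)) fun v => ?_
    have := Complex.norm_log_one_add_half_le_self (z := - F v.asIdeal) (by rw [norm_neg]; exact hv v)
    rwa [norm_neg, ← sub_eq_add_neg] at this
  have hexp : Tendsto (fun S : Finset V => ∏ v ∈ S, (1 - F v.asIdeal)) atTop (𝓝 (Complex.exp (∑' v : V, Complex.log (1 - F v.asIdeal)))) := by
    refine ((Complex.continuous_exp.tendsto _).comp hlog.hasSum).congr fun S => ?_
    simp only [Function.comp, Complex.exp_sum]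
    exact prod_congr rfl fun v _ => Complex.exp_log (hne v)
  have h2 := (hexp.mul_const (∑' I, F I)).congr hprod
  have h3 := tendsto_nhds_unique h2 hlim
  have h4 : ∑' v : V, Complex.log (1 - F v.asIdeal)⁻¹ = - ∑' v : V, Complex.log (1 - F v.asIdeal) := by
    rw [← tsum_neg]
    refine tsum_congr fun v => Complex.log_inv _ (Complex.slitPlane_arg_ne_pi ?_)
    rw [sub_eq_add_neg]
    exact Complex.mem_slitPlane_of_norm_lt_one (by rw [norm_neg]; linarith [hv v])
  rw [h4, Complex.exp_neg]
  exact eq_inv_of_mul_eq_one_right h3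

theorem exists_pv (v : HeightOneSpectrum (𝓞 K)) : ∃ p : ℕ, p.Prime ∧ (p : 𝓞 K) ∈ v.asIdeal ∧
    ((Ideal.absNorm v.asIdeal).Prime → p = Ideal.absNorm v.asIdeal) ∧
    (¬ (Ideal.absNorm v.asIdeal).Prime → p ^ 2 ≤ Ideal.absNorm v.asIdeal) ∧ 2 ≤ Ideal.absNorm v.asIdeal := by
  have : v.asIdeal.IsMaximal := v.isMaximal
  obtain ⟨p, n, hn, hp, hpp, h⟩ := Ideal.exists_prime_and_absNorm_eq_pow v.asIdeal
  refine ⟨p, hpp, hp, fun h1 => ?_, fun h1 => ?_, ?_⟩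
  · rw [h] at h1 ⊢
    rw [(Nat.Prime.eq_one_of_pow h1), pow_one]
  · rw [h]
    refine Nat.pow_le_pow_right hpp.pos ?_
    by_contra h2
    have : n = 1 := by omega
    rw [h, this, pow_one] at h1; exact h1 hpp
  · rw [h]
    exact hpp.two_le.trans (Nat.le_self_pow hn.ne' p)

theorem card_above {p : ℕ} (hp : p.Prime) (S : Finset (HeightOneSpectrum (𝓞 K))) (hS : ∀ v ∈ S, (p : 𝓞 K) ∈ v.asIdeal) :
    #S ≤ Module.finrank ℚ K := by
  have hinj : Set.InjOn (fun v : HeightOneSpectrum (𝓞 K) => v.asIdeal) S := fun v _ w _ h => HeightOneSpectrum.ext h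
  have h1 : ∏ v ∈ S, v.asIdeal ∣ Ideal.span {(p : 𝓞 K)} := by
    rw [← prod_image (f := fun I : Ideal (𝓞 K) => I) hinj]
    refine Finset.prod_primes_dvd _ (fun I hI => ?_) (fun I hI => ?_)
    · obtain ⟨v, _, rfl⟩ := mem_image.1 hI; exact v.prime
    · obtain ⟨v, hv, rfl⟩ := mem_image.1 hI
      exact Ideal.dvd_iff_le.2 ((Ideal.span_singleton_le_iff_mem _).2 (hS v hv))
  have h2 := map_dvd Ideal.absNorm h1
  rw [map_prod, Ideal.absNorm_span_singleton, Algebra.norm_natCast (R := ℤ) (S := 𝓞 K), RingOfIntegers.rank, Int.natAbs_pow, Int.natAbs_natCast] at h2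
  have h3 : p ^ #S ∣ ∏ v ∈ S, Ideal.absNorm v.asIdeal := by
    rw [← prod_const]
    refine prod_dvd_prod_of_dvd _ _ fun v hv => ?_
    obtain ⟨k, hk, e⟩ := (Nat.dvd_prime_pow hp).1 ((dvd_prod_of_mem _ hv).trans h2)
    rw [e]
    refine dvd_pow_self _ fun h0 => ?_
    obtain ⟨_, _, _, _, _, h2⟩ := exists_pv v
    rw [e, h0] at h2; norm_num at h2
  exact Nat.pow_dvd_pow_iff_le_right hp.one_lt |>.1 (h3.trans h2)

variable (K)
noncomputable def bK (n : ℕ) : ℝ := if n.Prime then Nat.card {v : HeightOneSpectrum (𝓞 K) // Ideal.absNorm v.asIdeal = n} else 0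
variable {K}

theorem bK_nonneg (n : ℕ) : 0 ≤ bK K n := by rw [bK]; split_ifs <;> positivity

theorem fin_v (n : ℕ) : Finite {v : HeightOneSpectrum (𝓞 K) // Ideal.absNorm v.asIdeal = n} := by
  have : Finite {I : Ideal (𝓞 K) // Ideal.absNorm I = n} := Ideal.finite_setOfPred_absNorm_eq n
  refine Finite.of_injective (fun v => (⟨v.1.asIdeal, v.2⟩ : {I : Ideal (𝓞 K) // Ideal.absNorm I = n})) fun v w h => ?_
  exact Subtype.ext (HeightOneSpectrum.ext (congrArg Subtype.val h))

theorem bK_le (n : ℕ) : bK K n ≤ Module.finrank ℚ K := by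
  rw [bK]; split_ifs with h
  · haveI := fin_v (K := K) n
    letI := Fintype.ofFinite {v : HeightOneSpectrum (𝓞 K) // Ideal.absNorm v.asIdeal = n}
    rw [Nat.card_eq_fintype_card]
    norm_cast
    rw [← card_univ, ← card_map (Function.Embedding.subtype _)]
    refine card_above h _ fun v hv => ?_
    obtain ⟨w, _, rfl⟩ := mem_map.1 hv
    have := Ideal.absNorm_mem w.1.asIdeal
    rwa [w.2] at this
  · positivity

variable (K)
noncomputable def pv (v : HeightOneSpectrum (𝓞 K)) : ℕ := (exists_pv v).choose
variable {K}

theorem summ_pv : Summable fun v : HeightOneSpectrum (𝓞 K) => (pv K v : ℝ)^(-(3/2) : ℝ) := by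
  have h32 : Summable fun n : ℕ => (n:ℝ)^(-(3/2) : ℝ) := Real.summable_nat_rpow.2 (by norm_num)
  refine summable_of_sum_le (c := Module.finrank ℚ K * ∑' n : ℕ, (n:ℝ)^(-(3/2) : ℝ)) (fun v => by positivity) fun S => ?_
  rw [← sum_fiberwise_of_maps_to (t := S.image (pv K)) (fun v hv => mem_image_of_mem _ hv)]
  have : ∀ p ∈ S.image (pv K), ∑ v ∈ S with pv K v = p, (pv K v : ℝ)^(-(3/2) : ℝ) ≤ Module.finrank ℚ K * (p:ℝ)^(-(3/2) : ℝ) := by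
    intro p hp
    rw [sum_congr rfl (g := fun _ => (p:ℝ)^(-(3/2) : ℝ)) fun v hv => by rw [(mem_filter.1 hv).2], sum_const, nsmul_eq_mul]
    obtain ⟨w, hw, rfl⟩ := mem_image.1 hp
    gcongr
    refine card_above (exists_pv w).choose_spec.1 _ fun v hv => ?_
    have := (exists_pv v).choose_spec.2.1
    have e : pv K v = pv K w := (mem_filter.1 hv).2
    change ((pv K v : ℕ) : 𝓞 K) ∈ _ at this
    rw [e] at this; exact this
  refine (sum_le_sum this).trans ?_
  rw [← mul_sum]
  gcongr
  exact h32.sum_le_tsum _ fun n _ => by positivity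
end MFP
end

section
namespace MFP
open Finset NumberField Filter Topology IsDedekindDomain
open scoped Classical
set_option linter.unusedSectionVars false

theorem hasSum_fiber {ι : Type*} (N : ι → ℕ) (hN : ∀ n, Finite {i // N i = n}) {f : ℕ → ℂ} {t : ℂ}
    (h : HasSum (fun i => f (N i)) t) : HasSum (fun n => (Nat.card {i // N i = n} : ℂ) * f n) t := by
  have h1 := h.tsum_fiberwise N
  refine Eq.subst (motive := fun q => HasSum q _) (funext fun n => ?_) h1
  have : Finite (N ⁻¹' {n}) := hN n
  letI := Fintype.ofFinite (N ⁻¹' {n})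
  rw [tsum_fintype, sum_congr rfl (g := fun _ => f n), sum_const, nsmul_eq_mul, card_univ, ← Nat.card_eq_fintype_card]
  · rfl
  · rintro ⟨I, rfl⟩ _; rfl

theorem lseries_fiber {ι : Type*} (N : ι → ℕ) (hN : ∀ n, Finite {i // N i = n}) (g : ℕ → ℂ) (hg : ∀ n, n ≠ 0 → g n = Nat.card {i // N i = n})
    {s t : ℂ} (hs : s ≠ 0) (h : HasSum (fun i => (N i : ℂ)^(-s)) t) : LSeries g s = t := by
  have h1 := hasSum_fiber N hN (f := fun n => (n : ℂ)^(-s)) h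
  rw [← h1.tsum_eq, LSeries]
  refine tsum_congr fun n => ?_
  rw [LSeries.term_def]
  split_ifs with h0
  · rw [h0, Nat.cast_zero, Complex.zero_cpow (neg_ne_zero.2 hs), mul_zero]
  · rw [hg n h0, Complex.cpow_neg, div_eq_mul_inv]

variable {K : Type*} [Field K] [NumberField K]

theorem norm_cpow_neg (n : ℕ) {s : ℂ} (hs : s.re ≠ 0) : ‖(n : ℂ)^(-s)‖ = (n:ℝ)^(-s.re) := by
  rcases Nat.eq_zero_or_pos n with rfl | h
  · have : s ≠ 0 := fun h => hs (by simp [h])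
    rw [Nat.cast_zero, Complex.zero_cpow (neg_ne_zero.2 this), Nat.cast_zero, Real.zero_rpow (neg_ne_zero.2 hs), norm_zero]
  · rw [Complex.norm_natCast_cpow_of_pos h, Complex.neg_re]

theorem ideal_summ {σ : ℝ} (hσ : 1 < σ) : Summable fun I : Ideal (𝓞 K) => (Ideal.absNorm I : ℝ)^(-σ) := by
  have h1 : Summable fun n : ℕ => rI K n * (n:ℝ)^(-σ) := by
    have := (rI_summ (K := K) (σ : ℂ) (by simpa using hσ)).norm
    refine this.congr fun n => ?_
    rw [LSeries.norm_term_eq]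
    split_ifs with h0
    · rw [h0, Nat.cast_zero, Real.zero_rpow (by linarith), mul_zero]
    · rw [Complex.norm_real, Real.norm_of_nonneg (rI_nonneg n), Complex.ofReal_re, Real.rpow_neg (by positivity), div_eq_mul_inv]
  refine summable_of_sum_le (c := ∑' n : ℕ, rI K n * (n:ℝ)^(-σ)) (fun v => by positivity) fun S => ?_
  rw [← sum_fiberwise_of_maps_to (t := S.image (fun I => Ideal.absNorm I)) (fun v hv => mem_image_of_mem _ hv)]
  refine le_trans (sum_le_sum (g := fun n : ℕ => rI K n * (n:ℝ)^(-σ)) fun n _ => ?_) (h1.sum_le_tsum _ fun n _ => mul_nonneg (rI_nonneg n) (by positivity))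
  rw [sum_congr rfl (g := fun _ => (n:ℝ)^(-σ)) fun v hv => by rw [(mem_filter.1 hv).2], sum_const, nsmul_eq_mul]
  gcongr
  rw [rI]
  have : Finite {I : Ideal (𝓞 K) // Ideal.absNorm I = n} := Ideal.finite_setOfPred_absNorm_eq n
  norm_cast
  rw [← Nat.card_eq_finsetCard]
  exact Nat.card_le_card_of_injective (fun I => (⟨I.1, (mem_filter.1 I.2).2⟩ : {I : Ideal (𝓞 K) // Ideal.absNorm I = n})) fun I J h => Subtype.ext (Subtype.mk.inj h)

noncomputable def Av (v : HeightOneSpectrum (𝓞 K)) (s : ℂ) : ℂ :=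
  Complex.log (1 - (Ideal.absNorm v.asIdeal : ℂ)^(-s))⁻¹ -
    if (Ideal.absNorm v.asIdeal).Prime then (Ideal.absNorm v.asIdeal : ℂ)^(-s) else 0

theorem rpow34 : (2:ℝ)^(-(3/4) : ℝ) ≤ 3/5 := by
  have h : ((2:ℝ)^(-(3/4) : ℝ))^4 = 1/8 := by
    rw [← Real.rpow_natCast, ← Real.rpow_mul (by norm_num)]; norm_num
  refine le_of_pow_le_pow_left₀ (n := 4) (by norm_num) (by norm_num) ?_
  rw [h]; norm_num

theorem norm_z {N : ℕ} (hN : 2 ≤ N) {s : ℂ} (hs : 3/4 ≤ s.re) : ‖(N : ℂ)^(-s)‖ ≤ (N:ℝ)^(-(3/4) : ℝ) ∧ ‖(N : ℂ)^(-s)‖ ≤ 3/5 := by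
  have h2 : (2:ℝ) ≤ N := by exact_mod_cast hN
  have h1 : ‖(N : ℂ)^(-s)‖ ≤ (N:ℝ)^(-(3/4) : ℝ) := by
    rw [norm_cpow_neg _ (by linarith)]
    exact Real.rpow_le_rpow_of_exponent_le (by linarith) (by linarith)
  refine ⟨h1, h1.trans (le_trans ?_ rpow34)⟩
  exact Real.rpow_le_rpow_of_nonpos (by norm_num) h2 (by norm_num)

theorem Av_bound (v : HeightOneSpectrum (𝓞 K)) {s : ℂ} (hs : 3/4 ≤ s.re) : ‖Av v s‖ ≤ 4 * (pv K v : ℝ)^(-(3/2) : ℝ) := by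
  obtain ⟨hp, -, h1, h2, hN⟩ := (exists_pv v).choose_spec
  change (pv K v).Prime at hp
  change _ → pv K v = _ at h1
  change _ → (pv K v)^2 ≤ _ at h2
  obtain ⟨b1, b2⟩ := norm_z hN hs
  rw [Av]
  set N := Ideal.absNorm v.asIdeal
  set z := (N : ℂ)^(-s)
  have h3 := Complex.norm_log_one_sub_inv_sub_self_le (z := z) (by linarith)
  have h4 : ‖z‖ ^ 2 * (1 - ‖z‖)⁻¹ / 2 ≤ 2 * ‖z‖^2 := by
    have : (1 - ‖z‖)⁻¹ ≤ 4 := by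
      rw [inv_le_comm₀ (by linarith) (by norm_num)]; linarith
    nlinarith [sq_nonneg ‖z‖]
  split_ifs with hpr
  · rw [h1 hpr]
    have : ‖z‖^2 ≤ (N:ℝ)^(-(3/2) : ℝ) := by
      calc _ ≤ ((N:ℝ)^(-(3/4) : ℝ))^2 := by gcongr
        _ = _ := by rw [← Real.rpow_natCast, ← Real.rpow_mul (by positivity)]; norm_num
    have : 0 ≤ (N:ℝ)^(-(3/2) : ℝ) := by positivity
    linarith
  · have h5 : ‖Complex.log (1 - z)⁻¹‖ ≤ 4 * ‖z‖ := by
      have := norm_sub_norm_le (Complex.log (1 - z)⁻¹) z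
      nlinarith [norm_nonneg z]
    rw [sub_zero]
    refine h5.trans ?_
    gcongr
    refine b1.trans ?_
    have hp0 : (0:ℝ) < pv K v := by exact_mod_cast hp.pos
    calc (N:ℝ)^(-(3/4) : ℝ) ≤ ((pv K v : ℝ)^2)^(-(3/4) : ℝ) :=
          Real.rpow_le_rpow_of_nonpos (by positivity) (by exact_mod_cast h2 hpr) (by norm_num)
      _ = _ := by rw [← Real.rpow_natCast, ← Real.rpow_mul hp0.le]; norm_num

theorem Av_diff (v : HeightOneSpectrum (𝓞 K)) {s : ℂ} (hs : 3/4 ≤ s.re) : DifferentiableAt ℂ (Av v) s := by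
  obtain ⟨hp, -, h1, h2, hN⟩ := (exists_pv v).choose_spec
  obtain ⟨b1, b2⟩ := norm_z hN hs
  unfold Av
  set N := Ideal.absNorm v.asIdeal
  have hN0 : (N : ℂ) ≠ 0 := by norm_cast; omega
  have hd : DifferentiableAt ℂ (fun s : ℂ => (N : ℂ)^(-s)) s :=
    DifferentiableAt.const_cpow differentiableAt_id.neg (Or.inl hN0)
  have hsl : 1 - (N : ℂ)^(-s) ∈ Complex.slitPlane := by
    rw [sub_eq_add_neg]; exact Complex.mem_slitPlane_of_norm_lt_one (by rw [norm_neg]; linarith)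
  refine DifferentiableAt.sub (DifferentiableAt.clog (DifferentiableAt.inv (hd.const_sub _) (Complex.slitPlane_ne_zero hsl)) ?_) ?_
  · rcases Complex.mem_slitPlane_iff.1 hsl with h | h
    · exact Complex.mem_slitPlane_iff.2 (Or.inl (by rw [Complex.inv_re]; exact div_pos h (Complex.normSq_pos.2 (Complex.slitPlane_ne_zero hsl))))
    · exact Complex.mem_slitPlane_iff.2 (Or.inr (by rw [Complex.inv_im]; exact div_ne_zero (neg_ne_zero.2 h) (Complex.normSq_pos.2 (Complex.slitPlane_ne_zero hsl)).ne'))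
  · split_ifs
    · exact hd
    · exact differentiableAt_const _

variable (K)
theorem zetaLike : ∃ (G : ℂ → ℂ) (δ : ℝ), ZetaLike (bK K) G δ := by
  obtain ⟨H, δ, hδ, hδ4, hd, ⟨C, A, hC, hg⟩, hH1, hH⟩ := zeta_ext K
  set As : ℂ → ℂ := fun s => ∑' v : HeightOneSpectrum (𝓞 K), Av v s with hAs
  set M : ℝ := ∑' v : HeightOneSpectrum (𝓞 K), 4 * (pv K v : ℝ)^(-(3/2) : ℝ)
  have hsp := (summ_pv (K := K)).mul_left 4
  have hsA : ∀ s : ℂ, 3/4 ≤ s.re → Summable fun v : HeightOneSpectrum (𝓞 K) => Av v s := fun s hs =>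
    Summable.of_norm_bounded hsp fun v => Av_bound v hs
  have hM : ∀ s : ℂ, 3/4 ≤ s.re → ‖As s‖ ≤ M := fun s hs =>
    tsum_of_norm_bounded hsp.hasSum fun v => Av_bound v hs
  have hAd : DifferentiableOn ℂ As {s | 1 - δ < s.re} := by
    refine Complex.differentiableOn_tsum_of_summable_norm hsp (fun v s hs => (Av_diff v ?_).differentiableWithinAt)
      (isOpen_lt continuous_const Complex.continuous_re) (fun v s hs => Av_bound v ?_)
    all_goals
      have : 1 - δ < s.re := hs
      linarith
  refine ⟨fun s => H s * Complex.exp (- As s), δ, bK_nonneg, ⟨_, bK_le⟩, hδ, by linarith, hd.mul hAd.neg.cexp,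
    ⟨C * Real.exp M, A, by positivity, fun s hs hs4 => ?_⟩, mul_ne_zero hH1 (Complex.exp_ne_zero _), fun s hs => ?_⟩
  · rw [norm_mul, mul_right_comm]
    gcongr
    · exact hg s hs
    · rw [Complex.norm_exp]
      refine Real.exp_le_exp.2 (((Complex.re_le_norm _).trans ?_))
      rw [norm_neg]; exact hM s (by linarith)
  · have hs0 : s ≠ 0 := fun h => by rw [h] at hs; norm_num at hs
    have hsum : Summable fun I : Ideal (𝓞 K) => ‖(Ideal.absNorm I : ℂ)^(-s)‖ :=
      (ideal_summ hs).congr fun I => (norm_cpow_neg _ (by linarith)).symm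
    have e1 := lseries_fiber (fun I : Ideal (𝓞 K) => Ideal.absNorm I) (fun n => Ideal.finite_setOfPred_absNorm_eq n)
      (fun n => (rI K n : ℂ)) (fun n _ => by simp [rI]) hs0 hsum.of_norm.hasSum
    have e2 := euler_ideal (fun I : Ideal (𝓞 K) => (Ideal.absNorm I : ℂ)^(-s)) (by simp [hs0]) (by simp)
      (fun I J => by rw [map_mul, Nat.cast_mul, Complex.natCast_mul_natCast_cpow]) hsum (fun v => by
        obtain ⟨_, _, _, _, _, hN⟩ := exists_pv v
        rw [norm_cpow_neg _ (by linarith)]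
        have : (2:ℝ) ≤ Ideal.absNorm v.asIdeal := by exact_mod_cast hN
        calc _ ≤ (2:ℝ)^(-s.re) := Real.rpow_le_rpow_of_nonpos (by norm_num) this (by linarith)
          _ ≤ (2:ℝ)^(-1:ℝ) := Real.rpow_le_rpow_of_exponent_le (by norm_num) (by linarith)
          _ = 1/2 := by rw [Real.rpow_neg_one]; norm_num)
    have hsv : Summable fun v : HeightOneSpectrum (𝓞 K) => ‖(Ideal.absNorm v.asIdeal : ℂ)^(-s)‖ :=
      hsum.comp_injective (i := fun v : HeightOneSpectrum (𝓞 K) => v.asIdeal) (fun v w h => HeightOneSpectrum.ext h)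
    have hsp' : Summable fun v : HeightOneSpectrum (𝓞 K) => if (Ideal.absNorm v.asIdeal).Prime then (Ideal.absNorm v.asIdeal : ℂ)^(-s) else 0 := by
      refine Summable.of_norm_bounded hsv fun v => ?_
      split_ifs <;> simp
    have e3 : LSeries (fun n => (bK K n : ℂ)) s = ∑' v : HeightOneSpectrum (𝓞 K), if (Ideal.absNorm v.asIdeal).Prime then (Ideal.absNorm v.asIdeal : ℂ)^(-s) else 0 := by
      have := hasSum_fiber (fun v : HeightOneSpectrum (𝓞 K) => Ideal.absNorm v.asIdeal) fin_v
        (f := fun n => if n.Prime then (n : ℂ)^(-s) else 0) hsp'.hasSum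
      rw [← this.tsum_eq, LSeries]
      refine tsum_congr fun n => ?_
      rw [LSeries.term_def, bK]
      by_cases hn : n.Prime
      · rw [if_neg hn.ne_zero, if_pos hn, if_pos hn, Complex.cpow_neg, div_eq_mul_inv]; simp
      · rw [if_neg hn, if_neg hn]; simp
    rw [hH s hs, e1, e2, mul_assoc, ← Complex.exp_add, e3]
    congr 2
    rw [← sub_eq_add_neg, sub_eq_iff_eq_add, hAs, ← Summable.tsum_add hsp' (hsA s (by linarith))]
    refine tsum_congr fun v => ?_
    rw [Av]; ring
end MFP
end

section
namespace MFP
open Finset NumberField Filter Topology IsDedekindDomain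
open scoped Classical
open Polynomial in
theorem card_v {K : Type*} [Field K] [NumberField K] (θ : 𝓞 K) (p : ℕ) [hpf : Fact p.Prime]
    (hp : ¬ p ∣ RingOfIntegers.exponent θ) :
    Nat.card {v : HeightOneSpectrum (𝓞 K) // Ideal.absNorm v.asIdeal = p} =
    Nat.card {t : ZMod p // (minpoly ℤ θ).eval₂ (Int.castRingHom (ZMod p)) t = 0} := by
  have hsur : ∀ φ : 𝓞 K →+* ZMod p, Function.Surjective φ := fun φ y => by
    obtain ⟨n, rfl⟩ := ZMod.natCast_zmod_surjective y
    exact ⟨n, map_natCast φ n⟩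
  have hev : ∀ (φ : 𝓞 K →+* ZMod p) (Q : ℤ[X]), φ (aeval θ Q) = Q.eval₂ (Int.castRingHom (ZMod p)) (φ θ) := by
    intro φ Q
    rw [aeval_def, hom_eval₂]; congr 1; exact RingHom.ext_int _ _
  obtain ⟨e, he⟩ : ∃ e : (ZMod p)[X] ⧸ Ideal.span {map (Int.castRingHom (ZMod p)) (minpoly ℤ θ)} ≃+* 𝓞 K ⧸ Ideal.span {(p : 𝓞 K)},
      ∀ Q : ℤ[X], e (Ideal.Quotient.mk _ (map (Int.castRingHom (ZMod p)) Q)) = Ideal.Quotient.mk _ (aeval θ Q) :=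
    ⟨_, RingOfIntegers.ZModXQuotSpanEquivQuotSpan_mk_apply hp⟩
  have f1 : Nat.card (𝓞 K →+* ZMod p) = Nat.card {t : ZMod p // (minpoly ℤ θ).eval₂ (Int.castRingHom (ZMod p)) t = 0} := by
    refine Nat.card_eq_of_bijective (fun φ => ⟨φ θ, by rw [← hev, minpoly.aeval, map_zero]⟩) ⟨?_, ?_⟩
    · intro φ ψ h
      have h : φ θ = ψ θ := congrArg Subtype.val h
      ext x
      obtain ⟨q, hq⟩ := Ideal.Quotient.mk_surjective (e.symm (Ideal.Quotient.mk _ x))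
      obtain ⟨Q, rfl⟩ := map_surjective _ (ZMod.ringHom_surjective (Int.castRingHom (ZMod p))) q
      have h2 := he Q
      rw [hq, e.apply_symm_apply] at h2
      rw [Ideal.Quotient.eq, Ideal.mem_span_singleton] at h2
      obtain ⟨y, hy⟩ := h2
      have h4 : ∀ χ : 𝓞 K →+* ZMod p, χ x = χ (aeval θ Q) := fun χ => by
        have := congrArg χ hy
        rw [map_sub, map_mul, map_natCast, CharP.cast_eq_zero, zero_mul, sub_eq_zero] at this
        exact this
      rw [h4, h4, hev, hev, h]
    · rintro ⟨t, ht⟩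
      let ψ : (ZMod p)[X] ⧸ Ideal.span {map (Int.castRingHom (ZMod p)) (minpoly ℤ θ)} →+* ZMod p :=
        Ideal.Quotient.lift _ (evalRingHom t) (by
          intro a ha
          rw [Ideal.mem_span_singleton] at ha
          obtain ⟨b, rfl⟩ := ha
          rw [coe_evalRingHom, eval_mul, eval_map, ht, zero_mul])
      refine ⟨(ψ.comp e.symm.toRingHom).comp (Ideal.Quotient.mk _), Subtype.ext ?_⟩
      have h2 := he X
      rw [aeval_X, map_X] at h2
      have h3 : e.symm (Ideal.Quotient.mk _ θ) = Ideal.Quotient.mk _ X := by rw [← h2]; exact e.symm_apply_apply _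
      change ψ (e.symm (Ideal.Quotient.mk _ θ)) = t
      rw [h3]; exact eval_X
  rw [← f1]
  have hcard : ∀ I : Ideal (𝓞 K), Ideal.absNorm I = Nat.card (𝓞 K ⧸ I) := fun I => rfl
  symm
  refine Nat.card_eq_of_bijective (fun φ => ⟨⟨RingHom.ker φ, RingHom.ker_isPrime φ, ?_⟩, ?_⟩) ⟨?_, ?_⟩
  · intro h
    have : (p : 𝓞 K) ∈ RingHom.ker φ := by rw [RingHom.mem_ker, map_natCast, CharP.cast_eq_zero]
    rw [h, Ideal.mem_bot] at this
    exact hpf.out.ne_zero (by exact_mod_cast this)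
  · change Ideal.absNorm (RingHom.ker φ) = p
    rw [hcard, Nat.card_congr (RingHom.quotientKerEquivOfSurjective (hsur φ)).toEquiv, Nat.card_zmod]
  · intro φ ψ h
    have h : RingHom.ker φ = RingHom.ker ψ := congrArg (fun v => v.1.asIdeal) h
    ext x
    obtain ⟨n, hn⟩ := ZMod.natCast_zmod_surjective (φ x)
    have h1 : x - n ∈ RingHom.ker φ := by rw [RingHom.mem_ker, map_sub, map_natCast, hn, sub_self]
    rw [h, RingHom.mem_ker, map_sub, map_natCast, hn, sub_eq_zero] at h1
    exact h1.symm
  · rintro ⟨v, hv⟩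
    have h1 : Nat.card (𝓞 K ⧸ v.asIdeal) = p := hv
    have : Finite (𝓞 K ⧸ v.asIdeal) := Nat.finite_of_card_ne_zero (by rw [h1]; exact hpf.out.ne_zero)
    let _ := Fintype.ofFinite (𝓞 K ⧸ v.asIdeal)
    rw [Nat.card_eq_fintype_card] at h1
    let r := ZMod.ringEquivOfPrime _ hpf.out h1
    refine ⟨r.symm.toRingHom.comp (Ideal.Quotient.mk _), Subtype.ext (HeightOneSpectrum.ext ?_)⟩
    ext x
    change r.symm (Ideal.Quotient.mk _ x) = 0 ↔ _
    rw [map_eq_zero_iff _ r.symm.injective, Ideal.Quotient.eq_zero_iff_mem]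
end MFP
end

section
namespace MFP
open Finset NumberField Filter Topology IsDedekindDomain
open scoped Classical
open Polynomial
theorem irreducible_data (g : ℤ[X]) (hg : Irreducible (g.map (Int.castRingHom ℚ))) :
    ∃ (b : ℕ → ℝ) (G : ℂ → ℂ) (δ : ℝ) (p0 : ℕ), ZetaLike b G δ ∧ (∀ n, ¬ n.Prime → b n = 0) ∧
    ∀ p : ℕ, p.Prime → p0 < p → b p = Nat.card {t : ZMod p // g.eval₂ (Int.castRingHom (ZMod p)) t = 0} := by
  let f := g.map (Int.castRingHom ℚ)
  have hfn : f ≠ 0 := hg.ne_zero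
  have : Fact (Irreducible f) := ⟨hg⟩
  let K := AdjoinRoot f
  have hinj : Function.Injective (Int.castRingHom ℚ) := Int.cast_injective
  have hdeg : f.natDegree = g.natDegree := natDegree_map_eq_of_injective hinj g
  have hd1 : 1 ≤ g.natDegree := by rw [← hdeg]; exact hg.natDegree_pos
  have hg0 : g ≠ 0 := by rintro rfl; simp at hd1
  let α : K := AdjoinRoot.root f
  set l := g.leadingCoeff with hl
  have hl0 : l ≠ 0 := leadingCoeff_ne_zero.2 hg0
  have hα : aeval α g = 0 := by
    have := AdjoinRoot.eval₂_root f
    rw [eval₂_map] at this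
    rw [aeval_def, ← this]; congr 1; 
  have hβ : IsIntegral ℤ (l • α) := isIntegral_leadingCoeff_smul g α hα
  let θ : 𝓞 K := ⟨l • α, hβ⟩
  have hβα : (l • α) = (l : ℚ) • α := by rw [Int.cast_smul_eq_zsmul]
  have hβQ : IsIntegral ℚ (l • α) := hβ.tower_top
  have htop : Algebra.adjoin ℚ {l • α} = ⊤ := by
    have h0 : Algebra.adjoin ℚ {α} = ⊤ := by
      have hal : (DivisionRing.toRatAlgebra : Algebra ℚ K) = AdjoinRoot.instAlgebra f := Subsingleton.elim _ _
      rw [hal]; exact AdjoinRoot.adjoinRoot_eq_top (f := f)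
    rw [← top_le_iff, ← h0]
    refine Algebra.adjoin_le ?_
    rintro _ rfl
    have h1 : (l:ℚ)⁻¹ • (l • α) ∈ Algebra.adjoin ℚ {l • α} :=
      Subalgebra.smul_mem _ (Algebra.self_mem_adjoin_singleton ℚ _) _
    rw [hβα, smul_smul, inv_mul_cancel₀ (by exact_mod_cast hl0), one_smul] at h1
    rw [hβα]; exact h1
  let B := PowerBasis.ofAdjoinEqTop hβQ htop
  have hgen : B.gen = l • α := PowerBasis.ofAdjoinEqTop_gen _ _
  -- exponent
  have hexp : RingOfIntegers.exponent θ ≠ 0 := by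
    rw [RingOfIntegers.exponent_eq_sInf]
    set D := Algebra.discr ℚ B.basis with hD
    have hD0 : D ≠ 0 := Algebra.discr_not_zero_of_basis ℚ B.basis
    have hmem : ({d : ℕ | 0 < d ∧ (d : 𝓞 K) ∈ conductor ℤ θ}).Nonempty := by
      refine ⟨D.num.natAbs, Int.natAbs_pos.2 (Rat.num_ne_zero.2 hD0), ?_⟩
      have h1 : (D.num : 𝓞 K) ∈ conductor ℤ θ := by
        rw [mem_conductor_iff]
        intro b
        have h2 : D • (b : K) ∈ Algebra.adjoin ℤ {B.gen} :=
          Algebra.discr_mul_isIntegral_mem_adjoin ℚ (by rw [hgen]; exact hβ) b.isIntegral_coe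
        rw [hgen] at h2
        have h3 := Subalgebra.smul_mem _ h2 (D.den : ℤ)
        have h4 : (D.den : ℤ) • D • (b : K) = ((D.num : 𝓞 K) * b : 𝓞 K) := by
          rw [← Int.cast_smul_eq_zsmul ℚ, smul_smul]
          push_cast
          have : (D.den : ℚ) * D = D.num := Rat.den_mul_eq_num D
          rw [this, Int.cast_smul_eq_zsmul, zsmul_eq_mul]; congr 1
        rw [h4] at h3
        have h5 : Algebra.adjoin ℤ {l • α} = (Algebra.adjoin ℤ {θ}).map (IsScalarTower.toAlgHom ℤ (𝓞 K) K) := by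
          rw [AlgHom.map_adjoin, Set.image_singleton]; rfl
        rw [h5] at h3
        obtain ⟨y, hy, hy2⟩ := h3
        rwa [← RingOfIntegers.coe_injective hy2]
      have h6 : ((D.num.natAbs : ℤ) : 𝓞 K) ∈ conductor ℤ θ := by
        rcases Int.natAbs_eq D.num with h | h
        · rwa [← h]
        · rw [eq_neg_iff_add_eq_zero, add_comm, ← eq_neg_iff_add_eq_zero] at h
          rw [h, Int.cast_neg]; exact neg_mem h1
      rwa [Int.cast_natCast] at h6
    exact (Nat.sInf_mem hmem).1.ne'
  have hmin : minpoly ℤ θ = integralNormalization g := by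
    have hm : (integralNormalization g).Monic := monic_integralNormalization hg0
    refine (eq_of_monic_of_dvd_of_natDegree_le (minpoly.monic θ.isIntegral) hm
      (minpoly.isIntegrallyClosed_dvd θ.isIntegral ?_) ?_).symm
    · refine RingOfIntegers.coe_injective ?_
      rw [← aeval_algebraMap_apply, map_zero]
      have h1 := integralNormalization_eval₂_leadingCoeff_mul hd1 (algebraMap ℤ K) α
      rw [← aeval_def, ← aeval_def, hα, mul_zero] at h1
      rw [← h1]; congr 2
      change l • α = _
      rw [zsmul_eq_mul]; rfl
    · rw [natDegree_integralNormalization]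
      have h1 : (minpoly ℤ θ).natDegree = (minpoly ℚ (l • α)).natDegree := by
        have : minpoly ℚ (l • α) = _ := minpoly.isIntegrallyClosed_eq_field_fractions ℚ K θ.isIntegral
        rw [this, natDegree_map_eq_of_injective]; exact Int.cast_injective
      have h2 := B.natDegree_minpoly
      rw [hgen, ← B.finrank] at h2
      have h3 : (minpoly ℚ α).natDegree = g.natDegree := by
        rw [← minpoly.eq_of_irreducible hg, natDegree_mul_C, hdeg]
        · simpa using hfn
        · exact (aeval_map_algebraMap ℚ α g).trans hα
      have h4 := minpoly.natDegree_le (A := ℚ) α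
      omega
  obtain ⟨G, δ, hZ⟩ := zetaLike K
  refine ⟨bK K, G, δ, max (RingOfIntegers.exponent θ) l.natAbs, hZ, fun n hn => if_neg hn, fun p hp hpp => ?_⟩
  have : Fact p.Prime := ⟨hp⟩
  have hpe : ¬ p ∣ RingOfIntegers.exponent θ := fun h =>
    absurd (Nat.le_of_dvd (Nat.pos_of_ne_zero hexp) h) (by omega)
  have hpl : (l : ZMod p) ≠ 0 := fun h => by
    rw [ZMod.intCast_zmod_eq_zero_iff_dvd, Int.natCast_dvd] at h
    exact absurd (Nat.le_of_dvd (Int.natAbs_pos.2 hl0) h) (by omega)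
  rw [bK, if_pos hp, card_v θ p hpe, hmin]
  congr 1
  symm
  have key : ∀ t : ZMod p, (integralNormalization g).eval₂ (Int.castRingHom (ZMod p)) (l * t) = l ^ (g.natDegree - 1) * g.eval₂ (Int.castRingHom (ZMod p)) t := fun t =>
    integralNormalization_eval₂_leadingCoeff_mul hd1 (Int.castRingHom (ZMod p)) t
  refine Nat.card_eq_of_bijective (fun t => ⟨l * t.1, by rw [key, t.2, mul_zero]⟩) ⟨?_, ?_⟩
  · intro t u h
    exact Subtype.ext (mul_left_cancel₀ hpl (congrArg Subtype.val h))
  · rintro ⟨u, hu⟩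
    have h1 : u = l * ((l:ZMod p)⁻¹ * u) := by rw [mul_inv_cancel_left₀ hpl]
    refine ⟨⟨(l:ZMod p)⁻¹ * u, ?_⟩, Subtype.ext h1.symm⟩
    rw [h1, key] at hu
    exact (mul_eq_zero.1 hu).resolve_left (pow_ne_zero _ hpl)
end MFP
end

section
namespace MFP
open Finset Filter
def InvGood (b : ℕ → ℝ) : Prop := (∀ n, 0 ≤ b n) ∧ (∃ B, ∀ n, b n ≤ B) ∧
  ∃ H : ℂ → ℂ, (∀ s : ℂ, 1 < s.re → H s = Complex.exp (-LSeries (fun n => (b n : ℂ)) s)) ∧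
  ∀ ε : ℝ, 0 < ε → ∃ c C : ℝ, 0 < c ∧ c ≤ 1/2 ∧ 0 < C ∧ ∀ (T : ℝ) (s : ℂ), 3 ≤ T → |s.im| ≤ T →
    1 - c / Real.log T ≤ s.re → s.re ≤ 2 → DifferentiableAt ℂ H s ∧ ‖H s‖ ≤ C * T^ε

theorem div_log_le {c T : ℝ} (hc : 0 < c) (hT : 3 ≤ T) : c / Real.log T ≤ c :=
  div_le_self hc.le (ZetaLike.one_le_log hT)

theorem lsum_of_bdd {b : ℕ → ℝ} (h0 : ∀ n, 0 ≤ b n) (hB : ∃ B, ∀ n, b n ≤ B) {s : ℂ} (hs : 1 < s.re) :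
    LSeriesSummable (fun n => (b n : ℂ)) s := by
  obtain ⟨B, hB⟩ := hB
  refine LSeriesSummable_of_bounded_of_one_lt_re (m := B) (fun n _ => ?_) hs
  rw [Complex.norm_real, Real.norm_of_nonneg (h0 n)]; exact hB n

theorem InvGood.of_zeta {b G δ} (h : ZetaLike b G δ) : InvGood b := by
  refine ⟨h.b_nonneg, h.b_bdd, fun s => (s - 1) / G s, fun s hs => ?_, fun ε hε => ?_⟩
  · have : s - 1 ≠ 0 := fun h0 => by
      rw [sub_eq_zero] at h0; rw [h0] at hs; simp at hs
    beta_reduce; rw [h.eq s hs, Complex.exp_neg, ← div_div, div_self this, one_div]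
  · obtain ⟨c, C, hc, hcδ, hC, H⟩ := h.inv_bound_left hε
    refine ⟨c, C, hc, by linarith [h.δ_le], hC, fun T s hT h1 h2 h3 => ?_⟩
    obtain ⟨h4, h5⟩ := H T s hT h1 h2 h3
    exact ⟨(differentiableAt_id.sub_const 1).div (h.diffAt (by linarith [div_log_le hc hT])) h4, h5⟩

theorem InvGood.zero : InvGood (fun _ => 0) := by
  refine ⟨fun _ => le_rfl, ⟨0, fun _ => le_rfl⟩, fun _ => 1, fun s _ => ?_, fun ε hε =>
    ⟨1/2, 1, by norm_num, by norm_num, by norm_num, fun T s hT _ _ _ => ⟨differentiableAt_const 1, ?_⟩⟩⟩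
  · have : (fun n : ℕ => ((0:ℝ):ℂ)) = 0 := by ext; simp
    rw [this, LSeries_zero]; simp
  · rw [norm_one, one_mul]; exact Real.one_le_rpow (by linarith) hε.le

theorem InvGood.add {b b'} (h : InvGood b) (h' : InvGood b') : InvGood (fun n => b n + b' n) := by
  obtain ⟨h0, hB, H, hH, hb⟩ := h
  obtain ⟨h0', hB', H', hH', hb'⟩ := h'
  refine ⟨fun n => add_nonneg (h0 n) (h0' n), ?_, fun s => H s * H' s, fun s hs => ?_, fun ε hε => ?_⟩
  · obtain ⟨B, hB⟩ := hB; obtain ⟨B', hB'⟩ := hB'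
    exact ⟨B + B', fun n => add_le_add (hB n) (hB' n)⟩
  · beta_reduce; rw [hH s hs, hH' s hs, ← Complex.exp_add, ← neg_add, ← LSeries_add (lsum_of_bdd h0 hB hs) (lsum_of_bdd h0' hB' hs)]
    congr 3; ext n; simp
  · obtain ⟨c, C, hc, hc2, hC, hh⟩ := hb (ε/2) (by linarith)
    obtain ⟨c', C', hc', hc2', hC', hh'⟩ := hb' (ε/2) (by linarith)
    refine ⟨min c c', C * C', lt_min hc hc', (min_le_left _ _).trans hc2, by positivity, fun T s hT h1 h2 h3 => ?_⟩
    have hl : 0 ≤ Real.log T := by linarith [ZetaLike.one_le_log hT]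
    obtain ⟨d1, d2⟩ := hh T s hT h1 (by linarith [div_le_div_of_nonneg_right (min_le_left c c') hl]) h3
    obtain ⟨d1', d2'⟩ := hh' T s hT h1 (by linarith [div_le_div_of_nonneg_right (min_le_right c c') hl]) h3
    refine ⟨d1.mul d1', ?_⟩
    rw [norm_mul]
    calc _ ≤ (C * T^(ε/2)) * (C' * T^(ε/2)) := by gcongr
      _ = C * C' * (T^(ε/2) * T^(ε/2)) := by ring
      _ = _ := by rw [← Real.rpow_add (by linarith), add_halves]

theorem term_diff (d : ℕ → ℂ) (n : ℕ) : Differentiable ℂ (fun s => LSeries.term d s n) := by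
  by_cases hn : n = 0
  · simp only [hn, LSeries.term_zero]; exact differentiable_const 0
  · simp only [LSeries.term_of_ne_zero hn]
    have hn' : (n:ℂ) ≠ 0 := by exact_mod_cast hn
    intro s
    exact (differentiableAt_const _).div (differentiableAt_id.const_cpow (Or.inl hn')) (by simp [Complex.cpow_eq_zero_iff, hn'])

theorem term_norm_le (d : ℕ → ℂ) (n : ℕ) {s : ℂ} (hs : 0 ≤ s.re) : ‖LSeries.term d s n‖ ≤ ‖d n‖ := by
  rw [LSeries.norm_term_eq]
  split_ifs with h
  · exact norm_nonneg _
  · exact div_le_self (norm_nonneg _) (Real.one_le_rpow (by exact_mod_cast Nat.pos_of_ne_zero h) hs)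

theorem InvGood.congr {b b'} (h : InvGood b) (h0' : ∀ n, 0 ≤ b' n) (n0 : ℕ) (hn : ∀ n, n0 < n → b n = b' n) :
    InvGood b' := by
  obtain ⟨h0, hB, H, hH, hb⟩ := h
  have hB' : ∃ B, ∀ n, b' n ≤ B := by
    obtain ⟨B, hB⟩ := hB
    refine ⟨B + ∑ n ∈ range (n0+1), b' n, fun n => ?_⟩
    have hS : 0 ≤ ∑ n ∈ range (n0+1), b' n := sum_nonneg fun n _ => h0' n
    rcases lt_or_ge n0 n with h | h
    · rw [← hn n h]; linarith [hB n]
    · have := single_le_sum (f := b') (fun n _ => h0' n) (mem_range.2 (by omega : n < n0+1))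
      linarith [hB 0, h0 0]
  let d : ℕ → ℂ := fun n => (b n : ℂ) - b' n
  let D : ℂ → ℂ := fun s => ∑ n ∈ range (n0+1), LSeries.term d s n
  refine ⟨h0', hB', fun s => H s * Complex.exp (D s), fun s hs => ?_, fun ε hε => ?_⟩
  · have h1 : LSeries d s = D s := tsum_eq_sum fun n hnn => by
      have : n0 < n := by simpa using hnn
      have hd : d n = 0 := by simp [d, hn n this]
      rw [LSeries.term_def, hd]; simp
    have h2 : LSeries d s = LSeries (fun n => (b n : ℂ)) s - LSeries (fun n => (b' n : ℂ)) s :=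
      LSeries_sub (lsum_of_bdd h0 hB hs) (lsum_of_bdd h0' hB' hs)
    beta_reduce; rw [← h1, h2, hH s hs, ← Complex.exp_add]; congr 1; ring
  · obtain ⟨c, C, hc, hc2, hC, hh⟩ := hb ε hε
    refine ⟨c, C * Real.exp (∑ n ∈ range (n0+1), ‖d n‖), hc, hc2, by positivity, fun T s hT h1 h2 h3 => ?_⟩
    obtain ⟨d1, d2⟩ := hh T s hT h1 h2 h3
    have hre : 0 ≤ s.re := by linarith [div_log_le hc hT]
    refine ⟨d1.mul (DifferentiableAt.cexp (DifferentiableAt.fun_sum fun n _ => (term_diff d n) s)), ?_⟩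
    rw [norm_mul]
    have h4 : ‖Complex.exp (D s)‖ ≤ Real.exp (∑ n ∈ range (n0+1), ‖d n‖) :=
      (Complex.norm_exp_le_exp_norm _).trans (Real.exp_le_exp.2 ((norm_sum_le _ _).trans (sum_le_sum fun n _ => term_norm_le d n hre)))
    calc _ ≤ (C * T^ε) * Real.exp (∑ n ∈ range (n0+1), ‖d n‖) := by gcongr
      _ = _ := by ring
end MFP
end

section
namespace MFP
open Finset Filter
open Polynomial
noncomputable def rc (Q : ℤ[X]) (n : ℕ) : ℝ :=
  open scoped Classical in if n.Prime then (Nat.card {t : ZMod n // Q.eval₂ (Int.castRingHom (ZMod n)) t = 0} : ℝ) else 0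

theorem rc_nonneg (Q : ℤ[X]) (n : ℕ) : 0 ≤ rc Q n := by
  unfold rc; split_ifs <;> positivity

theorem clear_den (h : ℚ[X]) : ∃ (c : ℤ) (g : ℤ[X]), c ≠ 0 ∧ g.map (Int.castRingHom ℚ) = C (c:ℚ) * h := by
  obtain ⟨b, hb, h1⟩ := IsLocalization.integerNormalization_spec (nonZeroDivisors ℤ) h
  refine ⟨b, _, nonZeroDivisors.ne_zero hb, h1.trans ?_⟩
  rw [← Int.cast_smul_eq_zsmul ℚ, smul_eq_C_mul]

theorem cast_ne {p : ℕ} {l : ℤ} (hl0 : l ≠ 0) (h1 : l.natAbs < p) : (l : ZMod p) ≠ 0 := fun h => by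
  rw [ZMod.intCast_zmod_eq_zero_iff_dvd, Int.natCast_dvd] at h
  exact absurd (Nat.le_of_dvd (Int.natAbs_pos.2 hl0) h) (by omega)

theorem inj_map : Function.Injective (Polynomial.map (Int.castRingHom ℚ)) :=
  map_injective _ Int.cast_injective

theorem rc_mul (Q g q : ℤ[X]) (e N : ℤ) (u v : ℤ[X]) (he : e ≠ 0) (hN : N ≠ 0) (h1 : C e * Q = g * q) (h2 : u * g + v * q = C N) (n : ℕ)
    (hn : max e.natAbs N.natAbs < n) : rc g n + rc q n = rc Q n := by
  unfold rc
  split_ifs with hp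
  swap
  · simp
  have : Fact n.Prime := ⟨hp⟩
  have he' : (e : ZMod n) ≠ 0 := cast_ne he (by omega)
  have hN' : (N : ZMod n) ≠ 0 := cast_ne hN (by omega)
  set R := Int.castRingHom (ZMod n)
  have k1 : ∀ t, (e : ZMod n) * Q.eval₂ R t = g.eval₂ R t * q.eval₂ R t := fun t => by
    have := congrArg (eval₂ R t) h1
    rwa [eval₂_mul, eval₂_mul, eval₂_C] at this
  have k2 : ∀ t, u.eval₂ R t * g.eval₂ R t + v.eval₂ R t * q.eval₂ R t = N := fun t => by
    have := congrArg (eval₂ R t) h2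
    rwa [eval₂_add, eval₂_mul, eval₂_mul, eval₂_C] at this
  classical
  norm_cast
  rw [Nat.card_eq_fintype_card, Nat.card_eq_fintype_card, Nat.card_eq_fintype_card, Fintype.card_subtype,
    Fintype.card_subtype, Fintype.card_subtype, ← card_union_of_disjoint]
  · congr 1
    ext t
    simp only [mem_union, mem_filter, mem_univ, true_and]
    rw [← mul_eq_zero, ← k1, mul_eq_zero, or_iff_right he']
  · rw [disjoint_left]
    intro t ha hb
    simp only [mem_filter, mem_univ, true_and] at ha hb
    have := k2 t
    rw [ha, hb, mul_zero, mul_zero, add_zero] at this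
    exact hN' this.symm

theorem rc_good : ∀ (k : ℕ) (Q : ℤ[X]), Q.natDegree ≤ k → (Q.map (Int.castRingHom ℚ)).Separable → InvGood (rc Q) := by
  intro k
  induction k with
  | zero =>
    intro Q hQ hs
    obtain ⟨c, rfl⟩ := natDegree_eq_zero.1 (Nat.le_zero.1 hQ)
    have hc : c ≠ 0 := fun h => not_separable_zero (by rwa [h, C_0, Polynomial.map_zero] at hs)
    refine InvGood.zero.congr (rc_nonneg _) c.natAbs fun n hn => ?_
    unfold rc
    split_ifs with hp
    · have : IsEmpty {t : ZMod n // (C c).eval₂ (Int.castRingHom (ZMod n)) t = 0} :=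
        ⟨fun t => cast_ne hc hn (by have := t.2; rwa [eval₂_C] at this)⟩
      rw [Nat.card_of_isEmpty]; simp
    · rfl
  | succ k ih =>
    intro Q hQ hs
    rcases Nat.lt_or_ge Q.natDegree (k+1) with hk | hk
    · exact ih Q (by omega) hs
    have hdeg : (Q.map (Int.castRingHom ℚ)).natDegree = Q.natDegree := natDegree_map_eq_of_injective Int.cast_injective Q
    obtain ⟨h, hirr, r, hr⟩ := exists_irreducible_of_natDegree_pos (f := Q.map (Int.castRingHom ℚ)) (by omega)
    rw [hr] at hs
    have hcop := hs.isCoprime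
    obtain ⟨c, g, hc, hg⟩ := clear_den h
    obtain ⟨d, q, hd, hq⟩ := clear_den r
    have hc' : (c:ℚ) ≠ 0 := by exact_mod_cast hc
    have hd' : (d:ℚ) ≠ 0 := by exact_mod_cast hd
    have hcu : IsUnit (C (c:ℚ)) := isUnit_C.2 hc'.isUnit
    have hdu : IsUnit (C (d:ℚ)) := isUnit_C.2 hd'.isUnit
    have hr0 : r ≠ 0 := by rintro rfl; rw [mul_zero] at hs; exact not_separable_zero hs
    have hCz : ∀ z : ℤ, C (Int.castRingHom ℚ z) = C (z : ℚ) := fun z => rfl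
    have h1 : C (c * d) * Q = g * q := inj_map (by
      rw [Polynomial.map_mul, Polynomial.map_mul, hg, hq, hr, Polynomial.map_C]
      simp only [hCz, Int.cast_mul, C_mul]; ring)
    have hcop2 : IsCoprime (g.map (Int.castRingHom ℚ)) (q.map (Int.castRingHom ℚ)) := by
      rw [hg, hq, isCoprime_mul_unit_left_left hcu, isCoprime_mul_unit_left_right hdu]; exact hcop
    obtain ⟨u, v, huv⟩ := hcop2
    obtain ⟨m, u', hm, hu⟩ := clear_den u
    obtain ⟨m', v', hm', hv⟩ := clear_den v
    have h2 : (C m' * u') * g + (C m * v') * q = C (m * m') := inj_map (by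
      simp only [Polynomial.map_add, Polynomial.map_mul, Polynomial.map_C, hu, hv, hCz, Int.cast_mul, C_mul]
      linear_combination (C (m:ℚ) * C (m':ℚ)) * huv)
    have hgirr : Irreducible (g.map (Int.castRingHom ℚ)) := by
      rw [hg]; exact (irreducible_isUnit_mul hcu).2 hirr
    have hqd : q.natDegree ≤ k := by
      have e1 : q.natDegree = r.natDegree := by
        rw [← natDegree_map_eq_of_injective (f := Int.castRingHom ℚ) Int.cast_injective q, hq, natDegree_C_mul hd']
      have e2 := natDegree_mul hirr.ne_zero hr0
      rw [← hr] at e2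
      have := hirr.natDegree_pos
      omega
    have hqs : (q.map (Int.castRingHom ℚ)).Separable := by
      rw [hq]; exact (hs.of_mul_right).unit_mul hdu
    obtain ⟨b, G, δ, p0, hZ, hb0, hb⟩ := irreducible_data g hgirr
    have hgg : InvGood (rc g) := (InvGood.of_zeta hZ).congr (rc_nonneg _) p0 fun n hn => by
      unfold rc
      split_ifs with hp
      · exact hb n hp hn
      · exact hb0 n hp
    exact (hgg.add (ih q hqd hqs)).congr (rc_nonneg _) _ (rc_mul Q g q (c*d) (m*m') _ _ (mul_ne_zero hc hd) (mul_ne_zero hm hm') h1 h2)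
end MFP
end

section
namespace MFP
open Finset Filter Topology

theorem w_bound {B : ℝ} {z : ℂ} (hz : ‖z‖ ≤ B) : ‖(1 - z) * Complex.exp z - 1‖ ≤ (1 + (1 + B) * Real.exp B) * ‖z‖^2 := by
  have h := Complex.norm_exp_sub_sum_le_norm_mul_exp z 2
  simp only [sum_range_succ, range_zero, sum_empty, zero_add, pow_zero, Nat.factorial_zero, Nat.cast_one, div_one, pow_one, Nat.factorial_one] at h
  have e : (1 - z) * Complex.exp z - 1 = -z^2 + (1 - z) * (Complex.exp z - (1 + z)) := by ring
  have h1 : ‖1 - z‖ ≤ 1 + B := (norm_sub_le _ _).trans (by rw [norm_one]; linarith)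
  rw [e]
  refine (norm_add_le _ _).trans ?_
  rw [norm_neg, norm_pow, norm_mul]
  have hB : 0 ≤ B := (norm_nonneg z).trans hz
  calc _ ≤ ‖z‖^2 + (1+B) * (‖z‖^2 * Real.exp B) := by
        gcongr
        exact h.trans (by gcongr)
    _ = _ := by ring

theorem E_exists {b : ℕ → ℝ} (h0 : ∀ n, 0 ≤ b n) (hB : ∃ B, ∀ n, b n ≤ B) :
    ∃ (E : ℂ → ℂ) (C : ℝ), 0 < C ∧ DifferentiableOn ℂ E {s | 3/4 < s.re} ∧ (∀ s : ℂ, 3/4 < s.re → ‖E s‖ ≤ C) ∧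
    ∀ s : ℂ, 3/4 < s.re → HasProd (fun n => (1 - LSeries.term (fun n => (b n : ℂ)) s n) *
      Complex.exp (LSeries.term (fun n => (b n : ℂ)) s n)) (E s) := by
  obtain ⟨B, hB⟩ := hB
  have hB0 : 0 ≤ B := (h0 0).trans (hB 0)
  let z : ℕ → ℂ → ℂ := fun n s => LSeries.term (fun n => (b n : ℂ)) s n
  let w : ℕ → ℂ → ℂ := fun n s => (1 - z n s) * Complex.exp (z n s) - 1
  let M := (1 + (1 + B) * Real.exp B) * B^2
  let u : ℕ → ℝ := fun n => M * (1 / (n:ℝ)^((3:ℝ)/2))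
  have hu : Summable u := (Real.summable_one_div_nat_rpow.2 (by norm_num)).mul_left M
  have hUo : IsOpen {s : ℂ | 3/4 < s.re} := isOpen_lt continuous_const Complex.continuous_re
  have hbn : ∀ n, ‖(b n : ℂ)‖ ≤ B := fun n => by rw [Complex.norm_real, Real.norm_of_nonneg (h0 n)]; exact hB n
  have hw : ∀ n (s : ℂ), 3/4 < s.re → ‖w n s‖ ≤ u n := fun n s hs => by
    have h1 : ‖z n s‖ ≤ B := (term_norm_le _ n (by linarith)).trans (hbn n)
    have h2 : ‖z n s‖^2 ≤ B^2 * (1 / (n:ℝ)^((3:ℝ)/2)) := by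
      simp only [z]
      rw [LSeries.norm_term_eq]
      split_ifs with hn
      · rw [zero_pow two_ne_zero]; positivity
      · have hn1 : (1:ℝ) ≤ n := by exact_mod_cast Nat.pos_of_ne_zero hn
        have : ((n:ℝ)^((3:ℝ)/4))^2 = (n:ℝ)^((3:ℝ)/2) := by
          rw [← Real.rpow_natCast, ← Real.rpow_mul (by linarith)]; norm_num
        rw [← this, mul_one_div, ← div_pow]
        have h3 : (n:ℝ)^((3:ℝ)/4) ≤ (n:ℝ)^s.re := Real.rpow_le_rpow_of_exponent_le hn1 hs.le
        gcongr
        exact hbn n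
    refine (w_bound h1).trans ?_
    calc _ ≤ (1 + (1 + B) * Real.exp B) * (B^2 * (1 / (n:ℝ)^((3:ℝ)/2))) := by gcongr
      _ = _ := by simp only [u, M]; ring
  have hwd : ∀ n, Differentiable ℂ (w n) := fun n =>
    (((differentiable_const _).sub (term_diff _ n)).mul (term_diff _ n).cexp).sub_const 1
  have hprod := Summable.hasProdLocallyUniformlyOn_nat_one_add (f := w) hUo hu
    (Eventually.of_forall fun n s hs => hw n s hs) (fun n => (hwd n).continuous.continuousOn)
  have hP : ∀ s : ℂ, 3/4 < s.re → HasProd (fun n => 1 + w n s) (∏' n, (1 + w n s)) := fun s hs => hprod.hasProd hs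
  refine ⟨fun s => ∏' n, (1 + w n s), Real.exp (∑' n, u n), Real.exp_pos _, ?_, fun s hs => ?_, fun s hs => ?_⟩
  · refine (hasProdLocallyUniformlyOn_iff_tendstoLocallyUniformlyOn.1 hprod).differentiableOn (Eventually.of_forall fun S => ?_) hUo
    exact DifferentiableOn.fun_finsetProd fun i _ => ((differentiable_const _).add (hwd i)).differentiableOn
  · refine le_of_tendsto (hP s hs).norm (Eventually.of_forall fun S => ?_)
    calc _ ≤ ∏ n ∈ S, Real.exp (u n) := prod_le_prod (fun _ _ => norm_nonneg _) fun n _ => by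
          refine (norm_add_le _ _).trans ?_
          rw [norm_one, add_comm]
          linarith [hw n s hs, Real.add_one_le_exp (u n)]
      _ = Real.exp (∑ n ∈ S, u n) := (Real.exp_sum _ _).symm
      _ ≤ _ := Real.exp_le_exp.2 (hu.sum_le_tsum _ fun n _ => (norm_nonneg _).trans (hw n (1:ℂ) (by norm_num)))
  · have := hP s hs
    simpa only [w, z, add_sub_cancel] using this

theorem euler_eq {a b : ℕ → ℝ} (a0 : a 0 = 0) (a1 : a 1 = 1) (amul : ∀ m n : ℕ, m.Coprime n → a (m * n) = a m * a n)
    (ap : ∀ p : ℕ, p.Prime → a p = -b p) (app : ∀ (p e : ℕ), p.Prime → 2 ≤ e → a (p^e) = 0)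
    (hb : ∀ n, ¬ n.Prime → b n = 0) {s : ℂ} (hs : LSeriesSummable (fun n => (a n : ℂ)) s) :
    HasProd (fun n => 1 - LSeries.term (fun n => (b n : ℂ)) s n) (LSeries (fun n => (a n : ℂ)) s) := by
  let f : ℕ → ℂ := fun n => LSeries.term (fun n => (a n : ℂ)) s n
  have hf1 : f 1 = 1 := by simp [f, LSeries.term_def, a1]
  have hmul : ∀ {m n : ℕ}, m.Coprime n → f (m * n) = f m * f n := fun {m n} h => by
    simp only [f, LSeries.term_def]
    by_cases hm : m = 0
    · simp [hm]
    by_cases hn : n = 0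
    · simp [hn]
    rw [if_neg (mul_ne_zero hm hn), if_neg hm, if_neg hn, amul m n h]
    push_cast
    rw [Complex.natCast_mul_natCast_cpow, mul_div_mul_comm]
  have hE := EulerProduct.eulerProduct_hasProd hf1 (fun {m n} h => hmul h) hs.norm (LSeries.term_zero _ _)
  have hloc : ∀ p : Nat.Primes, ∑' e : ℕ, f ((p:ℕ)^e) = 1 - LSeries.term (fun n => (b n : ℂ)) s (p:ℕ) := fun p => by
    rw [tsum_eq_sum (s := range 2) fun e he => ?_]
    · rw [sum_range_succ, sum_range_one, pow_zero, pow_one, hf1]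
      simp only [f, LSeries.term_of_ne_zero p.2.ne_zero, ap p p.2]
      push_cast; ring
    · simp only [f, LSeries.term_def, app p e p.2 (not_lt.1 fun h => he (mem_range.2 h))]; simp
  simp only [hloc] at hE
  have := (hasProd_subtype_iff_of_mulSupport_subset (s := {p : ℕ | p.Prime}) (f := fun n => 1 - LSeries.term (fun n => (b n : ℂ)) s n) ?_).1 hE
  · exact this
  · intro n hn
    by_contra hnp
    refine hn ?_
    simp only [LSeries.term_def, hb n hnp]; simp

theorem perron_of {a b : ℕ → ℝ} {k : ℕ} (hg : InvGood b) (a0 : a 0 = 0) (a1 : a 1 = 1) (amul : ∀ m n : ℕ, m.Coprime n → a (m * n) = a m * a n)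
    (ap : ∀ p : ℕ, p.Prime → a p = -b p) (app : ∀ (p e : ℕ), p.Prime → 2 ≤ e → a (p^e) = 0)
    (hb : ∀ n, ¬ n.Prime → b n = 0) {C₁ : ℝ}
    (hs1 : ∀ σ : ℝ, 1 < σ → σ ≤ 2 → Summable (fun n : ℕ => |a n| * (n:ℝ)^(-σ)) ∧ ∑' n : ℕ, |a n| * (n:ℝ)^(-σ) ≤ C₁ / (σ-1)^k)
    (hs2 : ∀ σ : ℝ, 1 < σ → σ ≤ 2 → Summable (fun n : ℕ => (a n)^2 * (n:ℝ)^(-σ)) ∧ ∑' n : ℕ, (a n)^2 * (n:ℝ)^(-σ) ≤ C₁ / (σ-1)^k) :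
    ∃ F c₀ C₀, PerronData a F c₀ C₀ k := by
  obtain ⟨h0, hB, H, hH, hbd⟩ := hg
  obtain ⟨E, C, hC, hEd, hEb, hEp⟩ := E_exists h0 hB
  obtain ⟨c, C', hc, hc2, hC', hh⟩ := hbd (1/2) (by norm_num)
  refine ⟨fun s => H s * E s, min c (1/8), max (C' * C) C₁, lt_min hc (by norm_num), (min_le_left _ _).trans hc2,
    lt_max_of_lt_left (by positivity), fun T s hT h1 h2 h3 => ?_, fun s hs => ?_, fun σ h1 h2 => ?_, fun σ h1 h2 => ?_⟩
  · have hl : 0 ≤ Real.log T := by linarith [ZetaLike.one_le_log hT]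
    obtain ⟨d1, d2⟩ := hh T s hT h1 (by linarith [div_le_div_of_nonneg_right (min_le_left c (1/8)) hl]) h3
    have hre : 3/4 < s.re := by
      linarith [div_log_le (lt_min hc (by norm_num : (0:ℝ) < 1/8)) hT, min_le_right c (1/8)]
    refine ⟨d1.mul ((hEd s hre).differentiableAt ((isOpen_lt continuous_const Complex.continuous_re).mem_nhds hre)), ?_⟩
    rw [norm_mul]
    have hT0 : 0 ≤ T^((1:ℝ)/2) := by positivity
    calc _ ≤ (C' * T^((1:ℝ)/2)) * C := by gcongr; exact hEb s hre
      _ = (C' * C) * T^((1:ℝ)/2) := by ring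
      _ ≤ _ := by gcongr; exact le_max_left _ _
  · have hsum : LSeriesSummable (fun n => (a n : ℂ)) s := by
      have h1 := (hs1 (min s.re 2) (lt_min hs (by norm_num)) (min_le_right _ _)).1
      refine LSeriesSummable.of_re_le_re (s := ((min s.re 2 : ℝ) : ℂ)) (by simp) ?_
      refine Summable.of_norm (h1.congr fun n => ?_)
      rw [LSeries.norm_term_eq]
      split_ifs with hn
      · simp [hn, a0]
      · rw [Complex.norm_real, Real.norm_eq_abs, Complex.ofReal_re, Real.rpow_neg (by positivity), div_eq_mul_inv]
    have p1 := euler_eq a0 a1 amul ap app hb hsum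
    have p2 := hEp s (by linarith)
    have p3 := (lsum_of_bdd h0 hB hs).hasSum.neg.cexp
    have p4 := p2.mul p3
    rw [hH s hs, mul_comm]
    refine p4.unique ?_ 
    convert p1 using 2 with n
    simp only [Function.comp_apply]
    rw [mul_assoc, ← Complex.exp_add, add_neg_cancel, Complex.exp_zero, mul_one]
  · have : 0 < (σ-1)^k := pow_pos (by linarith) k
    exact ⟨(hs1 σ h1 h2).1, (hs1 σ h1 h2).2.trans (by gcongr; exact le_max_right _ _)⟩
  · have : 0 < (σ-1)^k := pow_pos (by linarith) k
    exact ⟨(hs2 σ h1 h2).1, (hs2 σ h1 h2).2.trans (by gcongr; exact le_max_right _ _)⟩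
end MFP
end

section
namespace MFP
open Finset Filter Topology

theorem zeta_real {σ : ℝ} (h1 : 1 < σ) (h2 : σ ≤ 2) : ∑' n : ℕ, 1 / (n:ℝ)^σ ≤ 2 / (σ - 1) := by
  have h := ZetaAsymptotics.zeta_limit_aux1 h1
  rw [(Real.summable_one_div_nat_rpow.2 h1).tsum_eq_zero_add]
  simp only [Nat.cast_zero, Real.zero_rpow (by linarith : σ ≠ 0), div_zero, zero_add, Nat.cast_add, Nat.cast_one]
  have h3 : 0 ≤ ZetaAsymptotics.termTSum σ := tsum_nonneg fun n => ZetaAsymptotics.term_nonneg _ _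
  have h4 : 1 ≤ 1 / (σ - 1) := by rw [le_div_iff₀ (by linarith)]; linarith
  have h5 : 2 / (σ - 1) = 1/(σ-1) + 1/(σ-1) := by ring
  nlinarith

theorem dk_L (k : ℕ) {σ : ℝ} (h1 : 1 < σ) (h2 : σ ≤ 2) :
    LSeriesSummable (fun n => ((ArithmeticFunction.zeta^(k+1) : ArithmeticFunction ℕ) : ArithmeticFunction ℂ) n) (σ:ℂ) ∧
    ‖LSeries (fun n => ((ArithmeticFunction.zeta^(k+1) : ArithmeticFunction ℕ) : ArithmeticFunction ℂ) n) (σ:ℂ)‖ ≤ (2/(σ-1))^(k+1) := by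
  have hz : LSeriesSummable (fun n => ((ArithmeticFunction.zeta : ArithmeticFunction ℕ) : ArithmeticFunction ℂ) n) (σ:ℂ) :=
    ArithmeticFunction.LSeriesSummable_zeta_iff.2 (by simpa using h1)
  have hzb : ‖LSeries (fun n => ((ArithmeticFunction.zeta : ArithmeticFunction ℕ) : ArithmeticFunction ℂ) n) (σ:ℂ)‖ ≤ 2/(σ-1) := by
    refine (norm_tsum_le_tsum_norm hz.norm).trans (le_trans (hz.norm.tsum_le_tsum (fun n => ?_) (Real.summable_one_div_nat_rpow.2 h1)) (zeta_real h1 h2))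
    rw [LSeries.norm_term_eq]
    split_ifs with hn
    · positivity
    · simp [hn]
  induction k with
  | zero => simpa only [zero_add, pow_one] using ⟨hz, hzb⟩
  | succ k ih =>
    rw [pow_succ (ArithmeticFunction.zeta : ArithmeticFunction ℕ), ArithmeticFunction.natCoe_mul]
    refine ⟨ArithmeticFunction.LSeriesSummable_mul ih.1 hz, ?_⟩
    rw [ArithmeticFunction.LSeries_mul' ih.1 hz, norm_mul, pow_succ (2/(σ-1))]
    have : 0 < 2/(σ-1) := div_pos (by norm_num) (by linarith)
    gcongr
    exact ih.2

theorem dk_real (k : ℕ) {σ : ℝ} (h1 : 1 < σ) (h2 : σ ≤ 2) :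
    Summable (fun n : ℕ => (((ArithmeticFunction.zeta^(k+1) : ArithmeticFunction ℕ) n : ℕ) : ℝ) * (n:ℝ)^(-σ)) ∧
    ∑' n : ℕ, (((ArithmeticFunction.zeta^(k+1) : ArithmeticFunction ℕ) n : ℕ) : ℝ) * (n:ℝ)^(-σ) ≤ 2^(k+1) / (σ-1)^(k+1) := by
  obtain ⟨ha, hb⟩ := dk_L k h1 h2
  have e : ∀ n : ℕ, LSeries.term (fun n => ((ArithmeticFunction.zeta^(k+1) : ArithmeticFunction ℕ) : ArithmeticFunction ℂ) n) (σ:ℂ) n =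
      (((((ArithmeticFunction.zeta^(k+1) : ArithmeticFunction ℕ) n : ℕ) : ℝ) * (n:ℝ)^(-σ) : ℝ) : ℂ) := fun n => by
    rw [LSeries.term_def]
    split_ifs with hn
    · simp [hn]
    · rw [Real.rpow_neg (by positivity), Complex.ofReal_mul, Complex.ofReal_inv, Complex.ofReal_cpow (by positivity), div_eq_mul_inv]
      simp
  rw [LSeriesSummable, funext e] at ha
  unfold LSeries at hb
  rw [funext e, ← Complex.ofReal_tsum, Complex.norm_real] at hb
  refine ⟨Complex.summable_ofReal.1 ha, (le_abs_self _).trans (hb.trans (by rw [div_pow]))⟩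

theorem dk_prime (k : ℕ) {p : ℕ} (hp : p.Prime) : (ArithmeticFunction.zeta^k : ArithmeticFunction ℕ) 1 = 1 ∧
    (ArithmeticFunction.zeta^k : ArithmeticFunction ℕ) p = k := by
  induction k with
  | zero => simp [hp.ne_one]
  | succ k ih =>
    rw [pow_succ]
    constructor
    · rw [ArithmeticFunction.mul_zeta_apply]; simp [ih.1]
    · rw [ArithmeticFunction.mul_zeta_apply, hp.sum_divisors, ih.1, ih.2]

theorem dk_bd {g : ℕ → ℝ} {k : ℕ} (h0 : ∀ n, 0 ≤ g n) (g0 : g 0 = 0) (g1 : g 1 = 1) (gmul : ∀ m n : ℕ, m.Coprime n → g (m * n) = g m * g n)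
    (gp : ∀ p : ℕ, p.Prime → g p ≤ k) (gpp : ∀ (p e : ℕ), p.Prime → 2 ≤ e → g (p^e) = 0) (n : ℕ) :
    g n ≤ ((ArithmeticFunction.zeta^k : ArithmeticFunction ℕ) n : ℕ) := by
  have hm : (ArithmeticFunction.zeta^k : ArithmeticFunction ℕ).IsMultiplicative :=
    ArithmeticFunction.isMultiplicative_zeta.pow
  induction n using Nat.recOnPosPrimePosCoprime with
  | zero => simp [g0]
  | one => rw [g1, (dk_prime k Nat.prime_two).1]; simp
  | prime_pow p e hp he =>
    rcases Nat.lt_or_ge e 2 with h | h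
    · have : e = 1 := by omega
      rw [this, pow_one, (dk_prime k hp).2]; exact gp p hp
    · rw [gpp p e hp h]; positivity
  | coprime a b _ _ hab iha ihb =>
    rw [gmul a b hab, hm.map_mul_of_coprime hab, Nat.cast_mul]
    exact mul_le_mul iha ihb (h0 b) (by positivity)

theorem g_summ {g : ℕ → ℝ} {k : ℕ} (h0 : ∀ n, 0 ≤ g n) (g0 : g 0 = 0) (g1 : g 1 = 1) (gmul : ∀ m n : ℕ, m.Coprime n → g (m * n) = g m * g n)
    (gp : ∀ p : ℕ, p.Prime → g p ≤ (k+1 : ℕ)) (gpp : ∀ (p e : ℕ), p.Prime → 2 ≤ e → g (p^e) = 0) (σ : ℝ) (h1 : 1 < σ) (h2 : σ ≤ 2) :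
    Summable (fun n : ℕ => g n * (n:ℝ)^(-σ)) ∧ ∑' n : ℕ, g n * (n:ℝ)^(-σ) ≤ 2^(k+1) / (σ-1)^(k+1) := by
  obtain ⟨ha, hb⟩ := dk_real k h1 h2
  have hle : ∀ n : ℕ, g n * (n:ℝ)^(-σ) ≤ (((ArithmeticFunction.zeta^(k+1) : ArithmeticFunction ℕ) n : ℕ) : ℝ) * (n:ℝ)^(-σ) := fun n => by
    gcongr; exact dk_bd h0 g0 g1 gmul gp gpp n
  have hs := Summable.of_nonneg_of_le (fun n => mul_nonneg (h0 n) (by positivity)) hle ha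
  exact ⟨hs, (hs.tsum_le_tsum hle ha).trans hb⟩
end MFP
end

namespace MFP
theorem fP_eq (P : Polynomial ℤ) (n : ℕ) (hn : n ≠ 0) :
    fP P n = Nat.card {t : ZMod n // P.eval₂ (Int.castRingHom (ZMod n)) t = 0} := by
  have : NeZero n := ⟨hn⟩
  classical
  have key : ∀ d : ℕ, (n : ℤ) ∣ P.eval (d : ℤ) ↔ P.eval₂ (Int.castRingHom (ZMod n)) (d : ZMod n) = 0 := fun d => by
    have h := Polynomial.eval₂_at_apply (p := P) (Int.castRingHom (ZMod n)) (d : ℤ)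
    simp only [eq_intCast, Int.cast_natCast] at h
    rw [h, ZMod.intCast_zmod_eq_zero_iff_dvd]
  rw [Nat.card_eq_fintype_card, Fintype.card_subtype, fP]
  refine card_nbij (fun d : ℕ => (d : ZMod n)) ?_ ?_ ?_
  · intro d hd
    simp only [coe_filter, mem_filter, mem_univ, true_and, mem_Icc] at hd ⊢
    exact (key d).1 hd.2
  · intro d hd d' hd' h
    simp only [coe_filter, mem_Icc, Set.mem_ofPred_eq] at hd hd'
    have h := (ZMod.natCast_eq_natCast_iff' _ _ _).1 h
    rcases eq_or_lt_of_le hd.1.2 with h1 | h1 <;> rcases eq_or_lt_of_le hd'.1.2 with h2 | h2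
    · rw [h1, h2]
    · rw [h1, Nat.mod_self, Nat.mod_eq_of_lt h2] at h; omega
    · rw [h2, Nat.mod_self, Nat.mod_eq_of_lt h1] at h; omega
    · rwa [Nat.mod_eq_of_lt h1, Nat.mod_eq_of_lt h2] at h
  · intro t ht
    simp only [coe_filter, mem_univ, true_and, Set.mem_ofPred_eq] at ht
    simp only [Set.mem_image, coe_filter, mem_Icc, Set.mem_ofPred_eq]
    by_cases h0 : t.val = 0
    · have h1 : ((n:ℕ) : ZMod n) = t := by rw [CharP.cast_eq_zero]; exact ((ZMod.val_eq_zero t).1 h0).symm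
      exact ⟨n, ⟨⟨Nat.pos_of_ne_zero hn, le_rfl⟩, (key n).2 (by rwa [h1])⟩, h1⟩
    · have h1 : ((t.val:ℕ) : ZMod n) = t := ZMod.natCast_zmod_val t
      exact ⟨t.val, ⟨⟨Nat.pos_of_ne_zero h0, (ZMod.val_lt t).le⟩, (key _).2 (by rwa [h1])⟩, h1⟩

theorem fP_mul (P : Polynomial ℤ) (m n : ℕ) (hm : m ≠ 0) (hn : n ≠ 0) (h : m.Coprime n) :
    fP P (m * n) = fP P m * fP P n := by
  rw [fP_eq P m hm, fP_eq P n hn, fP_eq P _ (mul_ne_zero hm hn), ← Nat.card_prod]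
  let e := ZMod.chineseRemainder h
  have h1 : ∀ t, (e (P.eval₂ (Int.castRingHom _) t)).1 = P.eval₂ (Int.castRingHom (ZMod m)) (e t).1 := fun t => by
    have := Polynomial.hom_eval₂ P (Int.castRingHom _) ((RingHom.fst (ZMod m) (ZMod n)).comp e.toRingHom) t
    rw [RingHom.ext_int (((RingHom.fst (ZMod m) (ZMod n)).comp e.toRingHom).comp (Int.castRingHom _)) (Int.castRingHom _)] at this
    exact this
  have h2 : ∀ t, (e (P.eval₂ (Int.castRingHom _) t)).2 = P.eval₂ (Int.castRingHom (ZMod n)) (e t).2 := fun t => by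
    have := Polynomial.hom_eval₂ P (Int.castRingHom _) ((RingHom.snd (ZMod m) (ZMod n)).comp e.toRingHom) t
    rw [RingHom.ext_int (((RingHom.snd (ZMod m) (ZMod n)).comp e.toRingHom).comp (Int.castRingHom _)) (Int.castRingHom _)] at this
    exact this
  refine Nat.card_eq_of_bijective (fun t => (⟨(e t.1).1, by rw [← h1, t.2, map_zero]; rfl⟩, ⟨(e t.1).2, by rw [← h2, t.2, map_zero]; rfl⟩)) ⟨?_, ?_⟩
  · intro t u htu
    have a1 := congrArg (fun x => x.1.1) htu
    have a2 := congrArg (fun x => x.2.1) htu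
    exact Subtype.ext (e.injective (Prod.ext a1 a2))
  · rintro ⟨⟨x, hx⟩, ⟨y, hy⟩⟩
    have hxy : e (e.symm (x, y)) = (x, y) := e.apply_symm_apply _
    refine ⟨⟨e.symm (x, y), e.injective (Prod.ext ?_ ?_)⟩, ?_⟩
    · rw [h1, hxy, map_zero]; exact hx
    · rw [h2, hxy, map_zero]; exact hy
    · simp only [hxy]
end MFP

/-- **Lemma (twisted Mertens sum).** For a polynomial `P` of degree `ν ≥ 2` with nonzero
discriminant (equivalently, separable over `ℚ`), there are constants `c, C > 0` with
`|Σ_{n ≤ x} μ(n) f_P(n)| ≤ C x exp(−c (log x / log log x)^{1/3})` for all `x ≥ 3`. -/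
theorem moebius_fP_sum (ν : ℕ) (hν : 2 ≤ ν) (c : ℕ → ℤ) (hcν : c ν ≠ 0) (P : Polynomial ℤ)
    (hP : P = ∑ i ∈ Finset.range (ν + 1), Polynomial.C (c i) * Polynomial.X ^ i)
    (hdisc : (P.map (Int.castRingHom ℚ)).Separable) :
    ∃ c₀ C : ℝ, 0 < c₀ ∧ 0 < C ∧ ∀ x : ℝ, 3 ≤ x →
      |∑ n ∈ Finset.Icc 1 (Nat.floor x), (ArithmeticFunction.moebius n : ℝ) * (fP P n : ℝ)| ≤
        C * x * Real.exp (-c₀ * (Real.log x / Real.log (Real.log x)) ^ ((1 : ℝ) / 3)) := by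
  have hg := MFP.rc_good _ P le_rfl hdisc
  obtain ⟨B, hB⟩ := hg.2.1
  obtain ⟨k, hk⟩ := exists_nat_ge (B^2 + B)
  have hB0 : 0 ≤ B := (MFP.rc_nonneg P 0).trans (hB 0)
  let a : ℕ → ℝ := fun n => (ArithmeticFunction.moebius n : ℝ) * (fP P n : ℝ)
  have a0 : a 0 = 0 := by simp [a]
  have a1 : a 1 = 1 := by simp [a, fP]
  have amul : ∀ m n : ℕ, m.Coprime n → a (m * n) = a m * a n := fun m n h => by
    by_cases hm : m = 0
    · simp [a, hm]
    by_cases hn : n = 0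
    · simp [a, hn]
    simp only [a]
    rw [MFP.fP_mul P m n hm hn h, ArithmeticFunction.isMultiplicative_moebius.map_mul_of_coprime h]
    push_cast; ring
  have ap : ∀ p : ℕ, p.Prime → a p = -MFP.rc P p := fun p hp => by
    simp only [a, MFP.rc, if_pos hp, ArithmeticFunction.moebius_apply_prime hp, MFP.fP_eq P p hp.ne_zero]
    push_cast; ring
  have app : ∀ (p e : ℕ), p.Prime → 2 ≤ e → a (p^e) = 0 := fun p e hp he => by
    simp only [a, ArithmeticFunction.moebius_apply_prime_pow hp (by omega : e ≠ 0), if_neg (by omega : e ≠ 1)]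
    simp
  have hr : ∀ p, 0 ≤ MFP.rc P p ∧ MFP.rc P p ≤ B := fun p => ⟨MFP.rc_nonneg P p, hB p⟩
  have hs1 := MFP.g_summ (g := fun n => |a n|) (k := k) (fun n => abs_nonneg _) (by simp [a0]) (by simp [a1])
    (fun m n h => by rw [amul m n h, abs_mul]) (fun p hp => by
      rw [ap p hp, abs_neg, abs_of_nonneg (hr p).1]; push_cast; nlinarith [(hr p).2]) (fun p e hp he => by rw [app p e hp he, abs_zero])
  have hs2 := MFP.g_summ (g := fun n => (a n)^2) (k := k) (fun n => sq_nonneg _) (by simp [a0]) (by simp [a1])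
    (fun m n h => by rw [amul m n h, mul_pow]) (fun p hp => by
      rw [ap p hp, neg_sq]; push_cast; nlinarith [(hr p).2, (hr p).1]) (fun p e hp he => by rw [app p e hp he]; simp)
  obtain ⟨F, c₀, C₀, hPD⟩ := MFP.perron_of hg a0 a1 amul ap app (fun n hn => if_neg hn) hs1 hs2
  exact hPD.final
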